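/- Let F be a finite field with |F| = q, and let Q⁺ be the quadratic form on F⁸ defined by Q⁺(v) = v₁v₅ + v₂v₆ + v₃v₇ + v₄v₈. Let O(Q⁺) be the group of F-linear automorphisms g of F⁸ satisfying Q⁺(g(v)) = Q⁺(v) for all v, let Ω₈⁺(q) be the derived subgroup of O(Q⁺), and let PΩ₈⁺(q) be the quotient of Ω₈⁺(q) by its center. Then PΩ₈⁺(q) is (2,3)-generated if and only if q ≥ 4. -/

import Mathlib

open Matrix

/-- A group is `(2,3)`-generated if it is generated by an element of order 2
together with an element of order 3. -/
def IsTwoThreeGenerated (G : Type*) [Group G] : Prop :=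
  ∃ x y : G, orderOf x = 2 ∧ orderOf y = 3 ∧ Subgroup.closure {x, y} = ⊤

/-- The plus-type quadratic form `Q⁺(v) = v₁v₅ + v₂v₆ + v₃v₇ + v₄v₈` on `F⁸`. -/
def QPlus (F : Type*) [Field F] (v : Fin 8 → F) : F :=
  v 0 * v 4 + v 1 * v 5 + v 2 * v 6 + v 3 * v 7

/-- The group of linear automorphisms of `F⁸` preserving the form `Q`,
as a subgroup of `GL₈(F)`. -/
def orthogonalGroupOf (F : Type*) [Field F] (Q : (Fin 8 → F) → F) :
    Subgroup (GL (Fin 8) F) where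
  carrier := {g | ∀ v, Q ((g : Matrix (Fin 8) (Fin 8) F).mulVec v) = Q v}
  one_mem' := by
    intro v
    simp
  mul_mem' := by
    intro a b ha hb v
    have h : ((a * b : GL (Fin 8) F) : Matrix (Fin 8) (Fin 8) F).mulVec v
        = (a : Matrix (Fin 8) (Fin 8) F).mulVec
            ((b : Matrix (Fin 8) (Fin 8) F).mulVec v) := by
      simp [Matrix.mulVec_mulVec]
    rw [h, ha, hb]
  inv_mem' := by
    intro a ha v
    have h1 : (a : Matrix (Fin 8) (Fin 8) F).mulVec
        (((a⁻¹ : GL (Fin 8) F) : Matrix (Fin 8) (Fin 8) F).mulVec v) = v := by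
      rw [Matrix.mulVec_mulVec, ← Units.val_mul, mul_inv_cancel]
      simp
    calc Q (((a⁻¹ : GL (Fin 8) F) : Matrix (Fin 8) (Fin 8) F).mulVec v)
        = Q ((a : Matrix (Fin 8) (Fin 8) F).mulVec
            (((a⁻¹ : GL (Fin 8) F) : Matrix (Fin 8) (Fin 8) F).mulVec v)) := (ha _).symm
      _ = Q v := by rw [h1]

open scoped commutatorElement

namespace OmegaEight

variable {F : Type*} [Field F]

/-- The polar form of `QPlus`. -/
def polar (u v : Fin 8 → F) : F :=
  u 0 * v 4 + u 4 * v 0 + u 1 * v 5 + u 5 * v 1 + u 2 * v 6 + u 6 * v 2 + u 3 * v 7 + u 7 * v 3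

/-- The standard basis vectors. -/
def bv (F : Type*) [Field F] (i : Fin 8) : Fin 8 → F := Pi.single i 1

/-- The full orthogonal group of the plus-type form. -/
abbrev Orth (F : Type*) [Field F] := ↥(orthogonalGroupOf F (QPlus F))

section Polar

variable (u v w : Fin 8 → F) (c : F)

theorem polar_comm : polar u v = polar v u := by simp only [polar]; ring

@[simp] theorem polar_add_left : polar (u + v) w = polar u w + polar v w := by
  simp only [polar, Pi.add_apply]; ring

@[simp] theorem polar_add_right : polar w (u + v) = polar w u + polar w v := by
  simp only [polar, Pi.add_apply]; ring

@[simp] theorem polar_sub_left : polar (u - v) w = polar u w - polar v w := by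
  simp only [polar, Pi.sub_apply]; ring

@[simp] theorem polar_sub_right : polar w (u - v) = polar w u - polar w v := by
  simp only [polar, Pi.sub_apply]; ring

@[simp] theorem polar_neg_left : polar (-u) w = -polar u w := by
  simp only [polar, Pi.neg_apply]; ring

@[simp] theorem polar_neg_right : polar w (-u) = -polar w u := by
  simp only [polar, Pi.neg_apply]; ring

@[simp] theorem polar_smul_left : polar (c • u) w = c * polar u w := by
  simp only [polar, Pi.smul_apply, smul_eq_mul]; ring

@[simp] theorem polar_smul_right : polar w (c • u) = c * polar w u := by
  simp only [polar, Pi.smul_apply, smul_eq_mul]; ring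

@[simp] theorem polar_zero_left : polar 0 w = 0 := by simp [polar]

@[simp] theorem polar_zero_right : polar w 0 = 0 := by simp [polar]

theorem polar_self : polar u u = 2 * QPlus F u := by simp only [polar, QPlus]; ring

@[simp] theorem QPlus_add : QPlus F (u + v) = QPlus F u + QPlus F v + polar u v := by
  simp only [polar, QPlus, Pi.add_apply]; ring

@[simp] theorem QPlus_sub : QPlus F (u - v) = QPlus F u + QPlus F v - polar u v := by
  simp only [polar, QPlus, Pi.sub_apply]; ring

@[simp] theorem QPlus_smul : QPlus F (c • u) = c ^ 2 * QPlus F u := by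
  simp only [QPlus, Pi.smul_apply, smul_eq_mul]; ring

@[simp] theorem QPlus_neg : QPlus F (-u) = QPlus F u := by
  simp only [QPlus, Pi.neg_apply]; ring

@[simp] theorem QPlus_zero : QPlus F 0 = 0 := by simp [QPlus]

theorem polar_bv_right (i : Fin 8) : polar v (bv F i) = v (i + 4) := by
  fin_cases i <;> simp [polar, bv]

theorem polar_bv_left (i : Fin 8) : polar (bv F i) v = v (i + 4) := by
  rw [polar_comm, polar_bv_right]

theorem QPlus_bv (i : Fin 8) : QPlus F (bv F i) = 0 := by
  fin_cases i <;> simp [QPlus, bv]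

theorem bv_apply (i j : Fin 8) : bv F i j = if j = i then 1 else 0 := by
  simp [bv, Pi.single_apply]

theorem bv_ne_zero (i : Fin 8) : bv F i ≠ 0 := by simp [bv]

theorem eq_zero_of_polar {v : Fin 8 → F} (h : ∀ w, polar v w = 0) : v = 0 := by
  ext i
  have := h (bv F (i + 4))
  rw [polar_bv_right] at this
  rw [show i + 4 + 4 = i by clear this; revert i; decide] at this
  exact this

theorem exists_polar_ne_zero {v : Fin 8 → F} (h : v ≠ 0) : ∃ w, polar v w ≠ 0 := by
  by_contra! hc; exact h (eq_zero_of_polar hc)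

end Polar

/-- The natural representation of the orthogonal group. -/
def lin : Orth F →* Module.End F (Fin 8 → F) where
  toFun g := Matrix.mulVecLin (g.1 : Matrix (Fin 8) (Fin 8) F)
  map_one' := by simp; rfl
  map_mul' g h := by simp [Matrix.mulVecLin_mul]; rfl

@[simp] theorem lin_mul_apply (g h : Orth F) (v : Fin 8 → F) :
    lin (g * h) v = lin g (lin h v) := by rw [map_mul]; rfl

@[simp] theorem lin_one_apply (v : Fin 8 → F) : lin (1 : Orth F) v = v := by rw [map_one]; rfl

@[simp] theorem lin_inv_apply (g : Orth F) (v : Fin 8 → F) : lin g⁻¹ (lin g v) = v := by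
  rw [← lin_mul_apply]; simp

@[simp] theorem lin_apply_inv (g : Orth F) (v : Fin 8 → F) : lin g (lin g⁻¹ v) = v := by
  rw [← lin_mul_apply]; simp

theorem lin_injective : Function.Injective (lin : Orth F → Module.End F (Fin 8 → F)) := by
  intro g h hgh
  apply Subtype.ext
  apply Units.ext
  exact Matrix.ext_of_mulVec_single fun i => LinearMap.congr_fun hgh (Pi.single i 1)

theorem lin_ext {g h : Orth F} (H : ∀ v, lin g v = lin h v) : g = h :=
  lin_injective (LinearMap.ext H)

theorem lin_apply_inj (g : Orth F) {u v : Fin 8 → F} : lin g u = lin g v ↔ u = v :=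
  ⟨fun h => by rw [← lin_inv_apply g u, h, lin_inv_apply], fun h => by rw [h]⟩

@[simp] theorem QPlus_lin (g : Orth F) (v : Fin 8 → F) : QPlus F (lin g v) = QPlus F v := g.2 v

@[simp] theorem polar_lin (g : Orth F) (u v : Fin 8 → F) :
    polar (lin g u) (lin g v) = polar u v := by
  have h := QPlus_lin g (u + v)
  rw [map_add, QPlus_add, QPlus_add, QPlus_lin, QPlus_lin] at h
  exact add_left_cancel h

theorem polar_lin_left (g : Orth F) (u v : Fin 8 → F) :
    polar (lin g u) v = polar u (lin g⁻¹ v) := by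
  rw [← polar_lin g u, lin_apply_inv]

theorem end_injective_of_isometry (f : Module.End F (Fin 8 → F))
    (hf : ∀ v, QPlus F (f v) = QPlus F v) : LinearMap.ker f = ⊥ := by
  rw [LinearMap.ker_eq_bot']
  intro v hv
  apply eq_zero_of_polar
  intro w
  have h := hf (v + w)
  rw [map_add, QPlus_add, QPlus_add, hf, hf, hv, polar_zero_left] at h
  simpa using h

theorem toMatrixAlgEquiv_mulVec (f : Module.End F (Fin 8 → F)) (v : Fin 8 → F) :
    LinearMap.toMatrixAlgEquiv' f *ᵥ v = f v := by
  rw [← Matrix.toLin'_apply]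
  exact LinearMap.congr_fun (Matrix.toLin'_toMatrix' f) v

/-- The element of the orthogonal group attached to a linear isometry. -/
noncomputable def ofIso (f : Module.End F (Fin 8 → F))
    (hf : ∀ v, QPlus F (f v) = QPlus F v) : Orth F :=
  ⟨((LinearMap.isUnit_iff_ker_eq_bot f).2 (end_injective_of_isometry f hf) |>.map
    (LinearMap.toMatrixAlgEquiv' (R := F) (n := Fin 8))).unit, by
      intro v
      have : ((((LinearMap.isUnit_iff_ker_eq_bot f).2 (end_injective_of_isometry f hf) |>.map
        (LinearMap.toMatrixAlgEquiv' (R := F) (n := Fin 8))).unit : GL (Fin 8) F) :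
          Matrix (Fin 8) (Fin 8) F).mulVec v = f v := by
        simp [toMatrixAlgEquiv_mulVec]
      rw [this, hf]⟩

@[simp] theorem lin_ofIso (f : Module.End F (Fin 8 → F))
    (hf : ∀ v, QPlus F (f v) = QPlus F v) (v : Fin 8 → F) : lin (ofIso f hf) v = f v := by
  simp [lin, ofIso, toMatrixAlgEquiv_mulVec]

/-- The linear map underlying a Siegel transformation. -/
def siegelLin (a b : Fin 8 → F) : Module.End F (Fin 8 → F) where
  toFun z := z + polar z a • b - polar z b • a - (QPlus F b * polar z a) • a
  map_add' u v := by
    ext i; simp only [polar_add_left, Pi.add_apply, Pi.sub_apply, Pi.smul_apply, smul_eq_mul]; ring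
  map_smul' c u := by
    ext i
    simp only [polar_smul_left, Pi.add_apply, Pi.sub_apply, Pi.smul_apply, smul_eq_mul,
      RingHom.id_apply]
    ring

open Classical in
/-- The Siegel transformation attached to a singular vector `a` and a vector `b ⟂ a`. -/
noncomputable def siegel (a b : Fin 8 → F) : Orth F :=
  if h : QPlus F a = 0 ∧ polar a b = 0 then
    ofIso (siegelLin a b) (by
      intro z
      obtain ⟨h1, h2⟩ := h
      have h3 : polar b a = 0 := by rw [polar_comm, h2]
      simp only [siegelLin, LinearMap.coe_mk, AddHom.coe_mk, QPlus_sub, QPlus_add, QPlus_smul,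
        polar_smul_left, polar_smul_right, polar_add_left, polar_sub_left, polar_self, h1, h2, h3]
      ring)
  else 1

theorem siegel_apply {a b : Fin 8 → F} (ha : QPlus F a = 0) (hab : polar a b = 0)
    (z : Fin 8 → F) : lin (siegel a b) z =
      z + polar z a • b - polar z b • a - (QPlus F b * polar z a) • a := by
  rw [siegel, dif_pos ⟨ha, hab⟩, lin_ofIso]; rfl

theorem siegel_fix {a b z : Fin 8 → F} (ha : polar z a = 0) (hb : polar z b = 0) :
    lin (siegel a b) z = z := by
  by_cases h : QPlus F a = 0 ∧ polar a b = 0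
  · rw [siegel_apply h.1 h.2, ha, hb]; simp
  · rw [siegel, dif_neg h]; simp

theorem siegel_add {a b b' : Fin 8 → F} (ha : QPlus F a = 0) (hb : polar a b = 0)
    (hb' : polar a b' = 0) : siegel a (b + b') = siegel a b * siegel a b' := by
  apply lin_ext
  intro z
  have h1 : polar b a = 0 := by rw [polar_comm, hb]
  have h2 : polar b' a = 0 := by rw [polar_comm, hb']
  have h3 : polar a a = 0 := by rw [polar_self, ha, mul_zero]
  rw [lin_mul_apply, siegel_apply ha (by rw [polar_add_right, hb, hb', add_zero]),
    siegel_apply ha hb, siegel_apply ha hb']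
  have h4 : polar b b' = polar b' b := polar_comm _ _
  ext i
  simp only [polar_add_left, polar_sub_left, polar_add_right, polar_smul_left, QPlus_add,
    hb, hb', h1, h2, h3, Pi.add_apply, Pi.sub_apply, Pi.smul_apply, smul_eq_mul, h4]
  ring

theorem siegel_zero_right (a : Fin 8 → F) : siegel a (0 : Fin 8 → F) = 1 := by
  apply lin_ext
  intro z
  by_cases h : QPlus F a = 0
  · rw [siegel_apply h (by simp)]; simp
  · rw [siegel, dif_neg (fun h' => h h'.1)]

theorem siegel_zero_left (b : Fin 8 → F) : siegel (0 : Fin 8 → F) b = 1 := by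
  apply lin_ext
  intro z
  rw [siegel_apply (by simp) (by simp)]; simp

theorem siegel_neg {a b : Fin 8 → F} (ha : QPlus F a = 0) (hb : polar a b = 0) :
    siegel a (-b) = (siegel a b)⁻¹ := by
  rw [eq_inv_iff_mul_eq_one, ← siegel_add ha (by rw [polar_neg_right, hb, neg_zero]) hb,
    neg_add_cancel, siegel_zero_right]

theorem siegel_self {a : Fin 8 → F} (ha : QPlus F a = 0) (c : F) : siegel a (c • a) = 1 := by
  apply lin_ext
  intro z
  have h3 : polar a a = 0 := by rw [polar_self, ha, mul_zero]
  rw [siegel_apply ha (by rw [polar_smul_right, h3, mul_zero])]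
  ext i
  simp only [QPlus_smul, ha, polar_smul_right, Pi.add_apply, Pi.sub_apply, Pi.smul_apply,
    smul_eq_mul, lin_one_apply]
  ring

theorem siegel_smul_left {a b : Fin 8 → F} (ha : QPlus F a = 0) (hb : polar a b = 0) (c : F) :
    siegel (c • a) b = siegel a (c • b) := by
  apply lin_ext
  intro z
  rw [siegel_apply (by simp [ha]) (by simp [hb]), siegel_apply ha (by simp [hb])]
  ext i
  simp only [QPlus_smul, polar_smul_right, Pi.add_apply, Pi.sub_apply, Pi.smul_apply,
    smul_eq_mul]
  ring

theorem siegel_conj (g : Orth F) (a b : Fin 8 → F) :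
    g * siegel a b * g⁻¹ = siegel (lin g a) (lin g b) := by
  by_cases h : QPlus F a = 0 ∧ polar a b = 0
  · apply lin_ext
    intro z
    obtain ⟨z, rfl⟩ : ∃ z', z = lin g z' := ⟨lin g⁻¹ z, by simp⟩
    rw [siegel_apply (by simp [h.1]) (by simp [h.2])]
    simp [siegel_apply h.1 h.2]
  · rw [siegel, dif_neg h, siegel, dif_neg (by simpa using h)]; simp

/-- `siegel a b` and `siegel b (-a)` coincide when both vectors are singular. -/
theorem siegel_swap {a b : Fin 8 → F} (ha : QPlus F a = 0) (hb : QPlus F b = 0)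
    (hab : polar a b = 0) : siegel b a = siegel a (-b) := by
  apply lin_ext
  intro z
  rw [siegel_apply hb (by rw [polar_comm, hab]), siegel_apply ha (by simp [hab])]
  ext i
  simp only [QPlus_neg, ha, hb, polar_neg_right, Pi.add_apply, Pi.sub_apply, Pi.smul_apply,
    smul_eq_mul, Pi.neg_apply]
  ring

/-- The subgroup generated by the Siegel transformations along `e` and `f` with parameters
in `W`. -/
def pairGroup (W : Submodule F (Fin 8 → F)) (e f : Fin 8 → F) : Subgroup (Orth F) :=
  Subgroup.closure {g | ∃ b ∈ W, (polar e b = 0 ∧ g = siegel e b) ∨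
    (polar f b = 0 ∧ g = siegel f b)}

/-- The subgroup generated by all Siegel transformations. -/
def siegelGroup (F : Type*) [Field F] : Subgroup (Orth F) :=
  Subgroup.closure {g | ∃ a b, g = siegel a b}

theorem siegel_mem (a b : Fin 8 → F) : siegel a b ∈ siegelGroup F :=
  Subgroup.subset_closure ⟨a, b, rfl⟩

theorem pairGroup_le (W : Submodule F (Fin 8 → F)) (e f : Fin 8 → F) :
    pairGroup W e f ≤ siegelGroup F := by
  refine (Subgroup.closure_le _).2 ?_
  rintro g ⟨b, -, ⟨-, rfl⟩ | ⟨-, rfl⟩⟩ <;> exact siegel_mem _ _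

theorem pairGroup_fix {W : Submodule F (Fin 8 → F)} {e f c : Fin 8 → F} (he : e ∈ W) (hf : f ∈ W)
    (hc : ∀ w ∈ W, polar c w = 0) {g : Orth F} (hg : g ∈ pairGroup W e f) : lin g c = c := by
  induction hg using Subgroup.closure_induction with
  | mem g hg =>
    obtain ⟨b, hb, ⟨-, rfl⟩ | ⟨-, rfl⟩⟩ := hg
    · exact siegel_fix (hc _ he) (hc _ hb)
    · exact siegel_fix (hc _ hf) (hc _ hb)
  | one => simp
  | mul g h _ _ hg hh => rw [lin_mul_apply, hh, hg]
  | inv g _ hg => conv_lhs => rw [← hg]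
                  simp

/-- Two mutually orthogonal hyperbolic pairs inside a nondegenerate subspace. -/
structure HypPairs (W : Submodule F (Fin 8 → F)) (e f e' f' : Fin 8 → F) : Prop where
  nondeg : ∀ m ∈ W, m ≠ 0 → ∃ b ∈ W, polar m b ≠ 0
  he : e ∈ W
  hf : f ∈ W
  he' : e' ∈ W
  hf' : f' ∈ W
  qe : QPlus F e = 0
  qf : QPlus F f = 0
  qe' : QPlus F e' = 0
  qf' : QPlus F f' = 0
  ef : polar e f = 1
  ef' : polar e' f' = 1
  ee' : polar e e' = 0
  e_f' : polar e f' = 0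
  fe' : polar f e' = 0
  ff' : polar f f' = 0

namespace HypPairs

variable {W : Submodule F (Fin 8 → F)} {e f e' f' : Fin 8 → F}

theorem mem_e (_H : HypPairs W e f e' f')
    {b : Fin 8 → F} (hb : b ∈ W) (h : polar e b = 0) : siegel e b ∈ pairGroup W e f :=
  Subgroup.subset_closure ⟨b, hb, Or.inl ⟨h, rfl⟩⟩

theorem mem_f (_H : HypPairs W e f e' f')
    {b : Fin 8 → F} (hb : b ∈ W) (h : polar f b = 0) : siegel f b ∈ pairGroup W e f :=
  Subgroup.subset_closure ⟨b, hb, Or.inr ⟨h, rfl⟩⟩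

theorem fe (H : HypPairs W e f e' f') : polar f e = 1 := by rw [polar_comm, H.ef]
theorem f'e' (H : HypPairs W e f e' f') : polar f' e' = 1 := by rw [polar_comm, H.ef']
theorem e'e (H : HypPairs W e f e' f') : polar e' e = 0 := by rw [polar_comm, H.ee']
theorem e'f (H : HypPairs W e f e' f') : polar e' f = 0 := by rw [polar_comm, H.fe']
theorem f'f (H : HypPairs W e f e' f') : polar f' f = 0 := by rw [polar_comm, H.ff']

theorem exists_normalize_plane (H : HypPairs W e f e' f')
    (l k : F) (hl : l ≠ 0) :
    ∃ h ∈ pairGroup W e f, lin h (l • e + k • f) = e + (l * k) • f := by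
  have q1 := polar_self e
  have q2 := polar_self f
  have q3 := polar_self e'
  have q4 := polar_self f'
  rw [H.qe, mul_zero] at q1
  rw [H.qf, mul_zero] at q2
  rw [H.qe', mul_zero] at q3
  rw [H.qf', mul_zero] at q4
  refine ⟨siegel f (-(e' + (k * (l - 1)) • f')) * siegel e ((l - 1) • f') * siegel f (l⁻¹ • e'),
    mul_mem (mul_mem (H.mem_f ?_ ?_) (H.mem_e ?_ ?_)) (H.mem_f ?_ ?_), ?_⟩
  · exact neg_mem (add_mem H.he' (W.smul_mem _ H.hf'))
  · simp [H.fe', H.ff']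
  · exact W.smul_mem _ H.hf'
  · simp [H.e_f']
  · exact W.smul_mem _ H.he'
  · simp [H.fe']
  · rw [lin_mul_apply, lin_mul_apply, siegel_apply H.qf (b := l⁻¹ • e') (by simp [H.fe']),
      siegel_apply H.qe (by simp [H.e_f']), siegel_apply H.qf (by simp [H.fe', H.ff'])]
    ext i
    simp only [polar_add_left, polar_sub_left, polar_neg_left, polar_smul_left, polar_add_right,
      polar_neg_right, polar_smul_right, QPlus_add, QPlus_neg, QPlus_smul, H.qe, H.qf, H.qe',
      H.qf', H.ef, H.ef', H.ee', H.e_f', H.fe', H.ff', H.fe, H.f'e', H.e'e, H.e'f, H.f'f,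
      q1, q2, q3, q4, Pi.add_apply, Pi.sub_apply, Pi.neg_apply, Pi.smul_apply, smul_eq_mul]
    field_simp
    ring

theorem exists_normalize_of_ne (H : HypPairs W e f e' f')
    {z : Fin 8 → F} (hz : z ∈ W) (h : polar z f ≠ 0) :
    ∃ h ∈ pairGroup W e f, lin h z = e + QPlus F z • f := by
  have q1 := polar_self e
  have q2 := polar_self f
  rw [H.qe, mul_zero] at q1
  rw [H.qf, mul_zero] at q2
  set l := polar z f with hl
  set m := z - l • e - polar z e • f with hm
  have hmW : m ∈ W := sub_mem (sub_mem hz (W.smul_mem _ H.he)) (W.smul_mem _ H.hf)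
  have hfm : polar f m = 0 := by
    rw [hm]; simp [H.fe, q2, polar_comm f z, ← hl]
  have hem : polar e m = 0 := by
    rw [hm]; simp [H.ef, q1, polar_comm e z]
  have hz' : z = l • e + polar z e • f + m := by rw [hm]; abel
  obtain ⟨k, hk⟩ : ∃ k, lin (siegel f (-(l⁻¹ • m))) z = l • e + k • f := by
    rw [siegel_apply H.qf (by simp [hfm]), ← hl]
    refine ⟨polar z e - polar z (-(l⁻¹ • m)) - QPlus F (-(l⁻¹ • m)) * l, ?_⟩
    ext i
    have := congrFun hz' i
    simp only [Pi.add_apply, Pi.sub_apply, Pi.neg_apply, Pi.smul_apply, smul_eq_mul] at this ⊢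
    have h2 : l * -(l⁻¹ * m i) = - m i := by field_simp
    rw [h2]
    linear_combination this
  obtain ⟨g, hg, hg'⟩ := H.exists_normalize_plane l k h
  refine ⟨g * siegel f (-(l⁻¹ • m)), mul_mem hg (H.mem_f (neg_mem (W.smul_mem _ hmW))
    (by simp [hfm])), ?_⟩
  have hq := QPlus_lin (siegel f (-(l⁻¹ • m))) z
  rw [hk] at hq
  simp [H.qe, H.qf, H.ef] at hq
  rw [lin_mul_apply, hk, hg', ← hq, mul_comm]

theorem exists_normalize (H : HypPairs W e f e' f')
    {z : Fin 8 → F} (hz : z ∈ W) (h0 : z ≠ 0) :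
    ∃ h ∈ pairGroup W e f, lin h z = e + QPlus F z • f := by
  by_cases hzf : polar z f = 0
  swap
  · exact H.exists_normalize_of_ne hz hzf
  suffices ∃ b ∈ W, polar e b = 0 ∧ polar f b = 0 ∧ polar z b + QPlus F b * polar z e ≠ 0 by
    obtain ⟨b, hb, heb, hfb, hne⟩ := this
    have hmem : lin (siegel e b) z ∈ W := by
      rw [siegel_apply H.qe heb]
      exact sub_mem (sub_mem (add_mem hz (W.smul_mem _ hb)) (W.smul_mem _ H.he))
        (W.smul_mem _ H.he)
    obtain ⟨g, hg, hg'⟩ := H.exists_normalize_of_ne hmem (by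
      rw [siegel_apply H.qe heb]
      simp only [polar_add_left, polar_sub_left, polar_smul_left, hzf, H.ef, polar_comm b f, hfb]
      intro h
      apply hne
      linear_combination -h)
    refine ⟨g * siegel e b, mul_mem hg (H.mem_e hb heb), ?_⟩
    rw [lin_mul_apply, hg', QPlus_lin]
  by_cases hze : polar z e = 0
  · obtain ⟨b, hb, hzb⟩ := H.nondeg z hz h0
    have q1 := polar_self e
    have q2 := polar_self f
    rw [H.qe, mul_zero] at q1
    rw [H.qf, mul_zero] at q2
    refine ⟨b - polar b f • e - polar b e • f, sub_mem (sub_mem hb (W.smul_mem _ H.he))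
      (W.smul_mem _ H.hf), ?_, ?_, ?_⟩
    · simp [q1, H.ef, polar_comm e b]
    · simp [q2, H.fe, polar_comm f b]
    · simpa [hze, hzf] using hzb
  · by_contra! hc
    have h1 := hc e' H.he' H.ee' H.fe'
    have h2 := hc f' H.hf' H.e_f' H.ff'
    have h3 := hc (e' + f') (add_mem H.he' H.hf') (by simp [H.ee', H.e_f'])
      (by simp [H.fe', H.ff'])
    rw [H.qe', zero_mul, add_zero] at h1
    rw [H.qf', zero_mul, add_zero] at h2
    simp [h1, h2, H.qe', H.qf', H.ef', hze] at h3

/-- Vectors of equal norm are conjugate. -/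
theorem exists_map (H : HypPairs W e f e' f')
    {z z' : Fin 8 → F} (hz : z ∈ W) (h0 : z ≠ 0) (hz' : z' ∈ W) (h0' : z' ≠ 0)
    (hQ : QPlus F z = QPlus F z') : ∃ h ∈ pairGroup W e f, lin h z = z' := by
  obtain ⟨g, hg, hgz⟩ := H.exists_normalize hz h0
  obtain ⟨k, hk, hkz⟩ := H.exists_normalize hz' h0'
  refine ⟨k⁻¹ * g, mul_mem (inv_mem hk) hg, ?_⟩
  rw [lin_mul_apply, hgz, hQ, ← hkz, lin_inv_apply]

end HypPairs

theorem hypPairs_top (i j : Fin 8) (h : j ≠ i ∧ j ≠ i + 4) :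
    HypPairs (⊤ : Submodule F (Fin 8 → F)) (bv F i) (bv F (i + 4)) (bv F j) (bv F (j + 4)) where
  nondeg m _ hm := by
    obtain ⟨w, hw⟩ := exists_polar_ne_zero hm
    exact ⟨w, trivial, hw⟩
  he := trivial
  hf := trivial
  he' := trivial
  hf' := trivial
  qe := QPlus_bv _
  qf := QPlus_bv _
  qe' := QPlus_bv _
  qf' := QPlus_bv _
  ef := by simp [polar_bv_left, bv_apply]
  ef' := by simp [polar_bv_left, bv_apply]
  ee' := by rw [polar_bv_left, bv_apply, if_neg]; revert i j; decide
  e_f' := by rw [polar_bv_left, bv_apply, if_neg]; revert i j; decide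
  fe' := by rw [polar_bv_left, bv_apply, if_neg]; revert i j; decide
  ff' := by rw [polar_bv_left, bv_apply, if_neg]; revert i j; decide

theorem exists_siegelGroup_map {z z' : Fin 8 → F} (h0 : z ≠ 0) (h0' : z' ≠ 0)
    (hQ : QPlus F z = QPlus F z') : ∃ h ∈ siegelGroup F, lin h z = z' := by
  obtain ⟨h, hh, H⟩ := (hypPairs_top 0 1 (by decide)).exists_map (F := F) (z := z) (z' := z')
    trivial h0 trivial h0' hQ
  exact ⟨h, pairGroup_le _ _ _ hh, H⟩

theorem siegelGroup_le_pairGroup :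
    siegelGroup F ≤ pairGroup (⊤ : Submodule F (Fin 8 → F)) (bv F 0) (bv F 4) := by
  refine (Subgroup.closure_le _).2 ?_
  rintro g ⟨a, b, rfl⟩
  by_cases h : QPlus F a = 0 ∧ polar a b = 0
  swap
  · rw [siegel, dif_neg h]; exact one_mem _
  by_cases ha : a = 0
  · rw [ha, siegel_zero_left]; exact one_mem _
  have H := (hypPairs_top (F := F) 0 1 (by decide))
  obtain ⟨g, hg, hga⟩ := H.exists_map (z := a) (z' := bv F 0) trivial ha trivial (bv_ne_zero _)
    (by rw [h.1, QPlus_bv])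
  have : siegel a b = g⁻¹ * siegel (lin g a) (lin g b) * g := by
    rw [← siegel_conj]; group
  rw [this, hga]
  exact mul_mem (mul_mem (inv_mem hg) (H.mem_e trivial (by rw [← hga, polar_lin, h.2]))) hg

/-- A subgroup containing a full unipotent radical together with an element moving its centre
to an opposite vector contains every Siegel transformation. -/
theorem siegelGroup_le_of {H : Subgroup (Orth F)}
    (h1 : ∀ b, polar (bv F 0) b = 0 → siegel (bv F 0) b ∈ H)
    {h : Orth F} (hh : h ∈ H) (hb : lin h (bv F 0) = bv F 4) : siegelGroup F ≤ H := by
  refine siegelGroup_le_pairGroup.trans ((Subgroup.closure_le _).2 ?_)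
  rintro g ⟨b, -, ⟨hb', rfl⟩ | ⟨hb', rfl⟩⟩
  · exact h1 _ hb'
  · have : siegel (bv F 4) b = h * siegel (bv F 0) (lin h⁻¹ b) * h⁻¹ := by
      rw [siegel_conj, hb, lin_apply_inv]
    rw [this]
    refine mul_mem (mul_mem hh (h1 _ ?_)) (inv_mem hh)
    rw [← polar_lin_left, hb, hb']

end OmegaEight

namespace OmegaEight

variable {F : Type*} [Field F]

instance siegelGroup_normal : (siegelGroup F).Normal := by
  refine ⟨fun n hn g => ?_⟩
  induction hn using Subgroup.closure_induction with
  | mem n hn => obtain ⟨a, b, rfl⟩ := hn; rw [siegel_conj]; exact siegel_mem _ _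
  | one => simp
  | mul m n _ _ hm hn => rw [conj_mul.symm]; exact mul_mem hm hn
  | inv n _ hn => rw [← conj_inv]; exact inv_mem hn

/-- The vectors `b ⟂ a` whose Siegel transformation along `a` lies in `H`. -/
def radical (H : Subgroup (Orth F)) (a : Fin 8 → F) (ha : QPlus F a = 0) :
    AddSubgroup (Fin 8 → F) where
  carrier := {b | polar a b = 0 ∧ siegel a b ∈ H}
  add_mem' {b c} hb hc := ⟨by rw [polar_add_right, hb.1, hc.1, add_zero], by
    rw [siegel_add ha hb.1 hc.1]; exact mul_mem hb.2 hc.2⟩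
  zero_mem' := ⟨polar_zero_right _, by rw [siegel_zero_right]; exact one_mem _⟩
  neg_mem' {b} hb := ⟨by rw [polar_neg_right, hb.1, neg_zero], by
    rw [siegel_neg ha hb.1]; exact inv_mem hb.2⟩

/-- The isometry shifting the coordinates cyclically. -/
noncomputable def shift (k : Fin 8) : Orth F :=
  ofIso (LinearMap.funLeft F F (fun i => i + k)) (by
    intro v
    fin_cases k <;> simp [QPlus, LinearMap.funLeft_apply] <;> ring)

theorem lin_shift (k : Fin 8) (v : Fin 8 → F) : lin (shift k) v = fun i => v (i + k) := by
  rw [shift, lin_ofIso]; rfl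

theorem lin_shift_bv (k i : Fin 8) : lin (shift k) (bv F i) = bv F (i - k) := by
  rw [lin_shift]
  ext j
  rw [bv_apply, bv_apply]
  congr 1
  simp only [eq_iff_iff]
  constructor <;> intro h
  · rw [← h]; simp
  · rw [h]; simp

theorem siegel_mem_commutator {a e f d : Fin 8 → F} (ha : QPlus F a = 0) (he : QPlus F e = 0)
    (hf : QPlus F f = 0) (hef : polar e f = 1) (hae : polar a e = 0) (haf : polar a f = 0)
    (had : polar a d = 0) (hed : polar e d = 0) (hfd : polar f d = 0) :
    siegel a (d - QPlus F d • f) ∈ ⁅siegelGroup F, siegelGroup F⁆ := by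
  have h1 : lin (siegel f d) a = a := siegel_fix haf had
  have h2 : lin (siegel f d) e = e + (d - QPlus F d • f) := by
    rw [siegel_apply hf hfd, hef, hed]
    simp; abel
  have h3 := siegel_conj (siegel f d) a e
  rw [h1, h2, siegel_add ha hae (by simp [had, haf])] at h3
  have h4 : siegel a (d - QPlus F d • f) = ⁅(siegel a e)⁻¹, siegel f d⁆ := by
    rw [commutatorElement_def, eq_inv_mul_iff_mul_eq.2 h3.symm]
    group
  rw [h4]
  exact Subgroup.commutator_mem_commutator (inv_mem (siegel_mem _ _)) (siegel_mem _ _)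

theorem eq_sum_bv (v : Fin 8 → F) : v = v 0 • bv F 0 + v 1 • bv F 1 + v 2 • bv F 2 + v 3 • bv F 3 +
    v 4 • bv F 4 + v 5 • bv F 5 + v 6 • bv F 6 + v 7 • bv F 7 := by
  ext i
  fin_cases i <;> simp [bv_apply]

theorem siegel_bv_zero_mem_commutator {b : Fin 8 → F} (hb : polar (bv F 0) b = 0) :
    siegel (bv F 0) b ∈ ⁅siegelGroup F, siegelGroup F⁆ := by
  have hpol : ∀ i j : Fin 8, polar (bv F i) (bv F j) = if i + 4 = j then 1 else 0 := fun i j => by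
    rw [polar_bv_left, bv_apply]
  have key : ∀ i : Fin 8, i ≠ 0 → i ≠ 4 → ∀ t : F, siegel (bv F 0) (t • bv F i) ∈
      ⁅siegelGroup F, siegelGroup F⁆ := by
    intro i hi hi4 t
    obtain ⟨j, hj0, hj4, hji, hji4⟩ : ∃ j : Fin 8, j ≠ 0 ∧ j ≠ 4 ∧ j ≠ i ∧ j + 4 ≠ i := by
      decide +revert
    have hh := siegel_mem_commutator (a := bv F 0) (e := bv F j) (f := bv F (j + 4))
      (d := t • bv F i) (QPlus_bv _) (QPlus_bv _) (QPlus_bv _) (by simp [hpol])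
      (by rw [hpol, if_neg]; decide +revert) (by rw [hpol, if_neg]; decide +revert)
      (by rw [polar_smul_right, hpol, if_neg, mul_zero]; decide +revert)
      (by rw [polar_smul_right, hpol, if_neg hji4, mul_zero])
      (by rw [polar_smul_right, hpol, if_neg, mul_zero]; decide +revert)
    simpa [QPlus_bv] using hh
  have hperp : ∀ i : Fin 8, i ≠ 4 → ∀ t : F, polar (bv F 0) (t • bv F i) = 0 := by
    intro i hi t
    rw [polar_smul_right, hpol, if_neg, mul_zero]; decide +revert
  have hr : ∀ i : Fin 8, i ≠ 4 → ∀ t : F, t • bv F i ∈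
      radical (⁅siegelGroup F, siegelGroup F⁆) (bv F 0) (QPlus_bv 0) := by
    intro i hi t
    refine ⟨hperp i hi t, ?_⟩
    by_cases h0 : i = 0
    · rw [h0, siegel_self (QPlus_bv 0)]; exact one_mem _
    · exact key i h0 hi t
  have hb4 : b 4 = 0 := by rwa [polar_bv_left] at hb
  suffices b ∈ radical (⁅siegelGroup F, siegelGroup F⁆) (bv F 0) (QPlus_bv 0) from this.2
  rw [eq_sum_bv b, hb4, zero_smul, add_zero]
  refine add_mem (add_mem (add_mem (add_mem (add_mem (add_mem ?_ ?_) ?_) ?_) ?_) ?_) ?_ <;>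
    exact hr _ (by decide) _

theorem siegelGroup_le_commutator_self : siegelGroup F ≤ ⁅siegelGroup F, siegelGroup F⁆ := by
  refine siegelGroup_le_pairGroup.trans ((Subgroup.closure_le _).2 ?_)
  rintro g ⟨b, -, ⟨hb, rfl⟩ | ⟨hb, rfl⟩⟩
  · exact siegel_bv_zero_mem_commutator hb
  · have : siegel (bv F 4) b = shift 4 * siegel (bv F 0) (lin (shift 4)⁻¹ b) * (shift 4)⁻¹ := by
      rw [siegel_conj, lin_shift_bv, lin_apply_inv]; rfl
    rw [this]
    refine Subgroup.Normal.conj_mem inferInstance _ (siegel_bv_zero_mem_commutator ?_) _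
    rw [← polar_lin_left, lin_shift_bv]
    exact hb

theorem siegelGroup_le_commutator : siegelGroup F ≤ commutator (Orth F) :=
  siegelGroup_le_commutator_self.trans (Subgroup.commutator_mono le_top le_top)

theorem siegel_map_partner {e f z : Fin 8 → F} (he : QPlus F e = 0) (hf : QPlus F f = 0)
    (hz : QPlus F z = 0) (hef : polar e f = 1) (hez : polar e z = 1) :
    lin (siegel e (f - z)) z = f ∧ lin (siegel e (f - z)) e = e := by
  have h1 : polar e (f - z) = 0 := by simp [hef, hez]
  refine ⟨?_, siegel_fix (by rw [polar_self, he, mul_zero]) h1⟩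
  rw [siegel_apply he h1]
  have h2 : polar z e = 1 := by rw [polar_comm, hez]
  simp [h2, hf, hz, polar_self, polar_comm f z]

/-- The vectors orthogonal to the first hyperbolic pair. -/
def firstPerp (F : Type*) [Field F] : Submodule F (Fin 8 → F) where
  carrier := {v | v 0 = 0 ∧ v 4 = 0}
  add_mem' ha hb := by simp [ha.1, ha.2, hb.1, hb.2]
  zero_mem' := by simp
  smul_mem' c v hv := by simp [hv.1, hv.2]

theorem hypPairs_firstPerp :
    HypPairs (firstPerp F) (bv F 1) (bv F 5) (bv F 2) (bv F 6) := by
  have H := hypPairs_top (F := F) 1 2 (by decide)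
  refine ⟨?_, ?_, ?_, ?_, ?_, H.qe, H.qf, H.qe', H.qf', H.ef, H.ef', H.ee', H.e_f', H.fe', H.ff'⟩
  · rintro m ⟨hm0, hm4⟩ hm
    obtain ⟨w, hw⟩ := exists_polar_ne_zero hm
    refine ⟨w - w 0 • bv F 0 - w 4 • bv F 4, ?_, ?_⟩
    · constructor <;> simp [bv_apply]
    · simpa [polar_bv_right, hm0, hm4] using hw
  all_goals constructor <;> simp [bv_apply]

theorem exists_fix_four (g : Orth F) : ∃ ε ∈ siegelGroup F, ∀ i : Fin 8,
    i = 0 ∨ i = 4 ∨ i = 1 ∨ i = 5 → lin (ε * g) (bv F i) = bv F i := by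
  have hpol : ∀ i j : Fin 8, polar (bv F i) (bv F j) = if i + 4 = j then 1 else 0 := fun i j => by
    rw [polar_bv_left, bv_apply]
  have hne : ∀ (g : Orth F) i, lin g (bv F i) ≠ 0 := by
    intro g i h
    apply bv_ne_zero (F := F) i
    rw [← lin_inv_apply g (bv F i), h, map_zero]
  obtain ⟨ε₁, hε₁, h₁⟩ := exists_siegelGroup_map (hne g 0) (bv_ne_zero 0)
    (by rw [QPlus_lin, QPlus_bv])
  obtain ⟨ε₂, hε₂, h₂, h₂'⟩ : ∃ ε ∈ siegelGroup F, lin (ε * g) (bv F 0) = bv F 0 ∧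
      lin (ε * g) (bv F 4) = bv F 4 := by
    have := siegel_map_partner (e := bv F 0) (f := bv F 4) (z := lin (ε₁ * g) (bv F 4))
      (QPlus_bv _) (QPlus_bv _) (by rw [QPlus_lin, QPlus_bv]) (by simp [hpol])
      (by nth_rw 1 [← h₁]
          rw [← lin_mul_apply, polar_lin]; simp [hpol])
    refine ⟨siegel (bv F 0) (bv F 4 - lin (ε₁ * g) (bv F 4)) * ε₁,
      mul_mem (siegel_mem _ _) hε₁, ?_, ?_⟩
    · rw [mul_assoc, lin_mul_apply, show lin (ε₁ * g) (bv F 0) = bv F 0 by rw [lin_mul_apply, h₁],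
        this.2]
    · rw [mul_assoc, lin_mul_apply, this.1]
  have hmem : ∀ k : Orth F, lin k (bv F 0) = bv F 0 → lin k (bv F 4) = bv F 4 → ∀ i : Fin 8,
      i ≠ 0 → i ≠ 4 → lin k (bv F i) ∈ firstPerp F := by
    intro k h0 h4 i hi hi'
    constructor
    · have : polar (lin k (bv F i)) (bv F 4) = 0 := by
        rw [← h4, polar_lin, hpol, if_neg]; decide +revert
      rwa [polar_bv_right] at this
    · have : polar (lin k (bv F i)) (bv F 0) = 0 := by
        rw [← h0, polar_lin, hpol, if_neg]; decide +revert
      rwa [polar_bv_right] at this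
  have H := hypPairs_firstPerp (F := F)
  obtain ⟨ε₃, hε₃, h₃⟩ := H.exists_map (hmem _ h₂ h₂' 1 (by decide) (by decide)) (hne _ _) H.he
    (bv_ne_zero _) (by rw [QPlus_lin])
  have p0 : ∀ w ∈ firstPerp F, polar (bv F 0) w = 0 := fun w hw => by
    rw [polar_bv_left]; exact hw.2
  have p4 : ∀ w ∈ firstPerp F, polar (bv F 4) w = 0 := fun w hw => by
    rw [polar_bv_left]; exact hw.1
  have k0 : lin (ε₃ * (ε₂ * g)) (bv F 0) = bv F 0 := by
    rw [lin_mul_apply, h₂, pairGroup_fix H.he H.hf p0 hε₃]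
  have k4 : lin (ε₃ * (ε₂ * g)) (bv F 4) = bv F 4 := by
    rw [lin_mul_apply, h₂', pairGroup_fix H.he H.hf p4 hε₃]
  have k1 : lin (ε₃ * (ε₂ * g)) (bv F 1) = bv F 1 := by rw [lin_mul_apply, h₃]
  set z := lin (ε₃ * (ε₂ * g)) (bv F 5) with hz
  have hzW : bv F 5 - z ∈ firstPerp F :=
    sub_mem H.hf (hmem _ k0 k4 5 (by decide) (by decide))
  have := siegel_map_partner (e := bv F 1) (f := bv F 5) (z := z)
      (QPlus_bv _) (QPlus_bv _) (by rw [hz, QPlus_lin, QPlus_bv]) (by simp [hpol])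
      (by rw [hz]; nth_rw 1 [← k1]
          rw [polar_lin]; simp [hpol])
  refine ⟨siegel (bv F 1) (bv F 5 - z) * ε₃ * ε₂,
    mul_mem (mul_mem (siegel_mem _ _) (pairGroup_le _ _ _ hε₃)) hε₂, ?_⟩
  rw [show siegel (bv F 1) (bv F 5 - z) * ε₃ * ε₂ * g = siegel (bv F 1) (bv F 5 - z) *
    (ε₃ * (ε₂ * g)) by group]
  rintro i (rfl | rfl | rfl | rfl)
  · rw [lin_mul_apply, k0, siegel_fix (p0 _ H.he) (p0 _ hzW)]
  · rw [lin_mul_apply, k4, siegel_fix (p4 _ H.he) (p4 _ hzW)]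
  · rw [lin_mul_apply, k1, this.2]
  · rw [lin_mul_apply, this.1]

theorem commutator_le_siegelGroup : commutator (Orth F) ≤ siegelGroup F := by
  rw [commutator_def, Subgroup.commutator_le]
  intro g _ h _
  obtain ⟨ε, hε, Hε⟩ := exists_fix_four g
  obtain ⟨δ, hδ, Hδ⟩ := exists_fix_four (shift 2 * h * (shift 2)⁻¹)
  set g' := ε * g with hg'
  set δ' := (shift 2)⁻¹ * δ * shift 2 with hδ'
  have hδ'm : δ' ∈ siegelGroup F := by
    have := siegelGroup_normal.conj_mem δ hδ (shift 2)⁻¹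
    simpa using this
  set h' := δ' * h with hh'
  have Hh : ∀ i : Fin 8, i = 2 ∨ i = 6 ∨ i = 3 ∨ i = 7 → lin h' (bv F i) = bv F i := by
    intro i hi
    have h1 := Hδ (i - 2) (by decide +revert)
    have h2 : lin (shift 2) (bv F i) = bv F (i - 2) := lin_shift_bv _ _
    have h3 : shift 2 * h' = δ * (shift 2 * h * (shift 2)⁻¹) * shift 2 := by
      rw [hh', hδ']; group
    have h4 := congrArg (fun k => lin k (bv F i)) h3
    simp only [lin_mul_apply, h2] at h4
    simp only [lin_mul_apply] at h1
    rw [h1, ← h2, lin_apply_inj] at h4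
    exact h4
  have key : Commute g' h' := by
    apply lin_ext
    have c1 : ∀ v : Fin 8 → F, v 2 = 0 → v 6 = 0 → v 3 = 0 → v 7 = 0 → lin g' v = v := by
      intro v v2 v6 v3 v7
      rw [eq_sum_bv v]
      simp [v2, v3, v6, v7, Hε]
    have c2 : ∀ v : Fin 8 → F, v 0 = 0 → v 4 = 0 → v 1 = 0 → v 5 = 0 → lin h' v = v := by
      intro v v2 v6 v3 v7
      rw [eq_sum_bv v]
      simp [v2, v3, v6, v7, Hh]
    have d1 : ∀ (v : Fin 8 → F) i, (i = 2 ∨ i = 6 ∨ i = 3 ∨ i = 7) → (lin h' v) (i + 4) =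
        v (i + 4) := by
      intro v i hi
      rw [← polar_bv_right (lin h' v), ← polar_bv_right v]
      nth_rw 1 [← Hh i hi]
      rw [polar_lin]
    have d2 : ∀ (v : Fin 8 → F) i, (i = 0 ∨ i = 4 ∨ i = 1 ∨ i = 5) → (lin g' v) (i + 4) =
        v (i + 4) := by
      intro v i hi
      rw [← polar_bv_right (lin g' v), ← polar_bv_right v]
      nth_rw 1 [← Hε i hi]
      rw [polar_lin]
    intro v
    obtain ⟨u, w, rfl, u2, u6, u3, u7, w0, w4, w1, w5⟩ : ∃ u w : Fin 8 → F, v = u + w ∧ u 2 = 0 ∧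
        u 6 = 0 ∧ u 3 = 0 ∧ u 7 = 0 ∧ w 0 = 0 ∧ w 4 = 0 ∧ w 1 = 0 ∧ w 5 = 0 :=
      ⟨![v 0, v 1, 0, 0, v 4, v 5, 0, 0], ![0, 0, v 2, v 3, 0, 0, v 6, v 7], by
        ext i; fin_cases i <;> simp, by simp⟩
    have e1 : lin g' (lin h' u) = lin h' u := c1 _ (by simpa [u2] using d1 u 6 (by simp))
      (by simpa [u6] using d1 u 2 (by simp)) (by simpa [u3] using d1 u 7 (by simp))
      (by simpa [u7] using d1 u 3 (by simp))
    have e2 : lin h' (lin g' w) = lin g' w := c2 _ (by simpa [w0] using d2 w 4 (by simp))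
      (by simpa [w4] using d2 w 0 (by simp)) (by simpa [w1] using d2 w 5 (by simp))
      (by simpa [w5] using d2 w 1 (by simp))
    rw [lin_mul_apply g', lin_mul_apply h', map_add, map_add, map_add, map_add, e1, e2,
      c1 u u2 u6 u3 u7, c2 w w0 w4 w1 w5]
  rw [← QuotientGroup.eq_one_iff]
  have hg : (g : Orth F ⧸ siegelGroup F) = g' := by
    rw [hg', QuotientGroup.mk_mul, (QuotientGroup.eq_one_iff ε).2 hε, one_mul]
  have hh : (h : Orth F ⧸ siegelGroup F) = h' := by
    rw [hh', QuotientGroup.mk_mul, (QuotientGroup.eq_one_iff δ').2 hδ'm, one_mul]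
  have : ((⁅g, h⁆ : Orth F) : Orth F ⧸ siegelGroup F) = ⁅(g : Orth F ⧸ siegelGroup F), ↑h⁆ := rfl
  rw [this, hg, hh]
  have h6 : ⁅(g' : Orth F ⧸ siegelGroup F), ↑h'⁆ = ((⁅g', h'⁆ : Orth F) : Orth F ⧸ siegelGroup F) :=
    rfl
  rw [h6, commutatorElement_eq_one_iff_commute.2 key, QuotientGroup.mk_one]

theorem commutator_eq_siegelGroup : commutator (Orth F) = siegelGroup F :=
  le_antisymm commutator_le_siegelGroup siegelGroup_le_commutator

/-- The group of Siegel transformations acts irreducibly. -/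
theorem eq_top_of_invariant (W : Submodule F (Fin 8 → F))
    (hW : ∀ g ∈ siegelGroup F, ∀ w ∈ W, lin g w ∈ W) {v : Fin 8 → F} (hv : v ∈ W) (h0 : v ≠ 0) :
    W = ⊤ := by
  have key : ∀ v ∈ W, v ≠ 0 → ∀ v', v' ≠ 0 → QPlus F v = QPlus F v' → v' ∈ W := by
    intro v hv h0 v' h0' hQ
    obtain ⟨g, hg, rfl⟩ := exists_siegelGroup_map h0 h0' hQ
    exact hW g hg v hv
  have k1 : bv F 0 + QPlus F v • bv F 4 ∈ W := by
    refine key v hv h0 _ (fun h => ?_) ?_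
    · simpa [bv_apply] using congrFun h 0
    · simp [QPlus_bv, polar_bv_left, bv_apply]
  have k2 : bv F 0 + QPlus F v • bv F 4 + bv F 1 ∈ W := by
    refine key v hv h0 _ (fun h => ?_) ?_
    · simpa [bv_apply] using congrFun h 0
    · simp [QPlus_bv, polar_bv_left, bv_apply]
  have k3 : bv F 1 ∈ W := by simpa using sub_mem k2 k1
  have k4 : ∀ i, bv F i ∈ W := fun i => key _ k3 (bv_ne_zero _) _ (bv_ne_zero i)
    (by rw [QPlus_bv, QPlus_bv])
  rw [eq_top_iff]
  intro v _
  rw [eq_sum_bv v]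
  have k5 : ∀ i (t : F), t • bv F i ∈ W := fun i t => W.smul_mem t (k4 i)
  exact add_mem (add_mem (add_mem (add_mem (add_mem (add_mem (add_mem (k5 _ _) (k5 _ _)) (k5 _ _))
    (k5 _ _)) (k5 _ _)) (k5 _ _)) (k5 _ _)) (k5 _ _)

/-- An isometry commuting with all Siegel transformations is `±1`. -/
theorem scalar_of_commute {c : Orth F} (hc : ∀ g ∈ siegelGroup F, c * g = g * c) :
    ∃ l : F, l ^ 2 = 1 ∧ ∀ v, lin c v = l • v := by
  have hc' : ∀ g ∈ siegelGroup F, ∀ v, lin c (lin g v) = lin g (lin c v) := by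
    intro g hg v; rw [← lin_mul_apply, hc g hg, lin_mul_apply]
  set u := lin c (bv F 0) with hu
  have hb : ∀ j : Fin 8, j ≠ 0 → j ≠ 4 → u 4 • bv F j - u (j + 4) • bv F 0 = 0 := by
    intro j hj hj4
    have hp : polar (bv F 0) (bv F j) = 0 := by
      rw [polar_bv_left, bv_apply, if_neg]; decide +revert
    have h1 := hc' _ (siegel_mem (bv F 0) (bv F j)) (bv F 0)
    rw [siegel_fix (by simp [polar_bv_left, bv_apply]) hp, ← hu,
      siegel_apply (QPlus_bv _) hp, QPlus_bv, polar_bv_right, polar_bv_right, zero_mul, zero_smul,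
      sub_zero, add_sub_assoc] at h1
    exact (left_eq_add.1 h1)
  have hu4 : u 4 = 0 := by simpa [bv_apply] using congrFun (hb 1 (by decide) (by decide)) 1
  have huj : ∀ j : Fin 8, j ≠ 0 → j ≠ 4 → u (j + 4) = 0 := by
    intro j hj hj4
    have := congrFun (hb j hj hj4) 0
    simpa [bv_apply, hj.symm] using this
  have hu0 : u = u 0 • bv F 0 := by
    ext i
    by_cases hi : i = 0
    · subst hi; simp [bv_apply]
    · have h0 : u i = 0 := by
        by_cases hi4 : i = 4
        · rw [hi4, hu4]
        · have := huj (i + 4) (by decide +revert) (by decide +revert)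
          rwa [show i + 4 + 4 = i by clear this; decide +revert] at this
      simp [bv_apply, hi, h0]
  have hall : ∀ i, lin c (bv F i) = u 0 • bv F i := by
    intro i
    obtain ⟨g, hg, hgi⟩ := exists_siegelGroup_map (bv_ne_zero (F := F) 0) (bv_ne_zero (F := F) i)
      (by rw [QPlus_bv, QPlus_bv])
    rw [← hgi, hc' g hg, ← hu, ← map_smul, ← hu0]
  have hv : ∀ v, lin c v = u 0 • v := by
    intro v
    rw [eq_sum_bv v]
    simp only [map_add, map_smul, hall, smul_add, smul_comm (u 0)]
  refine ⟨u 0, ?_, hv⟩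
  have := polar_lin c (bv F 0) (bv F 4)
  rw [hv, hv] at this
  simp [polar_bv_left, bv_apply] at this
  rw [sq, this]

end OmegaEight

namespace OmegaEight

variable {F : Type*} [Field F]

/-- A Weyl element of the root subgroup attached to two orthogonal hyperbolic pairs. -/
noncomputable def weyl (i j : Fin 8) : Orth F :=
  siegel (bv F i) (bv F j) * siegel (bv F (i + 4)) (bv F (j + 4)) * siegel (bv F i) (bv F j)

theorem weyl_mem (i j : Fin 8) : (weyl i j : Orth F) ∈ siegelGroup F :=
  mul_mem (mul_mem (siegel_mem _ _) (siegel_mem _ _)) (siegel_mem _ _)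

theorem lin_siegel_bv (i j : Fin 8) (h : i + 4 ≠ j) (t : F) (z : Fin 8 → F) :
    lin (siegel (bv F i) (t • bv F j)) z =
      z + (t * z (i + 4)) • bv F j - (t * z (j + 4)) • bv F i := by
  rw [siegel_apply (QPlus_bv _) (by
    rw [polar_smul_right, polar_bv_left, bv_apply, if_neg h, mul_zero])]
  simp [QPlus_bv, polar_bv_right, smul_smul, mul_comm]

theorem lin_weyl {i j : Fin 8} (h : i + 4 ≠ j) (h' : i ≠ j) (z : Fin 8 → F) :
    lin (weyl i j) z = z + z (i + 4) • (bv F j - bv F (i + 4)) + z i • (bv F (j + 4) - bv F i)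
      - z (j + 4) • (bv F i + bv F (j + 4)) - z j • (bv F (i + 4) + bv F j) := by
  have h0 : i + 4 ≠ i := by decide +revert
  have h1 : j ≠ i + 4 := h.symm
  have h2 : j + 4 ≠ i := by decide +revert
  have h3 : j + 4 ≠ j := by decide +revert
  have h4 : i + 4 + 4 = i := by decide +revert
  have h5 : j + 4 + 4 = j := by decide +revert
  have h8 : i + 4 + 4 ≠ j + 4 := by decide +revert
  have e1 := lin_siegel_bv (F := F) i j h 1
  have e2 := lin_siegel_bv (F := F) (i + 4) (j + 4) h8 1
  simp only [one_smul, one_mul, h4, h5] at e1 e2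
  rw [weyl, lin_mul_apply, lin_mul_apply, e1, e2, e1]
  ext k
  have h6 : i ≠ j + 4 := h2.symm
  have h7 : j ≠ i := h'.symm
  simp only [Pi.add_apply, Pi.sub_apply, Pi.smul_apply, bv_apply, smul_eq_mul, h0, h1, h2, h3,
    h.symm, h', h, h6, h7, h0.symm, h3.symm, add_left_inj, if_true, if_false]
  ring

/-- The order-three generator: it permutes the first three hyperbolic pairs cyclically. -/
noncomputable def famY (F : Type*) [Field F] : Orth F :=
  ofIso (LinearMap.funLeft F F ![2, 0, 1, 3, 6, 4, 5, 7]) (by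
    intro v; simp [QPlus, LinearMap.funLeft_apply]; ring)

theorem lin_famY (v : Fin 8 → F) :
    lin (famY F) v = ![v 2, v 0, v 1, v 3, v 6, v 4, v 5, v 7] := by
  rw [famY, lin_ofIso]
  ext i; fin_cases i <;> rfl

/-- The isometry exchanging the first two hyperbolic pairs. -/
noncomputable def swapPairs (F : Type*) [Field F] : Orth F :=
  ofIso (LinearMap.funLeft F F ![1, 0, 2, 3, 5, 4, 6, 7]) (by
    intro v; simp [QPlus, LinearMap.funLeft_apply]; ring)

theorem lin_swapPairs (v : Fin 8 → F) :
    lin (swapPairs F) v = ![v 1, v 0, v 2, v 3, v 5, v 4, v 6, v 7] := by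
  rw [swapPairs, lin_ofIso]
  ext i; fin_cases i <;> rfl

theorem famY_pow : famY F ^ 3 = 1 := by
  apply lin_ext
  intro v
  rw [pow_succ, pow_two, lin_mul_apply, lin_mul_apply, lin_famY, lin_famY, lin_famY]
  ext i; fin_cases i <;> simp

theorem mem_of_inverted {G : Type*} [Group G] {y i : G} (hy : y ^ 3 = 1) (h : i * y = y⁻¹ * i) :
    y ∈ commutator G := by
  have : y = ⁅i, y⁆ := by
    rw [commutatorElement_def, h]
    have : y⁻¹ * y⁻¹ = y := by
      rw [← _root_.mul_inv_rev, inv_eq_iff_mul_eq_one, ← hy, pow_succ, pow_two]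
    simp [this]
  rw [this]
  exact Subgroup.commutator_mem_commutator (Subgroup.mem_top _) (Subgroup.mem_top _)

theorem famY_mem : famY F ∈ siegelGroup F := by
  rw [← commutator_eq_siegelGroup]
  refine mem_of_inverted famY_pow (i := swapPairs F) ?_
  rw [eq_inv_mul_iff_mul_eq]
  apply lin_ext
  intro v
  simp only [lin_mul_apply, lin_swapPairs, lin_famY]
  ext i; fin_cases i <;> simp

/-- The monomial involution underlying the order-two generator. -/
noncomputable def famN (F : Type*) [Field F] : Orth F :=
  weyl 0 2 * (weyl 2 3 * weyl 2 3) * (weyl 1 3 * weyl 1 7)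

theorem lin_famN (v : Fin 8 → F) :
    lin (famN F) v = ![v 6, -v 5, v 4, v 7, v 2, -v 1, v 0, v 3] := by
  have e1 : ∀ z : Fin 8 → F, lin (weyl 2 3) z =
      ![z 0, z 1, -z 7, z 6, z 4, z 5, -z 3, z 2] := by
    intro z
    rw [lin_weyl (by decide) (by decide)]
    ext i; fin_cases i <;> simp [bv_apply]
  have e2 : ∀ z : Fin 8 → F, lin (weyl 0 2) z =
      ![-z 6, z 1, z 4, z 3, -z 2, z 5, z 0, z 7] := by
    intro z
    rw [lin_weyl (by decide) (by decide)]
    ext i; fin_cases i <;> simp [bv_apply]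
  have e3 : ∀ z : Fin 8 → F, lin (weyl 1 3) z =
      ![z 0, -z 7, z 2, z 5, z 4, -z 3, z 6, z 1] := by
    intro z
    rw [lin_weyl (by decide) (by decide)]
    ext i; fin_cases i <;> simp [bv_apply]
  have e4 : ∀ z : Fin 8 → F, lin (weyl 1 7) z =
      ![z 0, -z 3, z 2, z 1, z 4, -z 7, z 6, z 5] := by
    intro z
    rw [lin_weyl (by decide) (by decide)]
    ext i; fin_cases i <;> simp [bv_apply]
  simp only [famN, lin_mul_apply, e1, e2, e3, e4]
  ext i; fin_cases i <;> simp

variable (n p r s : F)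

/-- The order-two generator, as a linear map. -/
def famXLin : Module.End F (Fin 8 → F) where
  toFun v := ![v 6 + n * v 1 + p * v 3 - r * v 7 + s * v 4 + p * r * v 2, -v 5 + n * v 2, v 4,
    v 7 - r * v 4 - p * v 2, v 2, -v 1 + n * v 4,
    v 0 + n * v 5 + r * v 3 - p * v 7 + p * r * v 4 + (p ^ 2 + r ^ 2 - n ^ 2 - s) * v 2,
    v 3 + p * v 4 + r * v 2]
  map_add' u v := by ext i; fin_cases i <;> simp <;> ring
  map_smul' c v := by ext i; fin_cases i <;> simp <;> ring

/-- The order-two generator. -/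
noncomputable def famX : Orth F :=
  ofIso (famXLin n p r s) (by intro v; simp [famXLin, QPlus]; ring)

theorem lin_famX (v : Fin 8 → F) : lin (famX n p r s) v =
    ![v 6 + n * v 1 + p * v 3 - r * v 7 + s * v 4 + p * r * v 2, -v 5 + n * v 2, v 4,
    v 7 - r * v 4 - p * v 2, v 2, -v 1 + n * v 4,
    v 0 + n * v 5 + r * v 3 - p * v 7 + p * r * v 4 + (p ^ 2 + r ^ 2 - n ^ 2 - s) * v 2,
    v 3 + p * v 4 + r * v 2] := by
  rw [famX, lin_ofIso]; rfl

theorem famX_mul_self : famX n p r s * famX n p r s = 1 := by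
  apply lin_ext
  intro v
  rw [lin_mul_apply, lin_famX, lin_famX]
  ext i; fin_cases i <;> simp <;> ring

theorem famX_mem : famX n p r s ∈ siegelGroup F := by
  have h1 : polar (bv F 0) ![0, -n, 0, p, 0, 0, 0, -r] = 0 := by simp [polar_bv_left]
  have h2 : polar (bv F 6) ![0, 0, 0, r, 0, -n, 0, -p] = 0 := by simp [polar_bv_left]
  have : famX n p r s = famN F * (siegel (bv F 0) ![0, -n, 0, p, 0, 0, 0, -r] *
      siegel (bv F 6) ![0, 0, 0, r, 0, -n, 0, -p] * siegel (bv F 0) (s • bv F 6)) := by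
    have e1 : ∀ z : Fin 8 → F, lin (siegel (bv F 0) ![0, -n, 0, p, 0, 0, 0, -r]) z =
        ![z 0 + n * z 5 - p * z 7 + r * z 3 + p * r * z 4, z 1 - n * z 4, z 2, z 3 + p * z 4,
          z 4, z 5, z 6, z 7 - r * z 4] := by
      intro z
      rw [siegel_apply (QPlus_bv _) h1, polar_bv_right]
      ext i
      simp only [Pi.add_apply, Pi.sub_apply, Pi.smul_apply]
      fin_cases i <;> simp [polar, QPlus, bv_apply] <;> ring
    have e2 : ∀ z : Fin 8 → F, lin (siegel (bv F 6) ![0, 0, 0, r, 0, -n, 0, -p]) z =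
        ![z 0, z 1, z 2, z 3 + r * z 2, z 4, z 5 - n * z 2,
          z 6 + n * z 1 - r * z 7 + p * z 3 + p * r * z 2, z 7 - p * z 2] := by
      intro z
      rw [siegel_apply (QPlus_bv _) h2, polar_bv_right]
      ext i
      simp only [Pi.add_apply, Pi.sub_apply, Pi.smul_apply]
      fin_cases i <;> simp [polar, QPlus, bv_apply] <;> ring
    have e3 : ∀ z : Fin 8 → F, lin (siegel (bv F 0) (s • bv F 6)) z =
        ![z 0 - s * z 2, z 1, z 2, z 3, z 4, z 5, z 6 + s * z 4, z 7] := by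
      intro z
      rw [lin_siegel_bv _ _ (by decide)]
      ext i; fin_cases i <;> simp [bv_apply]
    apply lin_ext
    intro v
    simp only [lin_mul_apply, lin_famX, lin_famN, e1, e2, e3]
    ext i; fin_cases i <;> simp <;> ring
  rw [this]
  have hw := weyl_mem (F := F)
  exact mul_mem (mul_mem (mul_mem (hw _ _) (mul_mem (hw _ _) (hw _ _))) (mul_mem (hw _ _) (hw _ _)))
    (mul_mem (mul_mem (siegel_mem _ _) (siegel_mem _ _)) (siegel_mem _ _))

end OmegaEight

namespace OmegaEight

variable {F : Type*} [Field F]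

open Polynomial in
theorem quad_dvd [Fintype F] {n : F} (hn : n ^ 2 ≠ 4) :
    (X ^ 2 - C n * X + 1 : F[X]) ∣ X ^ (Fintype.card F ^ 2 - 1) - 1 := by
  set R : F[X] := X ^ 2 - C n * X + 1 with hR
  let K := AlgebraicClosure F
  have hroot : ∀ a : K, aeval a R = 0 ↔ a ^ 2 - algebraMap F K n * a + 1 = 0 := by
    intro a; simp [hR]
  obtain ⟨a, ha⟩ : ∃ a : K, aeval a R = 0 := by
    apply IsAlgClosed.exists_aeval_eq_zero
    have : R.degree = 2 := by
      rw [hR]; compute_degree!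
    rw [this]; norm_num
  have ha' := (hroot a).1 ha
  set b : K := algebraMap F K n - a with hb
  have hab : a * b = 1 := by rw [hb]; linear_combination -ha'
  have hne : a ≠ b := by
    intro h
    apply hn
    apply (algebraMap F K).injective
    rw [map_pow, map_ofNat]
    have h1 : algebraMap F K n = 2 * a := by rw [hb] at h; linear_combination -h
    have h2 : a * a = 1 := by rw [← h] at hab; exact hab
    rw [h1]; linear_combination 4 * h2
  have hfac : R.map (algebraMap F K) = (X - C a) * (X - C b) := by
    rw [hR, hb]
    simp only [Polynomial.map_add, Polynomial.map_sub, Polynomial.map_pow, Polynomial.map_mul,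
      map_X, map_C, Polynomial.map_one, C_sub]
    have : (1 : K[X]) = C a * (C (algebraMap F K n) - C a) := by
      rw [← C_sub, ← C_mul, ← hb, hab, C_1]
    rw [this]; ring
  have ha0 : a ≠ 0 := left_ne_zero_of_mul_eq_one hab
  have hfrob : a ^ Fintype.card F = a ∨ a ^ Fintype.card F = b := by
    have h1 : aeval (a ^ Fintype.card F) R = 0 := by
      rw [← expand_aeval, FiniteField.expand_card, map_pow, ha, zero_pow Fintype.card_ne_zero]
    have h2 : (a ^ Fintype.card F - a) * (a ^ Fintype.card F - b) = 0 := by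
      have := congrArg (eval (a ^ Fintype.card F)) hfac
      rw [eval_map_algebraMap, h1] at this
      simpa using this.symm
    rcases mul_eq_zero.1 h2 with h | h
    · exact Or.inl (sub_eq_zero.1 h)
    · exact Or.inr (sub_eq_zero.1 h)
  have hbinv : b = a⁻¹ := eq_inv_of_mul_eq_one_right hab
  have hpow : a ^ (Fintype.card F ^ 2) = a := by
    rw [pow_two, pow_mul]
    rcases hfrob with h | h
    · rw [h, h]
    · rw [h, hbinv, inv_pow, h, hbinv, inv_inv]
  have hcard : 0 < Fintype.card F ^ 2 := pow_pos Fintype.card_pos 2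
  have hpa : a ^ (Fintype.card F ^ 2 - 1) = 1 := by
    apply mul_right_cancel₀ ha0
    rw [← pow_succ, Nat.sub_add_cancel hcard, hpow, one_mul]
  have hpb : b ^ (Fintype.card F ^ 2 - 1) = 1 := by rw [hbinv, inv_pow, hpa, inv_one]
  rw [← Polynomial.map_dvd_map' (algebraMap F K), hfac]
  apply IsCoprime.mul_dvd
  · exact Polynomial.isCoprime_X_sub_C_of_isUnit_sub (sub_ne_zero.2 hne).isUnit
  · rw [dvd_iff_isRoot]; simp [hpa]
  · rw [dvd_iff_isRoot]; simp [hpb]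

open Polynomial in
theorem pow_fix [Fintype F] {n : F} (hn : n ^ 2 ≠ 4) {g : Orth F} {v : Fin 8 → F}
    (h : lin g (lin g v) - n • lin g v + v = 0) : lin (g ^ (Fintype.card F ^ 2 - 1)) v = v := by
  obtain ⟨S, hS⟩ := quad_dvd hn
  have h1 := congrArg (fun P => aeval (lin g) P v) hS
  simp only [mul_comm _ S, map_mul, map_sub, map_pow, aeval_X, map_one, map_add, aeval_C,
    Module.End.mul_apply, LinearMap.sub_apply, LinearMap.add_apply, Module.End.one_apply,
    Module.algebraMap_end_apply, pow_two, h, map_zero] at h1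
  rw [map_pow, pow_two]
  exact sub_eq_zero.1 h1

theorem pow_fix_of_fix {g : Orth F} {v : Fin 8 → F} (h : lin g v = v) (k : ℕ) :
    lin (g ^ k) v = v := by
  induction k with
  | zero => simp
  | succ k ih => rw [pow_succ, lin_mul_apply, h, ih]

theorem lin_ext_bv {g h : Orth F} (H : ∀ i, lin g (bv F i) = lin h (bv F i)) : g = h := by
  apply lin_injective
  refine (Pi.basisFun F (Fin 8)).ext fun i => ?_
  rw [Pi.basisFun_apply]; exact H i

/-- An isometry fixing the annihilator of a totally singular plane is determined by one entry. -/
theorem eq_one_of_fix {g : Orth F} (h0 : lin g (bv F 0) = bv F 0) (h5 : lin g (bv F 5) = bv F 5)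
    (h2 : lin g (bv F 2) = bv F 2) (h6 : lin g (bv F 6) = bv F 6)
    (h3 : lin g (bv F 3) = bv F 3) (h7 : lin g (bv F 7) = bv F 7)
    (h : polar (lin g (bv F 4)) (bv F 1) = 0) : g = 1 := by
  have key : ∀ i j : Fin 8, lin g (bv F j) = bv F j → lin g (bv F i) (j + 4) = bv F i (j + 4) := by
    intro i j hj
    have := polar_lin g (bv F i) (bv F j)
    rwa [hj, polar_bv_right, polar_bv_right] at this
  rw [polar_bv_right] at h
  have e4 : lin g (bv F 4) = bv F 4 := by
    have q := QPlus_lin g (bv F 4)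
    have a0 := key 4 0 h0
    have a5 := key 4 5 h5
    have a2 := key 4 2 h2
    have a6 := key 4 6 h6
    have a3 := key 4 3 h3
    have a7 := key 4 7 h7
    simp only [bv_apply, Fin.isValue, Fin.reduceAdd, Fin.reduceEq, if_false, if_true] at a0 a5 a2 a6 a3 a7 h
    rw [QPlus_bv, QPlus, a0, a5, a2, a6, a3, a7] at q
    have b0 : lin g (bv F 4) 0 = 0 := by linear_combination q
    ext i
    fin_cases i <;> simp [bv_apply, *]
  have e1 : lin g (bv F 1) = bv F 1 := by
    have q := QPlus_lin g (bv F 1)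
    have a0 := key 1 0 h0
    have a5 := key 1 5 h5
    have a2 := key 1 2 h2
    have a6 := key 1 6 h6
    have a3 := key 1 3 h3
    have a7 := key 1 7 h7
    have a4 := key 1 4 e4
    simp only [bv_apply, Fin.isValue, Fin.reduceAdd, Fin.reduceEq, if_false, if_true] at a0 a5 a2 a6 a3 a7 a4
    rw [QPlus_bv, QPlus, a0, a5, a2, a6, a3, a7, a4] at q
    have b0 : lin g (bv F 1) 5 = 0 := by linear_combination q
    ext i
    fin_cases i <;> simp [bv_apply, *]
  apply lin_ext_bv
  intro i
  rw [lin_one_apply]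
  fin_cases i <;> assumption

/-- The embedding of the third and fourth hyperbolic pairs. -/
def mid (a b c d : F) : Fin 8 → F := ![0, 0, a, c, 0, 0, b, d]

theorem lin_siegel_mid_zero (a b c d : F) (z : Fin 8 → F) :
    lin (siegel (bv F 0) (mid a b c d)) z =
      ![z 0 - (a * z 6 + b * z 2 + c * z 7 + d * z 3) - (a * b + c * d) * z 4, z 1, z 2 + a * z 4,
        z 3 + c * z 4, z 4, z 5, z 6 + b * z 4, z 7 + d * z 4] := by
  rw [siegel_apply (QPlus_bv _) (by simp [polar_bv_left, mid]), polar_bv_right]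
  ext i
  simp only [Pi.add_apply, Pi.sub_apply, Pi.smul_apply]
  fin_cases i <;> simp [polar, QPlus, bv_apply, mid] <;> ring

theorem lin_siegel_mid_five (a b c d : F) (z : Fin 8 → F) :
    lin (siegel (bv F 5) (mid a b c d)) z =
      ![z 0, z 1, z 2 + a * z 1, z 3 + c * z 1, z 4,
        z 5 - (a * z 6 + b * z 2 + c * z 7 + d * z 3) - (a * b + c * d) * z 1,
        z 6 + b * z 1, z 7 + d * z 1] := by
  rw [siegel_apply (QPlus_bv _) (by simp [polar_bv_left, mid]), polar_bv_right]
  ext i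
  simp only [Pi.add_apply, Pi.sub_apply, Pi.smul_apply]
  fin_cases i <;> simp [polar, QPlus, bv_apply, mid] <;> ring

/-- The root element sending `bv j` to `bv j + t • bv i`. -/
noncomputable def rootElt (i j : Fin 8) (t : F) : Orth F := siegel (bv F i) ((-t) • bv F (j + 4))

theorem lin_rootElt {i j : Fin 8} (h : i ≠ j) (t : F) (z : Fin 8 → F) :
    lin (rootElt i j t) z = z - (t * z (i + 4)) • bv F (j + 4) + (t * z j) • bv F i := by
  have h4 : j + 4 + 4 = j := by decide +revert
  have h5 : i + 4 ≠ j + 4 := by decide +revert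
  rw [rootElt, lin_siegel_bv _ _ h5, h4]
  ext i; simp; ring

theorem rootElt_add {i j : Fin 8} (h : i ≠ j) (s t : F) :
    rootElt i j (s + t) = rootElt i j s * rootElt i j t := by
  have h5 : i + 4 ≠ j + 4 := by decide +revert
  have h6 : polar (bv F i) (bv F (j + 4)) = 0 := by rw [polar_bv_left, bv_apply, if_neg h5]
  rw [rootElt, rootElt, rootElt, ← siegel_add (QPlus_bv _), neg_add, add_smul]
  · rw [polar_smul_right, h6, mul_zero]
  · rw [polar_smul_right, h6, mul_zero]

theorem rootElt_zero (i j : Fin 8) : rootElt i j (0 : F) = 1 := by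
  rw [rootElt, neg_zero, zero_smul, siegel_zero_right]

theorem rootElt_pow {i j : Fin 8} (h : i ≠ j) (t : F) (k : ℕ) :
    rootElt i j t ^ k = rootElt i j (k * t) := by
  induction k with
  | zero => simp [rootElt_zero]
  | succ k ih => rw [pow_succ, ih, ← rootElt_add h]; push_cast; ring_nf

end OmegaEight

namespace OmegaEight

variable {F : Type*} [Field F]

/-- The Levi component of the product of the generators on the first two pairs. -/
noncomputable def leviA (n : F) : Orth F :=
  ofIso { toFun := fun z => ![n * z 0 + z 5, -z 4 + n * z 1, z 2, z 3, z 1, -z 0, z 6, z 7]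
          map_add' := fun u v => by ext i; fin_cases i <;> simp <;> ring
          map_smul' := fun c v => by ext i; fin_cases i <;> simp <;> ring }
    (by intro v; simp [QPlus]; ring)

theorem lin_leviA (n : F) (z : Fin 8 → F) :
    lin (leviA n) z = ![n * z 0 + z 5, -z 4 + n * z 1, z 2, z 3, z 1, -z 0, z 6, z 7] := by
  rw [leviA, lin_ofIso]; rfl

/-- The first Levi component of the product of the generators on the last two pairs. -/
noncomputable def leviB (p : F) : Orth F :=
  ofIso { toFun := fun z => ![z 0, z 1, z 7, -z 6, z 4, z 5, z 3 + p * z 6, -z 2 + p * z 7]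
          map_add' := fun u v => by ext i; fin_cases i <;> simp <;> ring
          map_smul' := fun c v => by ext i; fin_cases i <;> simp <;> ring }
    (by intro v; simp [QPlus]; ring)

theorem lin_leviB (p : F) (z : Fin 8 → F) :
    lin (leviB p) z = ![z 0, z 1, z 7, -z 6, z 4, z 5, z 3 + p * z 6, -z 2 + p * z 7] := by
  rw [leviB, lin_ofIso]; rfl

/-- The second Levi component of the product of the generators on the last two pairs. -/
noncomputable def leviC (r : F) : Orth F :=
  ofIso { toFun := fun z => ![z 0, z 1, -z 3, z 2 + r * z 3, z 4, z 5, -z 7 + r * z 6, z 6]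
          map_add' := fun u v => by ext i; fin_cases i <;> simp <;> ring
          map_smul' := fun c v => by ext i; fin_cases i <;> simp <;> ring }
    (by intro v; simp [QPlus]; ring)

theorem lin_leviC (r : F) (z : Fin 8 → F) :
    lin (leviC r) z = ![z 0, z 1, -z 3, z 2 + r * z 3, z 4, z 5, -z 7 + r * z 6, z 6] := by
  rw [leviC, lin_ofIso]; rfl

theorem leviA_pow [Fintype F] {n : F} (hn : n ^ 2 ≠ 4) :
    leviA n ^ (Fintype.card F ^ 2 - 1) = 1 := by
  apply lin_ext_bv
  intro i
  rw [lin_one_apply]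
  by_cases hi : i = 2 ∨ i = 3 ∨ i = 6 ∨ i = 7
  · apply pow_fix_of_fix
    rw [lin_leviA]
    rcases hi with rfl | rfl | rfl | rfl <;> ext i <;> fin_cases i <;> simp [bv_apply]
  · apply pow_fix hn
    rw [lin_leviA, lin_leviA]
    fin_cases i <;> simp at hi <;> ext i <;> fin_cases i <;> simp [bv_apply]

theorem leviB_pow [Fintype F] {n : F} (hn : n ^ 2 ≠ 4) :
    leviB n ^ (Fintype.card F ^ 2 - 1) = 1 := by
  apply lin_ext_bv
  intro i
  rw [lin_one_apply]
  by_cases hi : i = 0 ∨ i = 1 ∨ i = 4 ∨ i = 5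
  · apply pow_fix_of_fix
    rw [lin_leviB]
    rcases hi with rfl | rfl | rfl | rfl <;> ext i <;> fin_cases i <;> simp [bv_apply]
  · apply pow_fix hn
    rw [lin_leviB, lin_leviB]
    fin_cases i <;> simp at hi <;> ext i <;> fin_cases i <;> simp [bv_apply]

theorem leviC_pow [Fintype F] {n : F} (hn : n ^ 2 ≠ 4) :
    leviC n ^ (Fintype.card F ^ 2 - 1) = 1 := by
  apply lin_ext_bv
  intro i
  rw [lin_one_apply]
  by_cases hi : i = 0 ∨ i = 1 ∨ i = 4 ∨ i = 5
  · apply pow_fix_of_fix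
    rw [lin_leviC]
    rcases hi with rfl | rfl | rfl | rfl <;> ext i <;> fin_cases i <;> simp [bv_apply]
  · apply pow_fix hn
    rw [lin_leviC, lin_leviC]
    fin_cases i <;> simp at hi <;> ext i <;> fin_cases i <;> simp [bv_apply]

theorem leviAB_comm (n p : F) : Commute (leviA n) (leviB p) := by
  apply lin_ext; intro z
  simp only [lin_mul_apply, lin_leviA, lin_leviB]
  ext i; fin_cases i <;> simp

theorem leviAC_comm (n p : F) : Commute (leviA n) (leviC p) := by
  apply lin_ext; intro z
  simp only [lin_mul_apply, lin_leviA, lin_leviC]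
  ext i; fin_cases i <;> simp

theorem leviBC_comm (n p : F) : Commute (leviB n) (leviC p) := by
  apply lin_ext; intro z
  simp only [lin_mul_apply, lin_leviB, lin_leviC]
  ext i; fin_cases i <;> simp <;> ring

theorem lin_rootElt_zero_one (t : F) (z : Fin 8 → F) :
    lin (rootElt 0 1 t) z = ![z 0 + t * z 1, z 1, z 2, z 3, z 4, z 5 - t * z 4, z 6, z 7] := by
  rw [lin_rootElt (by decide)]
  ext i; simp only [Pi.add_apply, Pi.sub_apply, Pi.smul_apply]
  fin_cases i <;> simp [bv_apply]

theorem levi_root_comm (n p r t : F) :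
    Commute (rootElt 0 1 t) (leviA n * leviB p * leviC r) := by
  apply lin_ext; intro z
  simp only [lin_mul_apply, lin_leviA, lin_leviB, lin_leviC, lin_rootElt_zero_one]
  ext i; fin_cases i <;> simp <;> ring

theorem mid_root_comm (a b c d a' b' c' d' t : F) :
    Commute (rootElt 0 1 t) (siegel (bv F 0) (mid a b c d) * siegel (bv F 5) (mid a' b' c' d')) := by
  apply lin_ext; intro z
  simp only [lin_mul_apply, lin_siegel_mid_zero, lin_siegel_mid_five, lin_rootElt_zero_one]
  ext i; fin_cases i <;> simp <;> ring

variable (n p r s : F)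

theorem lin_famX_famY (z : Fin 8 → F) : lin (famX n p r s * famY F) z =
    ![z 5 + n * z 0 + p * z 3 - r * z 7 + s * z 6 + p * r * z 1, -z 4 + n * z 1, z 6,
    z 7 - r * z 6 - p * z 1, z 1, -z 0 + n * z 6,
    z 2 + n * z 4 + r * z 3 - p * z 7 + p * r * z 6 + (p ^ 2 + r ^ 2 - n ^ 2 - s) * z 1,
    z 3 + p * z 6 + r * z 1] := by
  rw [lin_mul_apply, lin_famX, lin_famY]
  ext i; fin_cases i <;> simp

/-- The common denominator of the parameters of the conjugating element. -/
def famDelta : F := n ^ 2 - n * p * r + p ^ 2 + r ^ 2 - 4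

/-- The numerator of the root parameter. -/
def famNum : F := s ^ 2 - (p ^ 2 + r ^ 2 - n ^ 2) * s + p ^ 2 * r ^ 2 + n ^ 2 + p ^ 2 + r ^ 2
  - 3 * n * p * r

/-- The unipotent element conjugating the product of the generators into normal form. -/
noncomputable def famU : Orth F :=
  siegel (bv F 0) (mid ((-n * s - 2 * n + 2 * p * r) / famDelta n p r)
    ((-n ^ 2 + p ^ 2 + r ^ 2 - 2 * s) / famDelta n p r)
    ((2 * n * r - p * r ^ 2 + p * s - 2 * p) / famDelta n p r)
    ((-2 * n * p + p ^ 2 * r - r * s + 2 * r) / famDelta n p r)) *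
  siegel (bv F 5) (mid ((n ^ 2 - p ^ 2 - r ^ 2 + 2 * s) / famDelta n p r)
    ((n ^ 3 - n * p ^ 2 - n * r ^ 2 + n * s - 2 * n + 2 * p * r) / famDelta n p r)
    ((-n ^ 2 * r + 2 * n * p + r ^ 3 - r * s - 2 * r) / famDelta n p r)
    ((n ^ 2 * p - 2 * n * r - p ^ 3 + p * s + 2 * p) / famDelta n p r))

set_option maxHeartbeats 2000000 in
theorem famU_conj (hD : famDelta n p r ≠ 0) :
    famU n p r s * (famX n p r s * famY F) =
      rootElt 0 1 (-(famNum n p r s / famDelta n p r)) * (leviA n * leviB p * leviC r) *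
        famU n p r s := by
  rw [← inv_mul_eq_one]
  have hw := lin_famX_famY n p r s
  have hu : ∀ z, lin (rootElt 0 1 (-(famNum n p r s / famDelta n p r)) *
      (leviA n * leviB p * leviC r)) z = ![n * z 0 + z 5 - famNum n p r s / famDelta n p r *
        (-z 4 + n * z 1), -z 4 + n * z 1, z 6, -(-z 7 + r * z 6), z 1,
        -z 0 + famNum n p r s / famDelta n p r * z 1, z 2 + r * z 3 + p * (-z 7 + r * z 6),
        z 3 + p * z 6] := by
    intro z
    simp only [lin_mul_apply, lin_leviA, lin_leviB, lin_leviC, lin_rootElt_zero_one]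
    ext i; fin_cases i <;> simp <;> ring
  have key : ∀ g h : Orth F, ∀ v, lin g v = lin h v → lin (g⁻¹ * h) v = v := by
    intro g h v e
    rw [lin_mul_apply, ← e, lin_inv_apply]
  have hU : ∀ z, lin (famU n p r s) z = _ := fun z => by
    rw [famU, lin_mul_apply, lin_siegel_mid_zero, lin_siegel_mid_five]
  refine eq_one_of_fix (key _ _ _ ?_) (key _ _ _ ?_) (key _ _ _ ?_) (key _ _ _ ?_)
    (key _ _ _ ?_) (key _ _ _ ?_) ?_
  · rw [lin_mul_apply, hw, hU, lin_mul_apply, hu, hU]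
    ext i; fin_cases i <;> simp [bv_apply]
  · rw [lin_mul_apply, hw, hU, lin_mul_apply, hu, hU]
    ext i; fin_cases i <;> simp [bv_apply]
  · rw [lin_mul_apply, hw, hU, lin_mul_apply, hu, hU]
    ext i; fin_cases i <;> simp [bv_apply] <;> field_simp <;> (try simp only [famDelta, famNum]) <;> ring
  · rw [lin_mul_apply, hw, hU, lin_mul_apply, hu, hU]
    ext i; fin_cases i <;> simp [bv_apply] <;> field_simp <;> (try simp only [famDelta, famNum]) <;> ring
  · rw [lin_mul_apply, hw, hU, lin_mul_apply, hu, hU]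
    ext i; fin_cases i <;> simp [bv_apply] <;> field_simp <;> (try simp only [famDelta, famNum]) <;> ring
  · rw [lin_mul_apply, hw, hU, lin_mul_apply, hu, hU]
    ext i; fin_cases i <;> simp [bv_apply] <;> field_simp <;> (try simp only [famDelta, famNum]) <;> ring
  · rw [lin_mul_apply, polar_lin_left, inv_inv, lin_mul_apply, lin_mul_apply (famU n p r s),
      hw, hU, hu, hU]
    simp [bv_apply, polar]
    field_simp
    simp only [famDelta, famNum]
    ring

theorem famXY_pow [Fintype F] (hD : famDelta n p r ≠ 0) (hn : n ^ 2 ≠ 4) (hp : p ^ 2 ≠ 4)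
    (hr : r ^ 2 ≠ 4) : (famX n p r s * famY F) ^ (Fintype.card F ^ 2 - 1) =
      rootElt 0 1 (famNum n p r s / famDelta n p r) := by
  have h := famU_conj n p r s hD
  have hc : SemiconjBy (famU n p r s) (famX n p r s * famY F)
      (rootElt 0 1 (-(famNum n p r s / famDelta n p r)) * (leviA n * leviB p * leviC r)) := h
  have h2 := (hc.pow_right (Fintype.card F ^ 2 - 1)).eq
  rw [(levi_root_comm n p r _).mul_pow,
    (((leviAC_comm n r).mul_left (leviBC_comm p r))).mul_pow, (leviAB_comm n p).mul_pow,
    leviA_pow hn, leviB_pow hp, leviC_pow hr, rootElt_pow (by decide), one_mul, one_mul,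
    mul_one] at h2
  have hcast : (((Fintype.card F ^ 2 - 1 : ℕ) : F)) = -1 := by
    rw [Nat.cast_sub (Nat.one_le_pow _ _ Fintype.card_pos), Nat.cast_pow, FiniteField.cast_card_eq_zero]
    simp
  rw [hcast, neg_one_mul, neg_neg, famU, (mid_root_comm _ _ _ _ _ _ _ _ _).eq] at h2
  exact mul_left_cancel h2

end OmegaEight

namespace OmegaEight

variable {F : Type*} [Field F]

theorem conj_mem {G : Type*} [Group G] {H : Subgroup G} {g h : G} (hg : g ∈ H) (hh : h ∈ H) :
    g * h * g⁻¹ ∈ H := mul_mem (mul_mem hg hh) (inv_mem hg)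

theorem siegel_lin_mem {H : Subgroup (Orth F)} {g : Orth F} (hg : g ∈ H) {a b : Fin 8 → F}
    (h : siegel a b ∈ H) : siegel (lin g a) (lin g b) ∈ H := by
  rw [← siegel_conj]; exact conj_mem hg h

theorem lin_famY_bv (i : Fin 8) : lin (famY F) (bv F i) = bv F (![1, 2, 0, 3, 5, 6, 4, 7] i) := by
  rw [lin_famY]
  ext j; fin_cases i <;> fin_cases j <;> simp [bv_apply]

theorem rootElt_famY {H : Subgroup (Orth F)} (hy : famY F ∈ H) {t : F} {i j : Fin 8}
    (h : rootElt i j t ∈ H) {i' j' : Fin 8} (hi : ![1, 2, 0, 3, 5, 6, 4, 7] i = i')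
    (hj : ![1, 2, 0, 3, 5, 6, 4, 7] (j + 4) = j' + 4) : rootElt i' j' t ∈ H := by
  have := siegel_lin_mem hy h
  rwa [map_smul, lin_famY_bv, lin_famY_bv, hi, hj] at this

theorem rootElt_comm {i j k : Fin 8} (hij : i ≠ j) (hjk : j ≠ k)
    (hik : i ≠ k) (hj4 : j + 4 ≠ k) (hi4 : i + 4 ≠ k) (hij4 : i + 4 ≠ j) (s t : F) :
    rootElt i j s * rootElt j k t = rootElt j k t * rootElt i k (s * t) * rootElt i j s := by
  have h9 : i + 4 ≠ i := by decide +revert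
  have h10 : k ≠ k + 4 := by decide +revert
  have h1 : i + 4 ≠ k + 4 := by decide +revert
  have h2 : i + 4 ≠ j + 4 := by decide +revert
  have h3 : j + 4 ≠ k + 4 := by decide +revert
  have h4 : j ≠ k + 4 := by decide +revert
  have h5 : j + 4 ≠ i := by decide +revert
  have h7 : k ≠ j + 4 := hj4.symm
  have h8 : k ≠ i := hik.symm
  apply lin_ext
  intro z
  simp only [lin_mul_apply, lin_rootElt hij, lin_rootElt hjk, lin_rootElt hik]
  ext l
  simp only [Pi.add_apply, Pi.sub_apply, Pi.smul_apply, smul_eq_mul, bv_apply, if_true, h1, h2, h3,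
    h4, h5, h7, hij, hjk, hik, hi4, hij4, hj4, if_false, h8, hj4.symm, hij4.symm, hi4.symm, h4.symm,
    h1.symm, h2.symm, h3.symm, hij.symm, hjk.symm, h9, h10]
  ring

theorem rootElt_mul_mem {H : Subgroup (Orth F)} {i j k : Fin 8} (hij : i ≠ j) (hjk : j ≠ k)
    (hik : i ≠ k) (hj4 : j + 4 ≠ k) (hi4 : i + 4 ≠ k) (hij4 : i + 4 ≠ j) {s t : F}
    (hs : rootElt i j s ∈ H)
    (ht : rootElt j k t ∈ H) : rootElt i k (s * t) ∈ H := by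
  have h := mul_mem hs ht
  rw [rootElt_comm hij hjk hik hj4 hi4 hij4, Subgroup.mul_mem_cancel_right _ hs] at h
  exact (Subgroup.mul_mem_cancel_left _ ht).1 h

/-- Root elements of the linear group of the first three pairs. -/
def HasRoots (H : Subgroup (Orth F)) : Prop :=
  ∀ i j : Fin 8, i < 3 → j < 3 → i ≠ j → ∀ t : F, rootElt i j t ∈ H

theorem hasRoots_of_zero_one {H : Subgroup (Orth F)} (hy : famY F ∈ H)
    (h : ∀ t : F, rootElt 0 1 t ∈ H) : HasRoots H := by
  have h1 : ∀ t : F, rootElt 1 2 t ∈ H := fun t => rootElt_famY hy (h t) rfl rfl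
  have h2 : ∀ t : F, rootElt 2 0 t ∈ H := fun t => rootElt_famY hy (h1 t) rfl rfl
  have h3 : ∀ t : F, rootElt 0 2 t ∈ H := fun t => by
    have := rootElt_mul_mem (by decide) (by decide) (by decide) (by decide) (by decide)
      (by decide) (h 1) (h1 t)
    rwa [one_mul] at this
  have h4 : ∀ t : F, rootElt 1 0 t ∈ H := fun t => rootElt_famY hy (h3 t) rfl rfl
  have h5 : ∀ t : F, rootElt 2 1 t ∈ H := fun t => rootElt_famY hy (h4 t) rfl rfl
  intro i j hi hj hij t
  have : (i = 0 ∨ i = 1 ∨ i = 2) ∧ (j = 0 ∨ j = 1 ∨ j = 2) := by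
    clear h h1 h2 h3 h4 h5
    decide +revert
  obtain ⟨rfl | rfl | rfl, rfl | rfl | rfl⟩ := this <;>
    first
      | exact absurd rfl hij
      | with_reducible exact h t
      | with_reducible exact h1 t
      | with_reducible exact h2 t
      | with_reducible exact h3 t
      | with_reducible exact h4 t
      | with_reducible exact h5 t

/-- A nonzero root parameter whose cube generates the field yields all root elements. -/
theorem hasRoots_of_generator {H : Subgroup (Orth F)} (hy : famY F ∈ H) {s : F} (hs0 : s ≠ 0)
    (hs : ∀ K : Subring F, s ^ 3 ∈ K → K = ⊤) (h : rootElt 0 1 s ∈ H) : HasRoots H := by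
  have c01 : ∀ {t : F}, rootElt 0 1 t ∈ H → rootElt 1 2 t ∈ H := fun h => rootElt_famY hy h rfl rfl
  have c12 : ∀ {t : F}, rootElt 1 2 t ∈ H → rootElt 2 0 t ∈ H := fun h => rootElt_famY hy h rfl rfl
  have c02 : ∀ {t : F}, rootElt 0 2 t ∈ H → rootElt 1 0 t ∈ H := fun h => rootElt_famY hy h rfl rfl
  have c10 : ∀ {t : F}, rootElt 1 0 t ∈ H → rootElt 2 1 t ∈ H := fun h => rootElt_famY hy h rfl rfl
  have m1 : ∀ {a b : F}, rootElt 0 1 a ∈ H → rootElt 0 1 b ∈ H → rootElt 0 2 (a * b) ∈ H :=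
    fun ha hb => rootElt_mul_mem (by decide) (by decide) (by decide) (by decide) (by decide)
      (by decide) ha (c01 hb)
  have m2 : ∀ {a b : F}, rootElt 0 2 a ∈ H → rootElt 0 2 b ∈ H → rootElt 0 1 (a * b) ∈ H :=
    fun ha hb => rootElt_mul_mem (by decide) (by decide) (by decide) (by decide) (by decide)
      (by decide) ha (c10 (c02 hb))
  let S : AddSubgroup F :=
    { carrier := {t | rootElt 0 1 t ∈ H}
      add_mem' := fun {a b} ha hb => by
        rw [Set.mem_setOf_eq, rootElt_add (by decide)]; exact mul_mem ha hb
      zero_mem' := by rw [Set.mem_setOf_eq, rootElt_zero]; exact one_mem H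
      neg_mem' := fun {a} ha => by
        have : rootElt 0 1 (-a) = (rootElt 0 1 a)⁻¹ := by
          rw [eq_inv_iff_mul_eq_one, ← rootElt_add (by decide), neg_add_cancel, rootElt_zero]
        rw [Set.mem_setOf_eq, this]; exact inv_mem ha }
  let K : Subring F :=
    { carrier := {k | ∀ t ∈ S, k * t ∈ S}
      mul_mem' := fun {a b} ha hb t ht => by rw [mul_assoc]; exact ha _ (hb _ ht)
      one_mem' := fun t ht => by rwa [one_mul]
      add_mem' := fun {a b} ha hb t ht => by rw [add_mul]; exact S.add_mem (ha _ ht) (hb _ ht)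
      zero_mem' := fun t _ => by rw [zero_mul]; exact S.zero_mem
      neg_mem' := fun {a} ha t ht => by rw [neg_mul]; exact S.neg_mem (ha _ ht) }
  have hK : K = ⊤ := hs K fun t ht => by
    have h3 : rootElt 0 1 (s * s * (s * t)) ∈ H := m2 (m1 h h) (m1 h ht)
    have : s ^ 3 * t = s * s * (s * t) := by ring
    rw [this]; exact h3
  refine hasRoots_of_zero_one hy fun t => ?_
  have h1 : t * s⁻¹ ∈ K := by rw [hK]; trivial
  have h2 : t * s⁻¹ * s ∈ S := h1 s h
  rwa [mul_assoc, inv_mul_cancel₀ hs0, mul_one] at h2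

theorem exists_torus {H : Subgroup (Orth F)} (hH : HasRoots H) {g : F} (hg : g ≠ 0) :
    ∃ h ∈ H, ∀ z : Fin 8 → F,
      lin h z = ![z 0, g * z 1, g⁻¹ * z 2, z 3, z 4, g⁻¹ * z 5, g * z 6, z 7] := by
  have h12 : ∀ t : F, rootElt 1 2 t ∈ H := fun t => hH 1 2 (by decide) (by decide) (by decide) t
  have h21 : ∀ t : F, rootElt 2 1 t ∈ H := fun t => hH 2 1 (by decide) (by decide) (by decide) t
  have e1 : ∀ (t : F) z, lin (rootElt 1 2 t) z =
      ![z 0, z 1 + t * z 2, z 2, z 3, z 4, z 5, z 6 - t * z 5, z 7] := by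
    intro t z
    rw [lin_rootElt (by decide)]
    ext i; simp only [Pi.add_apply, Pi.sub_apply, Pi.smul_apply]
    fin_cases i <;> simp [bv_apply]
  have e2 : ∀ (t : F) z, lin (rootElt 2 1 t) z =
      ![z 0, z 1, z 2 + t * z 1, z 3, z 4, z 5 - t * z 6, z 6, z 7] := by
    intro t z
    rw [lin_rootElt (by decide)]
    ext i; simp only [Pi.add_apply, Pi.sub_apply, Pi.smul_apply]
    fin_cases i <;> simp [bv_apply]
  refine ⟨rootElt 1 2 g * rootElt 2 1 (-g⁻¹) * rootElt 1 2 g *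
    (rootElt 1 2 (-1) * rootElt 2 1 1 * rootElt 1 2 (-1)), ?_, ?_⟩
  · exact mul_mem (mul_mem (mul_mem (h12 _) (h21 _)) (h12 _))
      (mul_mem (mul_mem (h12 _) (h21 _)) (h12 _))
  · intro z
    simp only [lin_mul_apply, e1, e2]
    ext i; fin_cases i <;> simp <;> field_simp <;> ring

end OmegaEight

namespace OmegaEight

variable {F : Type*} [Field F]

theorem lin_siegel_zero_five (t : F) (z : Fin 8 → F) :
    lin (siegel (bv F 0) (t • bv F 5)) z =
      ![z 0 - t * z 1, z 1, z 2, z 3, z 4, z 5 + t * z 4, z 6, z 7] := by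
  rw [lin_siegel_bv _ _ (by decide)]
  ext i; simp only [Pi.add_apply, Pi.sub_apply, Pi.smul_apply]
  fin_cases i <;> simp [bv_apply]

theorem siegel_plane (α β γ δ a b c d : F) :
    siegel ![α, 0, 0, 0, 0, β, 0, 0] ![γ, 0, a, c, 0, δ, b, d] =
      siegel (bv F 0) (mid (α * a) (α * b) (α * c) (α * d)) *
      siegel (bv F 5) (mid (β * a) (β * b) (β * c) (β * d)) *
      siegel (bv F 0) ((α * δ - β * γ - α * β * (a * b + c * d)) • bv F 5) := by
  apply lin_ext
  intro z
  rw [siegel_apply (by simp [QPlus]) (by simp [polar])]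
  simp only [lin_mul_apply, lin_siegel_mid_zero, lin_siegel_mid_five, lin_siegel_zero_five]
  ext i
  simp only [Pi.add_apply, Pi.sub_apply, Pi.smul_apply]
  fin_cases i <;> simp [polar, QPlus] <;> ring

theorem mid_mul_mid (a b c d a' b' c' d' x y z w x' y' z' w' : F) :
    siegel (bv F 0) (mid a b c d) * siegel (bv F 5) (mid a' b' c' d') *
      (siegel (bv F 0) (mid x y z w) * siegel (bv F 5) (mid x' y' z' w')) =
    siegel (bv F 0) (mid (a + x) (b + y) (c + z) (d + w)) *
      siegel (bv F 5) (mid (a' + x') (b' + y') (c' + z') (d' + w')) *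
      siegel (bv F 0) ((-(a' * y + b' * x + c' * w + d' * z)) • bv F 5) := by
  apply lin_ext
  intro v
  simp only [lin_mul_apply, lin_siegel_mid_zero, lin_siegel_mid_five, lin_siegel_zero_five]
  ext i
  fin_cases i <;> simp <;> ring

/-- Membership of the element of the parabolic radical with the given coordinates. -/
def Rad (H : Subgroup (Orth F)) (m n : F × F × F × F) : Prop :=
  siegel (bv F 0) (mid m.1 m.2.1 m.2.2.1 m.2.2.2) *
    siegel (bv F 5) (mid n.1 n.2.1 n.2.2.1 n.2.2.2) ∈ H

variable {H : Subgroup (Orth F)}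

theorem Rad.add (hZ : ∀ c : F, siegel (bv F 0) (c • bv F 5) ∈ H) {m n m' n' : F × F × F × F}
    (h : Rad H m n) (h' : Rad H m' n') : Rad H (m + m') (n + n') := by
  have := mul_mem h h'
  rw [mid_mul_mid, Subgroup.mul_mem_cancel_right _ (hZ _)] at this
  exact this

theorem Rad.of_siegel (hZ : ∀ c : F, siegel (bv F 0) (c • bv F 5) ∈ H) {α β γ δ a b c d : F}
    (h : siegel ![α, 0, 0, 0, 0, β, 0, 0] ![γ, 0, a, c, 0, δ, b, d] ∈ H) :
    Rad H (α * a, α * b, α * c, α * d) (β * a, β * b, β * c, β * d) := by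
  rw [siegel_plane, Subgroup.mul_mem_cancel_right _ (hZ _)] at h
  exact h

theorem Rad.torus (hH : HasRoots H) {g a b c d a' b' c' d' : F} (hg : g ≠ 0)
    (h : Rad H (a, b, c, d) (a', b', c', d')) :
    Rad H (g⁻¹ * a, g * b, c, d) (g⁻¹ * (g⁻¹ * a'), b', g⁻¹ * c', g⁻¹ * d') := by
  obtain ⟨k, hk, e⟩ := exists_torus hH hg
  have h1 := conj_mem hk h
  rw [← mul_inv_cancel_right (siegel (bv F 0) _) k⁻¹, inv_inv] at h1
  have h2 : ∀ A B : Orth F, k * (A * k⁻¹ * k * B) * k⁻¹ = (k * A * k⁻¹) * (k * B * k⁻¹) := by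
    intro A B; group
  rw [h2, siegel_conj, siegel_conj] at h1
  have e0 : lin k (bv F 0) = bv F 0 := by rw [e]; ext i; fin_cases i <;> simp [bv_apply]
  have e5 : lin k (bv F 5) = g⁻¹ • bv F 5 := by rw [e]; ext i; fin_cases i <;> simp [bv_apply]
  rw [e0, e5, siegel_smul_left (QPlus_bv _)] at h1
  · have e1 : lin k (mid a b c d) = mid (g⁻¹ * a) (g * b) c d := by
      rw [e]; ext i; fin_cases i <;> simp [mid]
    have e2 : g⁻¹ • lin k (mid a' b' c' d') =
        mid (g⁻¹ * (g⁻¹ * a')) b' (g⁻¹ * c') (g⁻¹ * d') := by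
      rw [e]; ext i; fin_cases i <;> simp [mid, hg]
    rw [e1, e2] at h1
    exact h1
  · rw [polar_bv_left, e]; simp [mid]

theorem Rad.famXY {n p r s : F} (hx : famX n p r s ∈ H) (hy : famY F ∈ H)
    (hZ : ∀ c : F, siegel (bv F 0) (c • bv F 5) ∈ H) {a b c d a' b' c' d' : F}
    (h : Rad H (a, b, c, d) (a', b', c', d')) :
    Rad H (n * b + b', n * (a + p * r * b + r * c - p * d) + (a' + p * r * b' + r * c' - p * d'),
        n * (d - r * b) + (d' - r * b'), n * (c + p * b) + (c' + p * b'))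
      (-b, -(a + p * r * b + r * c - p * d), -(d - r * b), -(c + p * b)) := by
  set k := famX n p r s * famY F with hk
  have hkH : k ∈ H := mul_mem hx hy
  have e := lin_famX_famY n p r s
  rw [← hk] at e
  have h1 := conj_mem hkH h
  have h2 : ∀ A B : Orth F, k * (A * B) * k⁻¹ = (k * A * k⁻¹) * (k * B * k⁻¹) := by
    intro A B; group
  rw [h2, siegel_conj, siegel_conj] at h1
  have e0 : lin k (bv F 0) = ![n, 0, 0, 0, 0, -1, 0, 0] := by
    rw [e]; ext i; fin_cases i <;> simp [bv_apply]
  have e5 : lin k (bv F 5) = ![1, 0, 0, 0, 0, 0, 0, 0] := by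
    rw [e]; ext i; fin_cases i <;> simp [bv_apply]
  have em : ∀ a b c d : F, lin k (mid a b c d) = ![p * c - r * d + s * b, 0, b, d - r * b, 0,
      n * b, a + r * c - p * d + p * r * b, c + p * b] := by
    intro a b c d
    rw [e]; ext i; fin_cases i <;> simp [mid]
  rw [e0, e5, em, em, siegel_plane, siegel_plane] at h1
  have h3 : ∀ (t : F) (a b c d a' b' c' d' : F), siegel (bv F 0) (t • bv F 5) *
      (siegel (bv F 0) (mid a b c d) * siegel (bv F 5) (mid a' b' c' d')) =
      siegel (bv F 0) (mid a b c d) * siegel (bv F 5) (mid a' b' c' d') *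
        siegel (bv F 0) (t • bv F 5) := by
    intro t a b c d a' b' c' d'
    have := (mid_root_comm a b c d a' b' c' d' (-t)).eq
    rwa [rootElt, neg_neg] at this
  rw [← mul_assoc, Subgroup.mul_mem_cancel_right _ (hZ _), mul_assoc, h3, ← mul_assoc,
    Subgroup.mul_mem_cancel_right _ (hZ _), mid_mul_mid,
    Subgroup.mul_mem_cancel_right _ (hZ _)] at h1
  convert h1 using 1
  simp only [Rad]
  congr! 4 <;> ring

end OmegaEight

namespace OmegaEight

variable {F : Type*} [Field F] {H : Subgroup (Orth F)}

theorem Rad.congr {a b c d a' b' c' d' x y z w x' y' z' w' : F}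
    (h : Rad H (a, b, c, d) (a', b', c', d')) (h1 : a = x) (h2 : b = y) (h3 : c = z) (h4 : d = w)
    (h5 : a' = x') (h6 : b' = y') (h7 : c' = z') (h8 : d' = w') :
    Rad H (x, y, z, w) (x', y', z', w') := by
  subst_vars; exact h

theorem Rad.add' (hZ : ∀ c : F, siegel (bv F 0) (c • bv F 5) ∈ H)
    {a b c d a' b' c' d' x y z w x' y' z' w' : F}
    (h : Rad H (a, b, c, d) (a', b', c', d')) (h' : Rad H (x, y, z, w) (x', y', z', w')) :
    Rad H (a + x, b + y, c + z, d + w) (a' + x', b' + y', c' + z', d' + w') := by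
  have := Rad.add hZ h h'
  simpa only [Prod.mk_add_mk] using this

theorem exists_eq_mul {c : F} (hc : c ≠ 0) (t : F) : ∃ u, t = u * c :=
  ⟨t / c, (div_mul_cancel₀ t hc).symm⟩

theorem mid_smul_bv_six (t : F) : t • bv F 6 = mid 0 t 0 0 := by
  ext i; fin_cases i <;> simp [bv_apply, mid]

theorem mid_smul_bv_two (t : F) : t • bv F 2 = mid t 0 0 0 := by
  ext i; fin_cases i <;> simp [bv_apply, mid]

theorem mid_zero : mid (0 : F) 0 0 0 = 0 := by
  ext i; fin_cases i <;> simp [mid]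

theorem rad_left {a b c d : F} :
    Rad H (a, b, c, d) (0, 0, 0, 0) ↔ siegel (bv F 0) (mid a b c d) ∈ H := by
  simp [Rad, mid_zero, siegel_zero_right]

theorem rad_right {a b c d : F} :
    Rad H (0, 0, 0, 0) (a, b, c, d) ↔ siegel (bv F 5) (mid a b c d) ∈ H := by
  simp [Rad, mid_zero, siegel_zero_right]

theorem siegel_bv_mem (hH : HasRoots H) {j : Fin 8} (hj : j = 5 ∨ j = 6) (c : F) :
    siegel (bv F 0) (c • bv F j) ∈ H := by
  rcases hj with rfl | rfl
  · have := hH 0 1 (by decide) (by decide) (by decide) (-c)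
    rwa [rootElt, neg_neg] at this
  · have := hH 0 2 (by decide) (by decide) (by decide) (-c)
    rwa [rootElt, neg_neg] at this

variable {n p r s : F}

theorem rad_main (hx : famX n p r s ∈ H) (hy : famY F ∈ H) (hH : HasRoots H)
    (hpr : p ^ 2 ≠ r ^ 2) (hnp : n ^ 2 ≠ p ^ 2) (hnr : n ^ 2 ≠ r ^ 2) {g : F} (hg0 : g ≠ 0)
    (hg1 : g ≠ 1) (t : F) :
    Rad H (0, 0, 0, 0) (0, t, 0, 0) ∧ Rad H (0, 0, t, 0) (0, 0, 0, 0) ∧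
      Rad H (0, 0, 0, t) (0, 0, 0, 0) := by
  have hZ : ∀ c : F, siegel (bv F 0) (c • bv F 5) ∈ H := siegel_bv_mem hH (Or.inl rfl)
  have f1 : ∀ t : F, Rad H (0, t, 0, 0) (0, 0, 0, 0) := fun t => by
    rw [rad_left, ← mid_smul_bv_six]; exact siegel_bv_mem hH (Or.inr rfl) t
  have f2 : ∀ t : F, Rad H (0, 0, 0, 0) (t, 0, 0, 0) := fun t => by
    rw [rad_right, ← mid_smul_bv_two]
    have := hH 2 1 (by decide) (by decide) (by decide) t
    rw [rootElt, neg_smul, ← siegel_swap (QPlus_bv _) (by simp [QPlus_bv])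
      (by simp [polar_bv_left, bv_apply]), siegel_smul_left (QPlus_bv _)
      (by simp [polar_bv_left, bv_apply])] at this
    exact this
  have P : ∀ t : F, Rad H (n * t, n * t * p * r, -(n * t * r), n * t * p)
      (-t, -(t * p * r), t * r, -(t * p)) := by
    intro t
    have h1 := siegel_lin_mem hx (hH 1 0 (by decide) (by decide) (by decide) (-t))
    have e1 : lin (famX n p r s) (bv F 1) = ![n, 0, 0, 0, 0, -1, 0, 0] := by
      rw [lin_famX]; ext i; fin_cases i <;> simp [bv_apply]
    have e2 : lin (famX n p r s) ((- -t) • bv F (0 + 4)) =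
        ![s * t, 0, t, -(r * t), 0, n * t, p * r * t, p * t] := by
      rw [lin_famX]; ext i; fin_cases i <;> simp [bv_apply]
    rw [e1, e2] at h1
    refine (Rad.of_siegel hZ h1).congr ?_ ?_ ?_ ?_ ?_ ?_ ?_ ?_ <;> ring
  have P' : ∀ t : F, Rad H (n * t, 0, -(n * t * r), n * t * p) (0, -(t * p * r), t * r, -(t * p)) := by
    intro t
    refine (((P t).add' hZ (f1 (-(n * t * p * r)))).add' hZ (f2 t)).congr ?_ ?_ ?_ ?_ ?_ ?_ ?_ ?_ <;>
      ring
  have hg : 1 - g⁻¹ ≠ 0 := by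
    intro h; apply hg1
    rw [sub_eq_zero, eq_comm, inv_eq_one] at h; exact h
  have E1 : ∀ t : F, Rad H (n * t, 0, 0, 0) (0, 0, t * r, -(t * p)) := by
    intro t
    obtain ⟨u, rfl⟩ := exists_eq_mul hg t
    refine ((P' u).add' hZ ((P' (-u)).torus hH hg0)).congr ?_ ?_ ?_ ?_ ?_ ?_ ?_ ?_ <;> ring
  have E2 : ∀ t : F, Rad H (0, 0, -(n * t * r), n * t * p) (0, -(t * p * r), 0, 0) := by
    intro t
    refine ((P' t).add' hZ (E1 (-t))).congr ?_ ?_ ?_ ?_ ?_ ?_ ?_ ?_ <;> ring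
  have E3 : ∀ t : F, Rad H (0, 0, -(p * t), r * t) (0, -(n * t), 0, 0) := by
    intro t
    refine (((E1 t).famXY hx hy hZ).add' hZ
      (f1 (-(n * (n * t)) - r * (t * r) - p * (t * p)))).congr ?_ ?_ ?_ ?_ ?_ ?_ ?_ ?_ <;> ring
  have W2 : ∀ t : F, Rad H (-(t * p * r), 0, n ^ 2 * t * p + t * p * r * r, -(n ^ 2 * t * r) - t * p * r * p)
      (0, n * t * (p ^ 2 + r ^ 2), -(n * t * p), n * t * r) := by
    intro t
    refine (((E2 t).famXY hx hy hZ).add' hZ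
      (f1 (n * (n * t * r * r + n * t * p * p) + p * r * (t * p * r)))).congr
        ?_ ?_ ?_ ?_ ?_ ?_ ?_ ?_ <;> ring
  have E5 : ∀ t : F, Rad H (-(t * p * r), 0, 0, 0) (0, 0, -(n * t * p), n * t * r) := by
    intro t
    obtain ⟨u, rfl⟩ := exists_eq_mul hg t
    refine ((W2 u).add' hZ ((W2 (-u)).torus hH hg0)).congr ?_ ?_ ?_ ?_ ?_ ?_ ?_ ?_ <;> ring
  have E4 : ∀ t : F, Rad H (0, 0, t * p * r * r, -(t * p * r * p))
      (0, n * t * (p ^ 2 + r ^ 2 - n ^ 2), 0, 0) := by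
    intro t
    refine (((W2 t).add' hZ (E5 (-t))).add' hZ (E3 (n ^ 2 * t))).congr ?_ ?_ ?_ ?_ ?_ ?_ ?_ ?_ <;> ring
  have hdet : (n ^ 2 - p ^ 2) * (n ^ 2 - r ^ 2) ≠ 0 :=
    mul_ne_zero (sub_ne_zero.2 hnp) (sub_ne_zero.2 hnr)
  have G1 : ∀ t : F, Rad H (0, 0, 0, 0) (0, t, 0, 0) := by
    intro t
    obtain ⟨u, rfl⟩ := exists_eq_mul hdet t
    refine ((E4 (-(n * u))).add' hZ (E2 (-(p * r * u)))).congr ?_ ?_ ?_ ?_ ?_ ?_ ?_ ?_ <;> ring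
  have G2 : ∀ t : F, Rad H (0, 0, -(p * t), r * t) (0, 0, 0, 0) := by
    intro t
    refine ((E3 t).add' hZ (G1 (n * t))).congr ?_ ?_ ?_ ?_ ?_ ?_ ?_ ?_ <;> ring
  have G3 : ∀ t : F, Rad H (0, 0, -(r * t), p * t) (0, 0, 0, 0) := by
    intro t
    by_cases hn : n = 0
    · have hp : p ≠ 0 := by rintro rfl; apply hnp; rw [hn]
      have hr : r ≠ 0 := by rintro rfl; apply hnr; rw [hn]
      obtain ⟨u, rfl⟩ := exists_eq_mul (mul_ne_zero hp hr) t
      refine ((E4 (-u)).add' hZ (G1 (n * u * (p ^ 2 + r ^ 2 - n ^ 2)))).congr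
        ?_ ?_ ?_ ?_ ?_ ?_ ?_ ?_ <;> ring
    · obtain ⟨u, rfl⟩ := exists_eq_mul hn t
      refine ((E2 u).add' hZ (G1 (u * p * r))).congr ?_ ?_ ?_ ?_ ?_ ?_ ?_ ?_ <;> ring
  obtain ⟨u, rfl⟩ := exists_eq_mul (sub_ne_zero.2 hpr) t
  refine ⟨G1 _, ?_, ?_⟩
  · refine ((G2 (-(p * u))).add' hZ (G3 (r * u))).congr ?_ ?_ ?_ ?_ ?_ ?_ ?_ ?_ <;> ring
  · refine ((G2 (-(r * u))).add' hZ (G3 (p * u))).congr ?_ ?_ ?_ ?_ ?_ ?_ ?_ ?_ <;> ring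

theorem family_generates (hx : famX n p r s ∈ H) (hy : famY F ∈ H) (hH : HasRoots H)
    (hpr : p ^ 2 ≠ r ^ 2) (hnp : n ^ 2 ≠ p ^ 2) (hnr : n ^ 2 ≠ r ^ 2) {g : F} (hg0 : g ≠ 0)
    (hg1 : g ≠ 1) : siegelGroup F ≤ H := by
  have hm := rad_main hx hy hH hpr hnp hnr hg0 hg1
  have b5 : ∀ t : F, siegel (bv F 0) (t • bv F 5) ∈ H := siegel_bv_mem hH (Or.inl rfl)
  have b6 : ∀ t : F, siegel (bv F 0) (t • bv F 6) ∈ H := siegel_bv_mem hH (Or.inr rfl)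
  have b3 : ∀ t : F, siegel (bv F 0) (t • bv F 3) ∈ H := fun t => by
    have h := rad_left.1 (hm t).2.1
    have : t • bv F 3 = mid 0 0 t 0 := by ext i; fin_cases i <;> simp [bv_apply, mid]
    rwa [this]
  have b7 : ∀ t : F, siegel (bv F 0) (t • bv F 7) ∈ H := fun t => by
    have h := rad_left.1 (hm t).2.2
    have : t • bv F 7 = mid 0 0 0 t := by ext i; fin_cases i <;> simp [bv_apply, mid]
    rwa [this]
  have b1 : ∀ t : F, siegel (bv F 0) (t • bv F 1) ∈ H := fun t => by
    have h := siegel_lin_mem hx (rad_right.1 (hm t).1)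
    have e1 : lin (famX n p r s) (bv F 5) = -bv F 1 + n • bv F 6 := by
      rw [lin_famX]; ext i; fin_cases i <;> simp [bv_apply]
    have e2 : lin (famX n p r s) (mid 0 t 0 0) = t • bv F 0 := by
      rw [lin_famX]; ext i; fin_cases i <;> simp [bv_apply, mid]
    have q1 : QPlus F (-bv F 1 + n • bv F 6) = 0 := by simp [QPlus, bv_apply]
    rw [e1, e2, siegel_swap (a := t • bv F 0) (by simp [QPlus_bv]) q1 (by simp [polar, bv_apply]),
      siegel_smul_left (QPlus_bv _) (by simp [polar, bv_apply])] at h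
    have h2 := mul_mem h (b6 (t * n))
    rw [← siegel_add (QPlus_bv _) (by simp [polar, bv_apply]) (by simp [polar, bv_apply])] at h2
    convert h2 using 2
    ext i; simp; ring
  have b2 : ∀ t : F, siegel (bv F 0) (t • bv F 2) ∈ H := fun t => by
    have h := siegel_lin_mem hy (siegel_lin_mem hy (b1 t))
    simp only [map_smul, lin_famY_bv] at h
    have h' : siegel (bv F 2) (t • bv F 0) ∈ H := h
    rw [siegel_swap (a := t • bv F 0) (by simp [QPlus_bv]) (QPlus_bv _) (by simp [polar, bv_apply]),
      siegel_smul_left (QPlus_bv _) (by simp [polar, bv_apply])] at h'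
    have h2 := inv_mem h'
    rwa [← siegel_neg (QPlus_bv _) (by simp [polar, bv_apply]), smul_neg, neg_neg] at h2
  have hyx : famY F * famX n p r s ∈ H := mul_mem hy hx
  refine siegelGroup_le_of (fun b hb => ?_) hyx ?_
  · have hb4 : b 4 = 0 := by rw [polar_bv_left] at hb; exact hb
    have : siegel (bv F 0) b = siegel (bv F 0) (b 0 • bv F 0 + (b 1 • bv F 1 + (b 2 • bv F 2 +
        (b 3 • bv F 3 + (b 5 • bv F 5 + (b 6 • bv F 6 + b 7 • bv F 7)))))) := by
      congr 1
      ext i; fin_cases i <;> simp [bv_apply, hb4]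
    rw [this, siegel_add, siegel_self, siegel_add, siegel_add, siegel_add, siegel_add, siegel_add,
      one_mul]
    · exact mul_mem (b1 _) (mul_mem (b2 _) (mul_mem (b3 _) (mul_mem (b5 _) (mul_mem (b6 _) (b7 _)))))
    all_goals simp [polar, QPlus, bv_apply]
  · rw [lin_mul_apply, lin_famX, lin_famY]
    ext i; fin_cases i <;> simp [bv_apply]

end OmegaEight

namespace OmegaEight

variable {F : Type*} [Field F]

/-- The derived group is generated by an involution and an element of order three. -/
def Generated (F : Type*) [Field F] : Prop :=
  ∃ x y : Orth F, x ∈ siegelGroup F ∧ y ∈ siegelGroup F ∧ x * x = 1 ∧ y ^ 3 = 1 ∧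
    x * y ≠ y * x ∧ siegelGroup F ≤ Subgroup.closure {x, y}

theorem famX_famY_ne (n p r s : F) : famX n p r s * famY F ≠ famY F * famX n p r s := by
  intro h
  have := congrArg (fun g => lin g (bv F 0) 4) h
  simp only [lin_mul_apply, lin_famX, lin_famY] at this
  simp [bv_apply] at this

theorem generated_of_hasRoots {n p r s g : F} (hpr : p ^ 2 ≠ r ^ 2) (hnp : n ^ 2 ≠ p ^ 2)
    (hnr : n ^ 2 ≠ r ^ 2) (hg0 : g ≠ 0) (hg1 : g ≠ 1)
    (h : HasRoots (Subgroup.closure {famX n p r s, famY F})) : Generated F :=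
  ⟨famX n p r s, famY F, famX_mem n p r s, famY_mem, famX_mul_self n p r s, famY_pow,
    famX_famY_ne n p r s, family_generates (n := n) (p := p) (r := r) (s := s)
      (Subgroup.subset_closure (Set.mem_insert _ _))
      (Subgroup.subset_closure (Set.mem_insert_of_mem _ rfl)) h hpr hnp hnr hg0 hg1⟩

theorem generated_of_params [Fintype F] {n p r s g : F} (hpr : p ^ 2 ≠ r ^ 2) (hnp : n ^ 2 ≠ p ^ 2)
    (hnr : n ^ 2 ≠ r ^ 2) (hg0 : g ≠ 0) (hg1 : g ≠ 1) (hD : famDelta n p r ≠ 0) (hn : n ^ 2 ≠ 4)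
    (hp : p ^ 2 ≠ 4) (hr : r ^ 2 ≠ 4) {w : F} (hw : famNum n p r s = w * famDelta n p r)
    (hw0 : w ≠ 0) (hK : ∀ K : Subring F, w ^ 3 ∈ K → K = ⊤) : Generated F := by
  refine generated_of_hasRoots (s := s) hpr hnp hnr hg0 hg1 ?_
  have hx : famX n p r s ∈ Subgroup.closure {famX n p r s, famY F} :=
    Subgroup.subset_closure (by simp)
  have hy : famY F ∈ Subgroup.closure {famX n p r s, famY F} :=
    Subgroup.subset_closure (by simp)
  refine hasRoots_of_generator hy hw0 hK ?_
  have := famXY_pow n p r s hD hn hp hr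
  rw [hw, mul_div_cancel_right₀ _ hD] at this
  rw [← this]
  exact pow_mem (mul_mem hx hy) _

theorem proper_subring [Fintype F] (K : Subring F) (hK : K ≠ ⊤) :
    ∃ k m : ℕ, 2 ≤ k ∧ 2 ≤ m ∧ Fintype.card F = k ^ m ∧ ∀ a ∈ K, a ≠ 0 → a ^ (k - 1) = 1 := by
  classical
  letI : Fintype K := Fintype.ofFinite K
  letI : Field K := (Finite.isDomain_to_isField K).toField
  refine ⟨Fintype.card K, Module.finrank K F, Fintype.one_lt_card, ?_, Module.card_eq_pow_finrank,
    ?_⟩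
  · by_contra h
    have h0 : 0 < Module.finrank K F := Module.finrank_pos
    have h1 : Module.finrank K F = 1 := by omega
    apply hK
    have hc := Module.card_eq_pow_finrank (K := K) (V := F)
    rw [h1, pow_one] at hc
    rw [eq_top_iff]
    intro x _
    have hb : Function.Bijective (Subtype.val : K → F) := by
      rw [Fintype.bijective_iff_injective_and_card]
      exact ⟨Subtype.val_injective, hc.symm⟩
    obtain ⟨y, rfl⟩ := hb.2 x
    exact y.2
  · intro a ha ha0
    have := FiniteField.pow_card_sub_one_eq_one (⟨a, ha⟩ : K) (by
      intro h; exact ha0 (congrArg Subtype.val h))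
    exact congrArg Subtype.val this

theorem exists_primitive [Fintype F] : ∃ z : F, z ≠ 0 ∧ orderOf z = Fintype.card F - 1 := by
  classical
  obtain ⟨u, hu⟩ := IsCyclic.exists_ofOrder_eq_natCard (α := Fˣ)
  refine ⟨u, u.ne_zero, ?_⟩
  rw [orderOf_units, hu, Nat.card_eq_fintype_card, Fintype.card_units]

theorem card_le_of_pow_mem [Fintype F] {z : F} (hz0 : z ≠ 0) (hz : orderOf z = Fintype.card F - 1)
    {j : ℕ} (hj : 0 < j) {K : Subring F} (hK : K ≠ ⊤) (h : z ^ j ∈ K) :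
    ∃ k m : ℕ, 2 ≤ k ∧ 2 ≤ m ∧ Fintype.card F = k ^ m ∧ Fintype.card F - 1 ≤ j * (k - 1) := by
  obtain ⟨k, m, hk, hm, hc, ha⟩ := proper_subring K hK
  refine ⟨k, m, hk, hm, hc, ?_⟩
  have := ha _ h (pow_ne_zero _ hz0)
  rw [← pow_mul] at this
  have := orderOf_dvd_of_pow_eq_one this
  rw [hz] at this
  exact Nat.le_of_dvd (Nat.mul_pos hj (by omega)) this

theorem generated_even [Fintype F] (h2 : (2 : F) = 0) (hq : 8 ≤ Fintype.card F) : Generated F := by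
  classical
  obtain ⟨z, hz0, hz⟩ := exists_primitive (F := F)
  have hneg : ∀ a : F, -a = a := fun a => by linear_combination -a * h2
  have hz1 : z + 1 ≠ 0 := by
    intro h
    have : z = 1 := by linear_combination h - h2
    rw [this, orderOf_one] at hz
    omega
  obtain ⟨k, hk⟩ : ∃ k : F, k * (z + 1) = 1 := ⟨(z + 1)⁻¹, inv_mul_cancel₀ hz1⟩
  have hk0 : k ≠ 0 := left_ne_zero_of_mul_eq_one hk
  obtain ⟨a, ha⟩ : ∃ a : F, a ∉ ({0, k} : Finset F) := by
    by_contra! h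
    have := Finset.card_le_card (fun x _ => h x : (Finset.univ : Finset F) ⊆ {0, k})
    have h3 : ({0, k} : Finset F).card ≤ 2 := Finset.card_le_two
    rw [Finset.card_univ] at this
    omega
  simp only [Finset.mem_insert, Finset.mem_singleton, not_or] at ha
  obtain ⟨ha0, hak⟩ := ha
  have hak' : a + k ≠ 0 := by
    intro h; apply hak; linear_combination h - k * h2
  obtain ⟨p, hp⟩ : ∃ p : F, p * a = 1 := ⟨a⁻¹, inv_mul_cancel₀ ha0⟩
  obtain ⟨r, hr⟩ : ∃ r : F, r * (a + k) = 1 := ⟨(a + k)⁻¹, inv_mul_cancel₀ hak'⟩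
  have hp0 : p ≠ 0 := left_ne_zero_of_mul_eq_one hp
  have hr0 : r ≠ 0 := left_ne_zero_of_mul_eq_one hr
  have hn : k * p * r = p + r := by
    linear_combination p * hr - r * hp - r * h2
  have hsq : ∀ {x y : F}, x ^ 2 = y ^ 2 → x = y := by
    intro x y h
    have : (x - y) ^ 2 = 0 := by linear_combination h - x * y * h2 + y ^ 2 * h2
    have := pow_eq_zero_iff (two_ne_zero) |>.1 this
    exact sub_eq_zero.1 this
  have h4 : (4 : F) = 0 := by linear_combination 2 * h2
  have hpr0 : p + r ≠ 0 := by rw [← hn]; exact mul_ne_zero (mul_ne_zero hk0 hp0) hr0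
  have hne : ∀ {x : F}, x ≠ 0 → x ^ 2 ≠ 4 := by
    intro x hx h; rw [h4] at h; exact hx (pow_eq_zero_iff two_ne_zero |>.1 h)
  have hD : famDelta (p + r) p r = k * p ^ 2 * r ^ 2 := by
    rw [famDelta]
    linear_combination -(p * r) * hn + (p ^ 2 + r ^ 2 - 2 + p * r - p * r * (p + r)) * h2
  refine generated_of_params (n := p + r) (p := p) (r := r) (s := 0) (w := z) (g := z)
    ?_ ?_ ?_ hz0 ?_ ?_ (hne hpr0) (hne hp0) (hne hr0) ?_ hz0 ?_
  · intro h
    apply hpr0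
    rw [hsq h]; linear_combination r * h2
  · intro h
    apply hr0
    linear_combination hsq h
  · intro h
    apply hp0
    linear_combination hsq h
  · intro h; apply hz1; rw [h]; linear_combination h2
  · rw [hD]; exact mul_ne_zero (mul_ne_zero hk0 (pow_ne_zero _ hp0)) (pow_ne_zero _ hr0)
  · rw [hD, famNum]
    linear_combination 3 * p * r * hn - p ^ 2 * r ^ 2 * hk +
      (p ^ 2 + r ^ 2 + p * r - k * p ^ 2 * r ^ 2) * h2
  · intro K h
    by_contra hK
    obtain ⟨k, m, hk, hm, hc, hle⟩ := card_le_of_pow_mem hz0 hz (by norm_num) hK h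
    have h1 : k ^ 2 ≤ Fintype.card F := by rw [hc]; exact Nat.pow_le_pow_right (by omega) hm
    rcases Nat.lt_or_ge k 3 with h3 | h3
    · have : k = 2 := by omega
      subst this; omega
    · have : 3 * k ≤ k ^ 2 := by nlinarith
      omega

end OmegaEight

namespace OmegaEight

variable {F : Type*} [Field F]

theorem generated_odd_of_params [Fintype F] (h2 : (2 : F) ≠ 0) {c r p : F} (hc0 : c ≠ 0)
    (hc1 : c ^ 2 ≠ 1) (hc2 : c ^ 2 ≠ -1) (hw0 : 1 + 2 * c ^ 2 ≠ 0) (hr : r * c = c ^ 2 + 1)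
    (hp0 : p ≠ 0) (hp2 : p ^ 2 ≠ 4) (hpr : p ^ 2 ≠ r ^ 2) (hp : p ^ 2 ≠ 4 - r ^ 2)
    (hK : ∀ K : Subring F, (1 + 2 * c ^ 2) ^ 3 ∈ K → K = ⊤) : Generated F := by
  have h4 : (4 : F) ≠ 0 := by
    have : (4 : F) = 2 * 2 := by norm_num
    rw [this]; exact mul_ne_zero h2 h2
  have hr0 : r ≠ 0 := by
    rintro rfl
    apply hc2; linear_combination -hr
  refine generated_of_params (n := 0) (p := p) (r := r) (s := p ^ 2 + 2 * c ^ 2)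
    (w := 1 + 2 * c ^ 2) (g := 2) hpr ?_ ?_ h2 ?_ ?_ ?_ hp2 ?_ ?_ hw0 hK
  · simpa using (pow_ne_zero 2 hp0).symm
  · simpa using (pow_ne_zero 2 hr0).symm
  · intro h; apply one_ne_zero (α := F); linear_combination h
  · rw [famDelta]; intro h; apply hp; linear_combination h
  · simpa using h4.symm
  · intro h
    have : (c ^ 2 - 1) ^ 2 = 0 := by linear_combination c ^ 2 * h - (r * c + c ^ 2 + 1) * hr
    apply hc1
    linear_combination (pow_eq_zero_iff two_ne_zero).1 this
  · rw [famNum, famDelta]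
    linear_combination -4 * (r * c + c ^ 2 + 1) * hr

theorem generated_odd_of_nine [Fintype F] (h2 : (2 : F) ≠ 0) (hq : 9 ≤ Fintype.card F) {c : F}
    (hc0 : c ≠ 0) (hc1 : c ^ 2 ≠ 1) (hc2 : c ^ 2 ≠ -1) (hw0 : 1 + 2 * c ^ 2 ≠ 0)
    (hK : ∀ K : Subring F, (1 + 2 * c ^ 2) ^ 3 ∈ K → K = ⊤) : Generated F := by
  classical
  obtain ⟨r, hr⟩ : ∃ r : F, r * c = c ^ 2 + 1 := ⟨(c ^ 2 + 1) / c, div_mul_cancel₀ _ hc0⟩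
  obtain ⟨t, ht⟩ : ∃ t : F, ∀ p : F, p ^ 2 = 4 - r ^ 2 → p = t ∨ p = -t := by
    by_cases h : ∃ t : F, t ^ 2 = 4 - r ^ 2
    · obtain ⟨t, ht⟩ := h
      exact ⟨t, fun p hp => sq_eq_sq_iff_eq_or_eq_neg.1 (hp.trans ht.symm)⟩
    · exact ⟨0, fun p hp => (h ⟨p, hp⟩).elim⟩
  obtain ⟨p, hp⟩ : ∃ p : F, p ∉ [0, 2, -2, r, -r, t, -t].toFinset := by
    by_contra! h
    have h1 := Finset.card_le_card (fun x _ => h x : (Finset.univ : Finset F) ⊆ _)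
    have h3 := List.toFinset_card_le [0, 2, -2, r, -r, t, -t]
    rw [Finset.card_univ] at h1
    simp only [List.length_cons, List.length_nil] at h3
    omega
  simp only [List.mem_toFinset, List.mem_cons, List.not_mem_nil, or_false, not_or] at hp
  obtain ⟨a1, a2, a3, a4, a5, a6, a7⟩ := hp
  refine generated_odd_of_params h2 hc0 hc1 hc2 hw0 hr a1 ?_ ?_ ?_ hK
  · intro h
    rcases sq_eq_sq_iff_eq_or_eq_neg.1 (h.trans (by norm_num : (4 : F) = 2 ^ 2)) with h | h
    exacts [a2 h, a3 h]
  · intro h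
    rcases sq_eq_sq_iff_eq_or_eq_neg.1 h with h | h
    exacts [a4 h, a5 h]
  · intro h
    rcases ht p h with h | h
    exacts [a6 h, a7 h]

theorem natCast_ne_zero_of_coprime [Fintype F] {n : ℕ} (h : Nat.Coprime n (Fintype.card F)) :
    (n : F) ≠ 0 := by
  intro h0
  have h1 : (Fintype.card F : F) = 0 := Nat.cast_card_eq_zero F
  obtain ⟨a, b, hab⟩ := Nat.isCoprime_iff_coprime.2 h
  have := congrArg (Int.cast : ℤ → F) hab
  push_cast at this
  rw [h0, h1] at this
  simp at this

theorem generated_of_prime [Fintype F] (hq : 7 ≤ Fintype.card F) (hp : (Fintype.card F).Prime) :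
    Generated F := by
  have cop : ∀ n : ℕ, n.Prime → n < 7 → (n : F) ≠ 0 := fun n hn h =>
    natCast_ne_zero_of_coprime ((Nat.coprime_primes hn hp).2 (by omega))
  have h2 : (2 : F) ≠ 0 := by exact_mod_cast cop 2 (by norm_num) (by norm_num)
  have h3 : (3 : F) ≠ 0 := by exact_mod_cast cop 3 (by norm_num) (by norm_num)
  have h5 : (5 : F) ≠ 0 := by exact_mod_cast cop 5 (by norm_num) (by norm_num)
  have hK : ∀ K : Subring F, K = ⊤ := by
    intro K
    by_contra h
    obtain ⟨k, m, hk, hm, hc, -⟩ := proper_subring K h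
    rw [hc] at hp
    exact Nat.Prime.not_prime_pow hm hp
  have e1 : (2 : F) ^ 2 ≠ 1 := fun h => h3 (by linear_combination h)
  have e2 : (2 : F) ^ 2 ≠ -1 := fun h => h5 (by linear_combination h)
  have e3 : 1 + 2 * (2 : F) ^ 2 ≠ 0 := by
    have : 1 + 2 * (2 : F) ^ 2 = 3 * 3 := by norm_num
    rw [this]; exact mul_ne_zero h3 h3
  by_cases h9 : 9 ≤ Fintype.card F
  · exact generated_odd_of_nine h2 h9 h2 e1 e2 e3 fun K _ => hK K
  · have h7 : Fintype.card F = 7 := by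
      have : Fintype.card F = 7 ∨ Fintype.card F = 8 := by omega
      rcases this with h | h
      · exact h
      · rw [h] at hp; norm_num at hp
    have h0 : (7 : F) = 0 := by
      have := Nat.cast_card_eq_zero F
      rw [h7] at this
      exact_mod_cast this
    refine generated_odd_of_params (c := 2) (r := -1) (p := 3) h2 h2 e1 e2 e3 ?_ h3 ?_ ?_ ?_
      fun K _ => hK K
    · linear_combination -h0
    · intro h; exact h5 (by linear_combination h)
    · intro h; apply one_ne_zero (α := F); linear_combination h - h0
    · intro h; apply one_ne_zero (α := F); linear_combination -h + h0

theorem isSquare_or_isSquare [Fintype F] (h2 : ringChar F ≠ 2) {a b : F} (ha : a ≠ 0) (hb : b ≠ 0)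
    (h : ¬IsSquare (a * b)) : IsSquare a ∨ IsSquare b := by
  by_contra! hn
  rw [FiniteField.isSquare_iff h2 ha] at hn
  rw [FiniteField.isSquare_iff h2 hb] at hn
  rw [FiniteField.isSquare_iff h2 (mul_ne_zero ha hb), mul_pow] at h
  have h3 := (FiniteField.pow_dichotomy h2 ha).resolve_left hn.1
  have h4 := (FiniteField.pow_dichotomy h2 hb).resolve_left hn.2
  apply h
  rw [h3, h4]; ring

theorem exists_param [Fintype F] (h2 : ringChar F ≠ 2) {Z : F} (hZ0 : Z ≠ 0) (hZ1 : Z ≠ 1)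
    (hZ : ¬IsSquare (-Z)) : ∃ c : F, 1 + 2 * c ^ 2 = Z ∨ (1 + 2 * c ^ 2) * Z = 1 := by
  have h2' : (2 : F) ≠ 0 := Ring.two_ne_zero h2
  have ha : (Z - 1) / 2 ≠ 0 := div_ne_zero (sub_ne_zero.2 hZ1) h2'
  have hb : (Z⁻¹ - 1) / 2 ≠ 0 := div_ne_zero (sub_ne_zero.2 (by simpa using hZ1)) h2'
  have hab : ¬IsSquare ((Z - 1) / 2 * ((Z⁻¹ - 1) / 2)) := by
    rintro ⟨d, hd⟩
    apply hZ
    refine ⟨2 * d * Z / (Z - 1), ?_⟩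
    have : Z - 1 ≠ 0 := sub_ne_zero.2 hZ1
    field_simp at hd ⊢
    linear_combination hd
  rcases isSquare_or_isSquare h2 ha hb hab with ⟨c, hc⟩ | ⟨c, hc⟩
  · refine ⟨c, Or.inl ?_⟩
    rw [pow_two, ← hc]; field_simp; ring
  · refine ⟨c, Or.inr ?_⟩
    rw [pow_two, ← hc]; field_simp; ring

theorem generated_of_square_class [Fintype F] (h2 : ringChar F ≠ 2) (hp : ¬(Fintype.card F).Prime)
    {z : F} (hz0 : z ≠ 0) (hz : orderOf z = Fintype.card F - 1) {j : ℕ} (hj : 0 < j) (hj2 : j ≤ 2)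
    (hsq : ¬IsSquare (-z ^ j))
    (hk : ∀ k m : ℕ, 2 ≤ k → 2 ≤ m → Fintype.card F = k ^ m →
      ¬Fintype.card F - 1 ≤ j * 3 * (k - 1)) : Generated F := by
  have h2' : (2 : F) ≠ 0 := Ring.two_ne_zero h2
  obtain ⟨ℓ, hℓ⟩ := CharP.exists F
  obtain ⟨n, hℓp, hn⟩ := FiniteField.card F ℓ
  haveI : Fact ℓ.Prime := ⟨hℓp⟩
  haveI : ExpChar F ℓ := ExpChar.prime hℓp
  have hℓ2 : ℓ ≠ 2 := fun h => h2 (by rw [← h]; exact ringChar.eq F ℓ ▸ rfl)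
  have hℓ3 : 3 ≤ ℓ := by have := hℓp.two_le; omega
  have hn2 : 2 ≤ (n : ℕ) := by
    have h1 := n.pos
    by_contra h
    have : (n : ℕ) = 1 := by omega
    rw [this, pow_one] at hn
    exact hp (hn ▸ hℓp)
  have hq : ℓ ^ 2 ≤ Fintype.card F := by rw [hn]; exact Nat.pow_le_pow_right (by omega) hn2
  have hbig : 9 ≤ Fintype.card F := by nlinarith
  have key : ∀ s : F, (s = z ^ j ∨ s * z ^ j = 1) → ∀ e, s ^ e = 1 → 0 < e →
      Fintype.card F - 1 ≤ j * e := by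
    intro s hs e he he0
    have h1 : z ^ (j * e) = 1 := by
      rw [pow_mul]
      rcases hs with rfl | h
      · exact he
      · have := congrArg (· ^ e) h
        simpa [mul_pow, he] using this
    have := orderOf_dvd_of_pow_eq_one h1
    rw [hz] at this
    exact Nat.le_of_dvd (Nat.mul_pos hj he0) this
  have frob : ∀ s : F, (s = z ^ j ∨ s * z ^ j = 1) → frobenius F ℓ s ≠ s := by
    intro s hs h
    have hs0 : s ≠ 0 := by
      rcases hs with rfl | h
      · exact pow_ne_zero _ hz0
      · exact left_ne_zero_of_mul_eq_one h
    have h1 : s ^ (ℓ - 1) = 1 := by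
      apply mul_right_cancel₀ hs0
      rw [← pow_succ, Nat.sub_add_cancel (by omega), one_mul]
      exact h
    have h3 := key s hs _ h1 (by omega)
    have h4 : j * (ℓ - 1) ≤ 2 * (ℓ - 1) := Nat.mul_le_mul_right _ hj2
    have : 3 * ℓ ≤ ℓ ^ 2 := by nlinarith
    omega
  have hZ1 : z ^ j ≠ 1 := fun h => frob _ (Or.inl rfl) (by rw [h, map_one])
  obtain ⟨c, hc⟩ := exists_param h2 (pow_ne_zero j hz0) hZ1 hsq
  have hf := frob _ hc
  refine generated_odd_of_nine h2' hbig (c := c) ?_ ?_ ?_ ?_ ?_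
  · rintro rfl; simp at hf
  · intro h; rw [h] at hf; exact hf (by rw [map_add, map_mul, map_one, map_ofNat])
  · intro h; rw [h] at hf; exact hf (by rw [map_add, map_mul, map_neg, map_one, map_ofNat])
  · intro h; rw [h] at hf; simp at hf
  · intro K h
    by_contra hK
    obtain ⟨k, m, hk2, hm, hcard, hpow⟩ := proper_subring K hK
    have hs0 : 1 + 2 * c ^ 2 ≠ 0 := fun h => by rw [h] at hf; simp at hf
    have := hpow _ h (pow_ne_zero _ hs0)
    rw [← pow_mul] at this
    have := key _ hc _ this (by omega)
    rw [← mul_assoc] at this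
    exact hk k m hk2 hm hcard this

theorem generated_odd_nonprime [Fintype F] (h2 : ringChar F ≠ 2) (hp : ¬(Fintype.card F).Prime) :
    Generated F := by
  obtain ⟨z, hz0, hz⟩ := exists_primitive (F := F)
  have hodd := FiniteField.odd_card_of_char_ne_two h2
  have hone : 1 < Fintype.card F := Fintype.one_lt_card
  have hodd' : ∀ k m : ℕ, 2 ≤ m → Fintype.card F = k ^ m → k % 2 = 1 := by
    intro k m hm h
    rw [h] at hodd
    rcases Nat.mod_two_eq_zero_or_one k with h | h
    · rw [Nat.pow_mod, h, zero_pow (by omega)] at hodd; omega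
    · exact h
  by_cases h4 : Fintype.card F % 4 = 3
  · refine generated_of_square_class h2 hp hz0 hz (j := 2) (by norm_num) le_rfl ?_ ?_
    · intro h
      have : IsSquare (-1 : F) := by
        obtain ⟨d, hd⟩ := h
        refine ⟨d / z, ?_⟩
        field_simp
        linear_combination hd
      exact FiniteField.isSquare_neg_one_iff.1 this h4
    · intro k m hk hm hc h
      have hko := hodd' k m hm hc
      have hm3 : 3 ≤ m := by
        by_contra h3
        have : m = 2 := by omega
        subst this
        rw [hc, Nat.pow_mod] at h4
        have : k % 4 = 1 ∨ k % 4 = 3 := by omega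
        rcases this with h | h <;> rw [h] at h4 <;> norm_num at h4
      have h1 : k ^ 3 ≤ Fintype.card F := by rw [hc]; exact Nat.pow_le_pow_right (by omega) hm3
      have hk3 : 3 ≤ k := by omega
      have : 9 * k ≤ k ^ 3 := by nlinarith [Nat.mul_le_mul hk3 hk3]
      omega
  · refine generated_of_square_class h2 hp hz0 hz (j := 1) (by norm_num) (by norm_num) ?_ ?_
    · intro h
      have h1 : IsSquare (-1 : F) := FiniteField.isSquare_neg_one_iff.2 h4
      have h3 : IsSquare z := by
        have := h1.mul h
        simpa using this
      rw [FiniteField.isSquare_iff h2 hz0] at h3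
      have := orderOf_dvd_of_pow_eq_one h3
      rw [hz] at this
      have := Nat.le_of_dvd (by omega) this
      omega
    · intro k m hk hm hc h
      have hko := hodd' k m hm hc
      have h1 : k ^ 2 ≤ Fintype.card F := by rw [hc]; exact Nat.pow_le_pow_right (by omega) hm
      have hk3 : 3 ≤ k := by omega
      have : 3 * k ≤ k ^ 2 := by nlinarith
      omega

end OmegaEight

namespace OmegaEight

variable {F : Type*} [Field F]

theorem siegel_shear {a b : Fin 8 → F} (ha : QPlus F a = 0) (hb : QPlus F b = 0)
    (hab : polar a b = 0) (c t : F) : siegel (a + c • b) (t • b) = siegel a (t • b) := by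
  have hba : polar b a = 0 := by rw [polar_comm, hab]
  have hbb : polar b b = 0 := by rw [polar_self, hb, mul_zero]
  have htb : QPlus F (t • b) = 0 := by simp [hb]
  have e : -(a + c • b) = -a + (-c) • b := by rw [neg_add, neg_smul]
  rw [siegel_swap htb (by simp [QPlus_add, ha, hb, hab]) (by simp [hba, hbb]), e,
    siegel_add htb (by simp [hba]) (by simp [hbb]),
    siegel_smul_left hb (b := (-c) • b) (by simp [hbb]), smul_smul, siegel_self hb, mul_one,
    ← siegel_swap htb ha (by simp [hba])]

theorem vec_ext {a b c d e f g h a' b' c' d' e' f' g' h' : F} (ha : a = a') (hb : b = b')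
    (hc : c = c') (hd : d = d') (he : e = e') (hf : f = f') (hg : g = g') (hh : h = h') :
    ![a, b, c, d, e, f, g, h] = ![a', b', c', d', e', f', g', h'] := by
  rw [ha, hb, hc, hd, he, hf, hg, hh]

theorem lin_famX_vec (n p r s a b c d e f g h : F) :
    lin (famX n p r s) ![a, b, c, d, e, f, g, h] =
      ![g + n * b + p * d - r * h + s * e + p * r * c, -f + n * c, e, h - r * e - p * c, c,
        -b + n * e, a + n * f + r * d - p * h + p * r * e + (p ^ 2 + r ^ 2 - n ^ 2 - s) * c,
        d + p * e + r * c] := by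
  rw [lin_famX]; rfl

theorem lin_famY_vec (a b c d e f g h : F) :
    lin (famY F) ![a, b, c, d, e, f, g, h] = ![c, a, b, d, g, e, f, h] := by
  rw [lin_famY]; rfl

theorem lin_rootElt_one_two_vec (t a b c d e f g h : F) :
    lin (rootElt 1 2 t) ![a, b, c, d, e, f, g, h] = ![a, b + t * c, c, d, e, f, g - t * f, h] := by
  rw [lin_rootElt (by decide)]
  ext i
  simp only [Pi.add_apply, Pi.sub_apply, Pi.smul_apply]
  fin_cases i <;> simp [bv_apply]

theorem lin_rootElt_one_zero_vec (t a b c d e f g h : F) :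
    lin (rootElt 1 0 t) ![a, b, c, d, e, f, g, h] = ![a, b + t * a, c, d, e - t * f, f, g, h] := by
  rw [lin_rootElt (by decide)]
  ext i
  simp only [Pi.add_apply, Pi.sub_apply, Pi.smul_apply]
  fin_cases i <;> simp [bv_apply]

set_option maxHeartbeats 2000000 in
theorem lin_words_of_four {w : F} (h2 : (2 : F) = 0) (hw : w ^ 2 = w + 1) :
    lin (rootElt 1 0 w * famX 1 w (w + 1) w * famY F * famX 1 w (w + 1) w * rootElt 1 0 w * rootElt 1 2 (w + 1)) ![w, 0, 0, 0, 0, 0, 0, 0] =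
      ![w + 1, 1, w, 1, w, 1, w, w + 1] ∧
    lin (rootElt 1 0 w * famX 1 w (w + 1) w * famY F * famX 1 w (w + 1) w * rootElt 1 0 w * rootElt 1 2 (w + 1)) ![0, 0, 0, 0, 0, 1, 0, 0] =
      ![w, w, w + 1, w + 1, 0, w + 1, 1, w + 1] ∧
    lin (famX 1 w (w + 1) w * famY F * famX 1 w (w + 1) w * rootElt 1 0 w * famX 1 w (w + 1) w * rootElt 1 0 w) ![1, 0, 0, 0, 0, 0, 0, 0] =
      ![0, w, w + 1, 0, w, 0, 0, w] ∧
    lin (famX 1 w (w + 1) w * famY F * famX 1 w (w + 1) w * rootElt 1 0 w * famX 1 w (w + 1) w * rootElt 1 0 w) ![0, 0, 0, 0, 0, 1, 0, 0] =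
      ![w, w, w + 1, w + 1, 0, w + 1, 1, w + 1] := by
  have s0 : lin (rootElt 1 2 (w + 1)) ![w, 0, 0, 0, 0, 0, 0, 0] = ![w, 0, 0, 0, 0, 0, 0, 0] := by
    rw [lin_rootElt_one_two_vec]; clear * - h2 hw; apply vec_ext <;> grind
  have s1 : lin (rootElt 1 0 w) ![w, 0, 0, 0, 0, 0, 0, 0] = ![w, w + 1, 0, 0, 0, 0, 0, 0] := by
    rw [lin_rootElt_one_zero_vec]; clear * - h2 hw; apply vec_ext <;> grind
  have s2 : lin (famX 1 w (w + 1) w) ![w, w + 1, 0, 0, 0, 0, 0, 0] = ![w + 1, 0, 0, 0, 0, w + 1, w, 0] := by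
    rw [lin_famX_vec]; clear * - h2 hw; apply vec_ext <;> grind
  have s3 : lin (famY F) ![w + 1, 0, 0, 0, 0, w + 1, w, 0] = ![0, w + 1, 0, 0, w, 0, w + 1, 0] := by
    exact lin_famY_vec _ _ _ _ _ _ _ _
  have s4 : lin (famX 1 w (w + 1) w) ![0, w + 1, 0, 0, w, 0, w + 1, 0] = ![w + 1, 0, w, 1, 0, 1, w, w + 1] := by
    rw [lin_famX_vec]; clear * - h2 hw; apply vec_ext <;> grind
  have s5 : lin (rootElt 1 0 w) ![w + 1, 0, w, 1, 0, 1, w, w + 1] = ![w + 1, 1, w, 1, w, 1, w, w + 1] := by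
    rw [lin_rootElt_one_zero_vec]; clear * - h2 hw; apply vec_ext <;> grind
  have s6 : lin (rootElt 1 2 (w + 1)) ![0, 0, 0, 0, 0, 1, 0, 0] = ![0, 0, 0, 0, 0, 1, w + 1, 0] := by
    rw [lin_rootElt_one_two_vec]; clear * - h2 hw; apply vec_ext <;> grind
  have s7 : lin (rootElt 1 0 w) ![0, 0, 0, 0, 0, 1, w + 1, 0] = ![0, 0, 0, 0, w, 1, w + 1, 0] := by
    rw [lin_rootElt_one_zero_vec]; clear * - h2 hw; apply vec_ext <;> grind
  have s8 : lin (famX 1 w (w + 1) w) ![0, 0, 0, 0, w, 1, w + 1, 0] = ![0, 1, w, 1, 0, w, w + 1, w + 1] := by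
    rw [lin_famX_vec]; clear * - h2 hw; apply vec_ext <;> grind
  have s9 : lin (famY F) ![0, 1, w, 1, 0, w, w + 1, w + 1] = ![w, 0, 1, 1, w + 1, 0, w, w + 1] := by
    exact lin_famY_vec _ _ _ _ _ _ _ _
  have s10 : lin (famX 1 w (w + 1) w) ![w, 0, 1, 1, w + 1, 0, w, w + 1] = ![w, 1, w + 1, w + 1, 1, w + 1, 1, w + 1] := by
    rw [lin_famX_vec]; clear * - h2 hw; apply vec_ext <;> grind
  have s11 : lin (rootElt 1 0 w) ![w, 1, w + 1, w + 1, 1, w + 1, 1, w + 1] = ![w, w, w + 1, w + 1, 0, w + 1, 1, w + 1] := by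
    rw [lin_rootElt_one_zero_vec]; clear * - h2 hw; apply vec_ext <;> grind
  have s12 : lin (rootElt 1 0 w) ![1, 0, 0, 0, 0, 0, 0, 0] = ![1, w, 0, 0, 0, 0, 0, 0] := by
    rw [lin_rootElt_one_zero_vec]; clear * - h2 hw; apply vec_ext <;> grind
  have s13 : lin (famX 1 w (w + 1) w) ![1, w, 0, 0, 0, 0, 0, 0] = ![w, 0, 0, 0, 0, w, 1, 0] := by
    rw [lin_famX_vec]; clear * - h2 hw; apply vec_ext <;> grind
  have s14 : lin (rootElt 1 0 w) ![w, 0, 0, 0, 0, w, 1, 0] = ![w, w + 1, 0, 0, w + 1, w, 1, 0] := by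
    rw [lin_rootElt_one_zero_vec]; clear * - h2 hw; apply vec_ext <;> grind
  have s15 : lin (famX 1 w (w + 1) w) ![w, w + 1, 0, 0, w + 1, w, 1, 0] = ![w + 1, w, w + 1, w, 0, 0, w + 1, 1] := by
    rw [lin_famX_vec]; clear * - h2 hw; apply vec_ext <;> grind
  have s16 : lin (famY F) ![w + 1, w, w + 1, w, 0, 0, w + 1, 1] = ![w + 1, w + 1, w, w, w + 1, 0, 0, 1] := by
    exact lin_famY_vec _ _ _ _ _ _ _ _
  have s17 : lin (famX 1 w (w + 1) w) ![w + 1, w + 1, w, w, w + 1, 0, 0, 1] = ![0, w, w + 1, 0, w, 0, 0, w] := by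
    rw [lin_famX_vec]; clear * - h2 hw; apply vec_ext <;> grind
  have s18 : lin (rootElt 1 0 w) ![0, 0, 0, 0, 0, 1, 0, 0] = ![0, 0, 0, 0, w, 1, 0, 0] := by
    rw [lin_rootElt_one_zero_vec]; clear * - h2 hw; apply vec_ext <;> grind
  have s19 : lin (famX 1 w (w + 1) w) ![0, 0, 0, 0, w, 1, 0, 0] = ![w + 1, 1, w, 1, 0, w, w + 1, w + 1] := by
    rw [lin_famX_vec]; clear * - h2 hw; apply vec_ext <;> grind
  have s20 : lin (rootElt 1 0 w) ![w + 1, 1, w, 1, 0, w, w + 1, w + 1] = ![w + 1, 0, w, 1, w + 1, w, w + 1, w + 1] := by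
    rw [lin_rootElt_one_zero_vec]; clear * - h2 hw; apply vec_ext <;> grind
  have s21 : lin (famX 1 w (w + 1) w) ![w + 1, 0, w, 1, w + 1, w, w + 1, w + 1] = ![0, 0, w + 1, w, w, w + 1, w + 1, 1] := by
    rw [lin_famX_vec]; clear * - h2 hw; apply vec_ext <;> grind
  have s22 : lin (famY F) ![0, 0, w + 1, w, w, w + 1, w + 1, 1] = ![w + 1, 0, 0, w, w + 1, w, w + 1, 1] := by
    exact lin_famY_vec _ _ _ _ _ _ _ _
  have s23 : lin (famX 1 w (w + 1) w) ![w + 1, 0, 0, w, w + 1, w, w + 1, 1] = ![w, w, w + 1, w + 1, 0, w + 1, 1, w + 1] := by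
    rw [lin_famX_vec]; clear * - h2 hw; apply vec_ext <;> grind
  simp only [lin_mul_apply]
  refine ⟨?_, ?_, ?_, ?_⟩
  · rw [s0, s1, s2, s3, s4, s5]
  · rw [s6, s7, s8, s9, s10, s11]
  · rw [s12, s13, s14, s15, s16, s17]
  · rw [s18, s19, s20, s21, s22, s23]

theorem siegel_mul_mem_of_four {w : F} (h2 : (2 : F) = 0) (hw : w ^ 2 = w + 1)
    {H : Subgroup (Orth F)} (hx : famX 1 w (w + 1) w ∈ H) (hy : famY F ∈ H)
    (h12 : rootElt 1 2 (w + 1) ∈ H) (h10 : rootElt 1 0 w ∈ H) {t : F}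
    (h : siegel (bv F 0) (t • bv F 5) ∈ H) : siegel (bv F 0) ((w * t) • bv F 5) ∈ H := by
  obtain ⟨a1, b1, a2, b2⟩ := lin_words_of_four h2 hw
  have e0 : bv F 0 = ![1, 0, 0, 0, 0, 0, 0, 0] := by ext i; fin_cases i <;> simp [bv_apply]
  have we0 : w • bv F 0 = ![w, 0, 0, 0, 0, 0, 0, 0] := by ext i; fin_cases i <;> simp [bv_apply]
  have e5 : bv F 5 = ![0, 0, 0, 0, 0, 1, 0, 0] := by ext i; fin_cases i <;> simp [bv_apply]
  have h05 : polar (bv F 0) (bv F 5) = 0 := by rw [polar_bv_left]; simp [bv_apply]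
  rw [← e5] at b1 b2
  rw [← e0] at a2
  rw [← we0] at a1
  obtain ⟨g₁, hg₁⟩ : ∃ g₁, g₁ = rootElt 1 0 w * famX 1 w (w + 1) w * famY F * famX 1 w (w + 1) w * rootElt 1 0 w *
    rootElt 1 2 (w + 1) := ⟨_, rfl⟩
  obtain ⟨g₂, hg₂⟩ : ∃ g₂, g₂ = famX 1 w (w + 1) w * famY F * famX 1 w (w + 1) w * rootElt 1 0 w *
    famX 1 w (w + 1) w * rootElt 1 0 w := ⟨_, rfl⟩
  rw [← hg₁] at a1 b1
  rw [← hg₂] at a2 b2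
  have m₁ : g₁ ∈ H := by
    rw [hg₁]; exact mul_mem (mul_mem (mul_mem (mul_mem (mul_mem h10 hx) hy) hx) h10) h12
  have m₂ : g₂ ∈ H := by
    rw [hg₂]; exact mul_mem (mul_mem (mul_mem (mul_mem (mul_mem hx hy) hx) h10) hx) h10
  have key : lin g₁ (w • bv F 0) = lin g₂ (bv F 0) + w • lin g₂ (bv F 5) := by
    rw [a1, a2, b2]
    clear * - h2 hw
    ext i
    simp only [Pi.add_apply, Pi.smul_apply]
    fin_cases i <;> simp <;> grind
  have q0 : QPlus F (lin g₂ (bv F 0)) = 0 := by rw [QPlus_lin, QPlus_bv]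
  have q5 : QPlus F (lin g₂ (bv F 5)) = 0 := by rw [QPlus_lin, QPlus_bv]
  have q05 : polar (lin g₂ (bv F 0)) (lin g₂ (bv F 5)) = 0 := by rw [polar_lin, h05]
  have h3 := siegel_lin_mem m₂ h
  rw [map_smul, ← siegel_shear q0 q5 q05 w t, ← key, b2, ← b1, ← map_smul] at h3
  have h4 := siegel_lin_mem (inv_mem m₁) h3
  rw [lin_inv_apply, lin_inv_apply, siegel_smul_left (QPlus_bv _) (by simp [h05]), smul_smul] at h4
  exact h4

theorem generated_four [Fintype F] (hq : Fintype.card F = 4) : Generated F := by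
  have h2 : (2 : F) = 0 := by
    have := Nat.cast_card_eq_zero F
    rw [hq] at this
    have h4 : (2 : F) * 2 = 0 := by
      have h5 : (4 : F) = 0 := by exact_mod_cast this
      linear_combination h5
    exact mul_self_eq_zero.1 h4
  obtain ⟨w, hw0, hwo⟩ := exists_primitive (F := F)
  have hw1 : w ≠ 1 := by
    rintro rfl
    rw [orderOf_one, hq] at hwo; norm_num at hwo
  have hw3 : w ^ 3 = 1 := by
    have := pow_orderOf_eq_one w
    rwa [hwo, hq] at this
  have hw : w ^ 2 = w + 1 := by
    have h : (w - 1) * (w ^ 2 - (w + 1)) = 0 := by linear_combination hw3 - (w ^ 2 - 1) * h2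
    linear_combination (mul_eq_zero.1 h).resolve_left (sub_ne_zero.2 hw1)
  have h4 : (4 : F) = 0 := by linear_combination 2 * h2
  have hw1' : w + 1 ≠ 0 := by rw [← hw]; exact pow_ne_zero _ hw0
  have hD : famDelta 1 w (w + 1) = 1 := by rw [famDelta]; grind
  have hN : famNum 1 w (w + 1) w = w + 1 := by rw [famNum]; grind
  refine generated_of_hasRoots (n := 1) (p := w) (r := w + 1) (s := w) (g := w) ?_ ?_ ?_ hw0 hw1 ?_
  · intro h; apply one_ne_zero (α := F); grind
  · intro h; apply hw0; grind
  · intro h; apply hw1'; grind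
  have hx : famX 1 w (w + 1) w ∈ Subgroup.closure {famX 1 w (w + 1) w, famY F} :=
    Subgroup.subset_closure (Set.mem_insert _ _)
  have hy : famY F ∈ Subgroup.closure {famX 1 w (w + 1) w, famY F} :=
    Subgroup.subset_closure (Set.mem_insert_of_mem _ rfl)
  generalize Subgroup.closure {famX 1 w (w + 1) w, famY F} = H at hx hy
  have r01 : rootElt 0 1 (w + 1) ∈ H := by
    have := famXY_pow 1 w (w + 1) w (by rw [hD]; exact one_ne_zero)
      (by rw [h4, one_pow]; exact one_ne_zero) (by rw [h4]; exact pow_ne_zero _ hw0)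
      (by rw [h4]; exact pow_ne_zero _ hw1')
    rw [hD, hN, div_one] at this
    rw [← this]; exact pow_mem (mul_mem hx hy) _
  have r12 : rootElt 1 2 (w + 1) ∈ H := rootElt_famY hy r01 rfl rfl
  have r02 : rootElt 0 2 w ∈ H := by
    have := rootElt_mul_mem (by decide) (by decide) (by decide) (by decide) (by decide)
      (by decide) r01 r12
    rwa [show (w + 1) * (w + 1) = w by grind] at this
  have r10 : rootElt 1 0 w ∈ H := rootElt_famY hy r02 rfl rfl
  have step : ∀ t : F, rootElt 0 1 t ∈ H → rootElt 0 1 (w * t) ∈ H := by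
    intro t ht
    rw [rootElt] at ht ⊢
    rw [← mul_neg]
    exact siegel_mul_mem_of_four h2 hw hx hy r12 r10 ht
  refine hasRoots_of_zero_one hy fun t => ?_
  have u1 : rootElt 0 1 (1 : F) ∈ H := by
    have := step _ r01
    rwa [show w * (w + 1) = 1 by grind] at this
  have uw : rootElt 0 1 w ∈ H := by simpa using step _ u1
  have ht : t = 0 ∨ t = 1 ∨ t = w ∨ t = w + 1 := by
    have := FiniteField.pow_card t
    rw [hq] at this
    have h0 : t * ((t - 1) * ((t - w) * (t - (w + 1)))) = 0 := by grind
    simpa [sub_eq_zero] using h0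
  rcases ht with rfl | rfl | rfl | rfl
  · rw [rootElt_zero]; exact one_mem H
  · exact u1
  · exact uw
  · exact r01

end OmegaEight

namespace OmegaEight

variable {F : Type*} [Field F]

/-- The order-two generator over the field with five elements. -/
noncomputable def fiveX (F : Type*) [Field F] : Orth F :=
  siegel (bv F 7) ((1 : F) • bv F 0) * siegel (bv F 4) ((-1 : F) • bv F 6) *
    siegel (bv F 4) ((2 : F) • bv F 7) * famN F * siegel (bv F 4) ((-2 : F) • bv F 7) *
    siegel (bv F 4) ((1 : F) • bv F 6) * siegel (bv F 7) ((-1 : F) • bv F 0)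

theorem lin_fiveX (v : Fin 8 → F) : lin (fiveX F) v =
    ![-v 0 + v 3 + v 4 + v 6 + v 7, -v 5, -v 2 + 2 * v 3 + v 4, -2 * v 0 + 2 * v 3 + v 4 + v 7, 4 * v 0 - 2 * v 3 - v 4 - 2 * v 7, -v 1, -v 6, -2 * v 0 + v 3 + v 4 + 2 * v 6 + 2 * v 7] := by
  have s1 : ∀ (t : F) (z : Fin 8 → F), lin (siegel (bv F 7) (t • bv F 0)) z =
      ![z 0 + t * z 3, z 1, z 2, z 3, z 4, z 5, z 6, z 7 - t * z 4] := by
    intro t z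
    rw [lin_siegel_bv _ _ (by decide)]
    ext i
    simp only [Pi.add_apply, Pi.sub_apply, Pi.smul_apply]
    fin_cases i <;> simp [bv_apply]
  have s2 : ∀ (t : F) (z : Fin 8 → F), lin (siegel (bv F 4) (t • bv F 6)) z =
      ![z 0, z 1, z 2, z 3, z 4 - t * z 2, z 5, z 6 + t * z 0, z 7] := by
    intro t z
    rw [lin_siegel_bv _ _ (by decide)]
    ext i
    simp only [Pi.add_apply, Pi.sub_apply, Pi.smul_apply]
    fin_cases i <;> simp [bv_apply]
  have s3 : ∀ (t : F) (z : Fin 8 → F), lin (siegel (bv F 4) (t • bv F 7)) z =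
      ![z 0, z 1, z 2, z 3, z 4 - t * z 3, z 5, z 6, z 7 + t * z 0] := by
    intro t z
    rw [lin_siegel_bv _ _ (by decide)]
    ext i
    simp only [Pi.add_apply, Pi.sub_apply, Pi.smul_apply]
    fin_cases i <;> simp [bv_apply]
  simp only [fiveX, lin_mul_apply, s1, s2, s3, lin_famN]
  ext i; fin_cases i <;> simp <;> ring

theorem famN_mem : famN F ∈ siegelGroup F := by
  have h : famN F = famX 0 0 0 0 := by
    apply lin_ext
    intro v
    rw [lin_famN, lin_famX]
    ext i; fin_cases i <;> simp
  rw [h]; exact famX_mem 0 0 0 0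

theorem fiveX_mem : fiveX F ∈ siegelGroup F := by
  refine mul_mem (mul_mem (mul_mem (mul_mem (mul_mem (mul_mem ?_ ?_) ?_) famN_mem) ?_) ?_) ?_ <;>
    exact siegel_mem _ _

theorem fiveX_mul_self : fiveX F * fiveX F = 1 := by
  apply lin_ext
  intro v
  rw [lin_mul_apply, lin_fiveX, lin_fiveX, lin_one_apply]
  ext i; fin_cases i <;> simp <;> ring

/-- The order-three generator over the field with five elements, as a linear map. -/
def fiveYLin (F : Type*) [Field F] : Module.End F (Fin 8 → F) where
  toFun v := ![-v 1, v 0 - v 1, v 6 - v 7, v 7, -v 4 - v 5, v 4, v 2 + v 7, v 2 + v 3 - v 6 + v 7]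
  map_add' u v := by ext i; fin_cases i <;> simp <;> ring
  map_smul' c v := by ext i; fin_cases i <;> simp <;> ring

/-- The order-three generator over the field with five elements. -/
noncomputable def fiveY (F : Type*) [Field F] : Orth F :=
  ofIso (fiveYLin F) (by intro v; simp [fiveYLin, QPlus]; ring)

theorem lin_fiveY (v : Fin 8 → F) : lin (fiveY F) v =
    ![-v 1, v 0 - v 1, v 6 - v 7, v 7, -v 4 - v 5, v 4, v 2 + v 7, v 2 + v 3 - v 6 + v 7] := by
  rw [fiveY, lin_ofIso]; rfl

theorem fiveY_pow : fiveY F ^ 3 = 1 := by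
  apply lin_ext
  intro v
  rw [pow_succ, pow_two, lin_mul_apply, lin_mul_apply, lin_fiveY, lin_fiveY, lin_fiveY,
    lin_one_apply]
  ext i; fin_cases i <;> simp <;> ring

/-- The monomial involution inverting the order-three generator, as a linear map. -/
def fiveInvLin (F : Type*) [Field F] : Module.End F (Fin 8 → F) where
  toFun v := ![v 1, v 0, v 6, -v 7, v 5, v 4, v 2, -v 3]
  map_add' u v := by ext i; fin_cases i <;> simp <;> ring
  map_smul' c v := by ext i; fin_cases i <;> simp <;> ring

/-- The monomial involution inverting the order-three generator. -/
noncomputable def fiveInv (F : Type*) [Field F] : Orth F :=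
  ofIso (fiveInvLin F) (by intro v; simp [fiveInvLin, QPlus]; ring)

theorem lin_fiveInv (v : Fin 8 → F) :
    lin (fiveInv F) v = ![v 1, v 0, v 6, -v 7, v 5, v 4, v 2, -v 3] := by
  rw [fiveInv, lin_ofIso]; rfl

theorem fiveY_mem : fiveY F ∈ siegelGroup F := by
  rw [← commutator_eq_siegelGroup]
  refine mem_of_inverted fiveY_pow (i := fiveInv F) ?_
  rw [eq_inv_mul_iff_mul_eq]
  apply lin_ext
  intro v
  simp only [lin_mul_apply, lin_fiveInv, lin_fiveY]
  ext i; fin_cases i <;> simp <;> ring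

/-- Eight residues modulo five. -/
abbrev Code := ℕ × ℕ × ℕ × ℕ × ℕ × ℕ × ℕ × ℕ

instance : DecidableEq Code :=
  @instDecidableEqProd _ _ _ (@instDecidableEqProd _ _ _ (@instDecidableEqProd _ _ _
    (@instDecidableEqProd _ _ _ (@instDecidableEqProd _ _ _ (@instDecidableEqProd _ _ _
      (@instDecidableEqProd _ _ _ _))))))

/-- The vector with the given residues as coordinates. -/
def vecOf (F : Type*) [Field F] : Code → Fin 8 → F
  | (a, b, c, d, e, f, g, h) => ![(a : F), b, c, d, e, f, g, h]

/-- The action of the order-two generator on residues. -/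
def codeX : Code → Code
  | (a, b, c, d, e, f, g, h) =>
    ((4 * a + d + e + g + h) % 5, (4 * f) % 5, (4 * c + 2 * d + e) % 5, (3 * a + 2 * d + e + h) % 5, (4 * a + 3 * d + 4 * e + 3 * h) % 5, (4 * b) % 5, (4 * g) % 5, (3 * a + d + e + 2 * g + 2 * h) % 5)

/-- The action of the order-three generator on residues. -/
def codeY : Code → Code
  | (a, b, c, d, e, f, g, h) =>
    ((4 * b) % 5, (a + 4 * b) % 5, (g + 4 * h) % 5, (h) % 5, (4 * e + 4 * f) % 5, (e) % 5, (c + h) % 5, (c + d + 4 * g + h) % 5)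

/-- The action of the root element on residues. -/
def codeT : Code → Code
  | (a, b, c, d, e, f, g, h) =>
    ((3 * a + 2 * c + 4 * d + 4 * f + 3 * g + h) % 5, (3 * a + 2 * b + c + 2 * d + e + 3 * g + 2 * h) % 5, (2 * a + 2 * b + 4 * c + d + 2 * e + 2 * f + 2 * h) % 5, (a + 4 * b + 3 * c + 2 * d + 4 * e + 3 * f + 3 * g) % 5, (3 * b + 4 * c + 3 * d + 4 * e + 2 * f + 3 * g + 4 * h) % 5, (2 * a + 2 * c + 4 * d + 3 * g + h) % 5, (a + 3 * b + 3 * e + 4 * f + 3 * g + 2 * h) % 5, (2 * a + b + e + 3 * f + 4 * g) % 5)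

/-- The action of a word, read from left to right, on residues. -/
def codeWord : List ℕ → Code → Code
  | [], l => l
  | k :: w, l => codeWord w (if k = 0 then codeX l else codeY l)

/-- The group element of a word, read from left to right. -/
noncomputable def fiveWord (F : Type*) [Field F] : List ℕ → Orth F
  | [] => 1
  | k :: w => fiveWord F w * (if k = 0 then fiveX F else fiveY F)

theorem fiveWord_mem (w : List ℕ) :
    fiveWord F w ∈ Subgroup.closure {fiveX F, fiveY F} := by
  induction w with
  | nil => exact one_mem _
  | cons k w ih =>
    refine mul_mem ih ?_
    split_ifs
    · exact Subgroup.subset_closure (Set.mem_insert _ _)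
    · exact Subgroup.subset_closure (Set.mem_insert_of_mem _ rfl)

theorem natCast_mod_five (h5 : (5 : F) = 0) (n : ℕ) : ((n % 5 : ℕ) : F) = n := by
  conv_rhs => rw [← Nat.mod_add_div n 5]
  push_cast
  rw [h5]; ring

theorem lin_fiveX_code (h5 : (5 : F) = 0) (l : Code) : lin (fiveX F) (vecOf F l) = vecOf F (codeX l) := by
  obtain ⟨a, b, c, d, e, f, g, h⟩ := l
  rw [lin_fiveX]
  simp only [codeX, vecOf, natCast_mod_five h5]
  apply vec_ext <;> simp <;> grind

theorem lin_fiveY_code (h5 : (5 : F) = 0) (l : Code) : lin (fiveY F) (vecOf F l) = vecOf F (codeY l) := by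
  obtain ⟨a, b, c, d, e, f, g, h⟩ := l
  rw [lin_fiveY]
  simp only [codeY, vecOf, natCast_mod_five h5]
  apply vec_ext <;> simp <;> grind

theorem lin_fiveWord (h5 : (5 : F) = 0) (w : List ℕ) (l : Code) :
    lin (fiveWord F w) (vecOf F l) = vecOf F (codeWord w l) := by
  induction w generalizing l with
  | nil => exact lin_one_apply _
  | cons k w ih =>
    rw [fiveWord, lin_mul_apply, codeWord]
    split_ifs
    · rw [lin_fiveX_code h5, ih]
    · rw [lin_fiveY_code h5, ih]

theorem lin_siegel_code (h5 : (5 : F) = 0) (l : Code) :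
    lin (siegel (vecOf F (2, 3, 2, 1, 0, 2, 1, 2)) (vecOf F (0, 3, 1, 2, 4, 0, 4, 3)))
      (vecOf F l) = vecOf F (codeT l) := by
  obtain ⟨a, b, c, d, e, f, g, h⟩ := l
  rw [siegel_apply (by simp [QPlus, vecOf]; grind) (by simp [polar, QPlus, vecOf]; grind)]
  simp only [codeT, vecOf, natCast_mod_five h5]
  ext i
  simp only [Pi.add_apply, Pi.sub_apply, Pi.smul_apply]
  fin_cases i <;> simp [polar, QPlus] <;> grind

theorem siegel_mem_closure_five (h5 : (5 : F) = 0) :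
    siegel (vecOf F (2, 3, 2, 1, 0, 2, 1, 2)) (vecOf F (0, 3, 1, 2, 4, 0, 4, 3)) ∈
      Subgroup.closure {fiveX F, fiveY F} := by
  have h : siegel (vecOf F (2, 3, 2, 1, 0, 2, 1, 2)) (vecOf F (0, 3, 1, 2, 4, 0, 4, 3)) =
      fiveWord F [1, 0, 1, 0, 1, 0, 1, 0, 1, 0, 1, 0, 1, 0, 1, 0, 1, 0, 1, 0, 1, 0, 1, 0] := by
    apply lin_ext_bv
    intro i
    have hi : ∃ l : Code, bv F i = vecOf F l ∧ codeT l =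
        codeWord [1, 0, 1, 0, 1, 0, 1, 0, 1, 0, 1, 0, 1, 0, 1, 0, 1, 0, 1, 0, 1, 0, 1, 0] l := by
      fin_cases i
      · exact ⟨(1, 0, 0, 0, 0, 0, 0, 0), by ext j; fin_cases j <;> simp [bv_apply, vecOf],
          by decide +kernel⟩
      · exact ⟨(0, 1, 0, 0, 0, 0, 0, 0), by ext j; fin_cases j <;> simp [bv_apply, vecOf],
          by decide +kernel⟩
      · exact ⟨(0, 0, 1, 0, 0, 0, 0, 0), by ext j; fin_cases j <;> simp [bv_apply, vecOf],
          by decide +kernel⟩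
      · exact ⟨(0, 0, 0, 1, 0, 0, 0, 0), by ext j; fin_cases j <;> simp [bv_apply, vecOf],
          by decide +kernel⟩
      · exact ⟨(0, 0, 0, 0, 1, 0, 0, 0), by ext j; fin_cases j <;> simp [bv_apply, vecOf],
          by decide +kernel⟩
      · exact ⟨(0, 0, 0, 0, 0, 1, 0, 0), by ext j; fin_cases j <;> simp [bv_apply, vecOf],
          by decide +kernel⟩
      · exact ⟨(0, 0, 0, 0, 0, 0, 1, 0), by ext j; fin_cases j <;> simp [bv_apply, vecOf],
          by decide +kernel⟩
      · exact ⟨(0, 0, 0, 0, 0, 0, 0, 1), by ext j; fin_cases j <;> simp [bv_apply, vecOf],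
          by decide +kernel⟩
    obtain ⟨l, hl, hc⟩ := hi
    rw [hl, lin_siegel_code h5, lin_fiveWord h5, hc]
  rw [h]; exact fiveWord_mem _

theorem radical_mem_five (h5 : (5 : F) = 0) {w : List ℕ} {c : ℕ} {l : Code}
    (ha : codeWord w (2, 3, 2, 1, 0, 2, 1, 2) = (c, 0, 0, 0, 0, 0, 0, 0))
    (hb : codeWord w (0, 3, 1, 2, 4, 0, 4, 3) = l) (hl : l.2.2.2.2.1 = 0) :
    (c : F) • vecOf F l ∈ radical (Subgroup.closure {fiveX F, fiveY F}) (bv F 0) (QPlus_bv 0) := by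
  have h := siegel_lin_mem (fiveWord_mem w) (siegel_mem_closure_five h5)
  rw [lin_fiveWord h5, lin_fiveWord h5, ha, hb] at h
  have e : vecOf F (c, 0, 0, 0, 0, 0, 0, 0) = (c : F) • bv F 0 := by
    ext i; fin_cases i <;> simp [bv_apply, vecOf]
  have hp : polar (bv F 0) (vecOf F l) = 0 := by
    rw [polar_bv_left]
    obtain ⟨a, b, c, d, e, f, g, h⟩ := l
    simp only at hl
    simp [vecOf, hl]
  rw [e, siegel_smul_left (QPlus_bv 0) hp] at h
  exact ⟨by rw [polar_smul_right, hp, mul_zero], h⟩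

theorem bv_mem_radical_five (h5 : (5 : F) = 0) {i : Fin 8} (hi : i ≠ 4) :
    bv F i ∈ radical (Subgroup.closure {fiveX F, fiveY F}) (bv F 0) (QPlus_bv 0) := by
  have m0 := radical_mem_five h5 (w := [0, 1, 0, 1, 0, 1, 0, 1, 0, 1, 0, 1, 1, 0, 1, 0, 1, 1, 0, 1, 1, 0, 1, 1, 0, 1, 0, 1, 0, 1])
    (c := 1) (l := (2, 1, 0, 3, 0, 2, 4, 1)) (by decide +kernel) (by decide +kernel) rfl
  have m1 := radical_mem_five h5 (w := [0, 1, 0, 1, 1, 0, 1, 0, 1, 0, 1, 1, 0, 1, 1, 0, 1, 0, 1, 0, 1, 0, 1, 0, 1, 0, 1, 1, 0, 1, 0])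
    (c := 2) (l := (0, 4, 0, 0, 0, 0, 0, 3)) (by decide +kernel) (by decide +kernel) rfl
  have m2 := radical_mem_five h5 (w := [0, 1, 0, 1, 1, 0, 1, 1, 0, 1, 0, 1, 1, 0, 1, 0, 1, 1, 0, 1, 1, 0, 1, 1, 0, 1, 0, 1, 1, 0, 1, 0, 1, 1])
    (c := 3) (l := (1, 0, 4, 3, 0, 3, 3, 1)) (by decide +kernel) (by decide +kernel) rfl
  have m3 := radical_mem_five h5 (w := [0, 1, 0, 1, 1, 0, 1, 1, 0, 1, 1, 0, 1, 0, 1, 0, 1, 0, 1, 1, 0, 1, 0, 1, 1, 0, 1, 1, 0, 1, 0, 1, 0, 1])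
    (c := 2) (l := (3, 3, 0, 2, 0, 1, 2, 1)) (by decide +kernel) (by decide +kernel) rfl
  have m4 := radical_mem_five h5 (w := [0, 1, 1, 0, 1, 0, 1, 0, 1, 1, 0, 1, 1, 0, 1, 0, 1, 0, 1, 0, 1, 1, 0, 1, 0, 1, 0, 1, 0, 1, 1, 0, 1, 0])
    (c := 3) (l := (4, 4, 3, 4, 0, 2, 2, 4)) (by decide +kernel) (by decide +kernel) rfl
  have m5 := radical_mem_five h5 (w := [1, 1, 0, 1, 0, 1, 0, 1, 1, 0, 1, 1, 0, 1, 1, 0, 1, 1, 0, 1, 1, 0, 1, 1, 0, 1, 1, 0, 1, 0, 1, 1, 0, 1, 0, 1, 1])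
    (c := 2) (l := (1, 2, 0, 3, 0, 2, 0, 2)) (by decide +kernel) (by decide +kernel) rfl
  generalize hR : radical (Subgroup.closure {fiveX F, fiveY F}) (bv F 0) (QPlus_bv 0) = R at *
  have hz : ∀ t : F, t • bv F 0 ∈ R := by
    intro t
    rw [← hR]
    refine ⟨by simp [polar_bv_left, bv_apply], ?_⟩
    rw [siegel_self (QPlus_bv _)]; exact one_mem _
  fin_cases i
  · simpa using hz 1
  · have := (add_mem (nsmul_mem m0 0) (add_mem (nsmul_mem m1 1) (add_mem (nsmul_mem m2 4) (add_mem (nsmul_mem m3 4) (add_mem (nsmul_mem m4 3) (add_mem (nsmul_mem m5 2) (hz (4))))))))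
    convert this using 1
    ext j
    simp only [Pi.add_apply, Pi.smul_apply, nsmul_eq_mul, smul_eq_mul]
    clear * - h5
    fin_cases j <;> simp [bv_apply, vecOf] <;> grind
  · have := (add_mem (nsmul_mem m0 1) (add_mem (nsmul_mem m1 1) (add_mem (nsmul_mem m2 1) (add_mem (nsmul_mem m3 4) (add_mem (nsmul_mem m4 1) (add_mem (nsmul_mem m5 0) (hz (4))))))))
    convert this using 1
    ext j
    simp only [Pi.add_apply, Pi.smul_apply, nsmul_eq_mul, smul_eq_mul]
    clear * - h5
    fin_cases j <;> simp [bv_apply, vecOf] <;> grind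
  · have := (add_mem (nsmul_mem m0 4) (add_mem (nsmul_mem m1 2) (add_mem (nsmul_mem m2 2) (add_mem (nsmul_mem m3 3) (add_mem (nsmul_mem m4 4) (add_mem (nsmul_mem m5 1) (hz (3))))))))
    convert this using 1
    ext j
    simp only [Pi.add_apply, Pi.smul_apply, nsmul_eq_mul, smul_eq_mul]
    clear * - h5
    fin_cases j <;> simp [bv_apply, vecOf] <;> grind
  · exact absurd rfl hi
  · have := (add_mem (nsmul_mem m0 4) (add_mem (nsmul_mem m1 3) (add_mem (nsmul_mem m2 0) (add_mem (nsmul_mem m3 1) (add_mem (nsmul_mem m4 0) (add_mem (nsmul_mem m5 4) (hz (3))))))))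
    convert this using 1
    ext j
    simp only [Pi.add_apply, Pi.smul_apply, nsmul_eq_mul, smul_eq_mul]
    clear * - h5
    fin_cases j <;> simp [bv_apply, vecOf] <;> grind
  · have := (add_mem (nsmul_mem m0 4) (add_mem (nsmul_mem m1 1) (add_mem (nsmul_mem m2 3) (add_mem (nsmul_mem m3 3) (add_mem (nsmul_mem m4 1) (add_mem (nsmul_mem m5 2) (hz (4))))))))
    convert this using 1
    ext j
    simp only [Pi.add_apply, Pi.smul_apply, nsmul_eq_mul, smul_eq_mul]
    clear * - h5
    fin_cases j <;> simp [bv_apply, vecOf] <;> grind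
  · have := (add_mem (nsmul_mem m0 0) (add_mem (nsmul_mem m1 3) (add_mem (nsmul_mem m2 3) (add_mem (nsmul_mem m3 3) (add_mem (nsmul_mem m4 1) (add_mem (nsmul_mem m5 4) (hz (3))))))))
    convert this using 1
    ext j
    simp only [Pi.add_apply, Pi.smul_apply, nsmul_eq_mul, smul_eq_mul]
    clear * - h5
    fin_cases j <;> simp [bv_apply, vecOf] <;> grind

theorem generated_five [Fintype F] (hq : Fintype.card F = 5) : Generated F := by
  have h5 : (5 : F) = 0 := by
    have := Nat.cast_card_eq_zero F
    rw [hq] at this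
    exact_mod_cast this
  have hsurj : ∀ t : F, ∃ n : ℕ, (n : F) = t := by
    haveI : Fact (Nat.Prime 5) := ⟨by norm_num⟩
    haveI : CharP F 5 := charP_of_card_eq_prime hq
    have hb : Function.Bijective (ZMod.castHom (dvd_refl 5) F) := by
      rw [Fintype.bijective_iff_injective_and_card]
      exact ⟨RingHom.injective _, by rw [ZMod.card, hq]⟩
    intro t
    obtain ⟨s, rfl⟩ := hb.2 t
    exact ⟨s.val, by rw [ZMod.castHom_apply, ZMod.natCast_val]⟩
  refine ⟨fiveX F, fiveY F, fiveX_mem, fiveY_mem, fiveX_mul_self, fiveY_pow, ?_, ?_⟩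
  · intro h
    have := congrArg (fun g => lin g (bv F 0) 1) h
    simp only [lin_mul_apply, lin_fiveX, lin_fiveY] at this
    simp [bv_apply] at this
  · refine siegelGroup_le_of ?_ (fiveWord_mem [1, 0, 1]) ?_
    · intro b hb
      have hs : ∀ i : Fin 8, i ≠ 4 → ∀ t : F, t • bv F i ∈
          radical (Subgroup.closure {fiveX F, fiveY F}) (bv F 0) (QPlus_bv 0) := by
        intro i hi t
        obtain ⟨n, rfl⟩ := hsurj t
        rw [Nat.cast_smul_eq_nsmul]
        exact nsmul_mem (bv_mem_radical_five h5 hi) n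
      have h4 : b 4 = 0 := by rwa [polar_bv_left] at hb
      have := add_mem (add_mem (add_mem (add_mem (add_mem (add_mem (hs 0 (by decide) (b 0))
        (hs 1 (by decide) (b 1))) (hs 2 (by decide) (b 2))) (hs 3 (by decide) (b 3)))
        (hs 5 (by decide) (b 5))) (hs 6 (by decide) (b 6))) (hs 7 (by decide) (b 7))
      have e := eq_sum_bv b
      rw [h4, zero_smul, add_zero] at e
      rw [← e] at this
      exact this.2
    · have e0 : bv F 0 = vecOf F (1, 0, 0, 0, 0, 0, 0, 0) := by
        ext i; fin_cases i <;> simp [bv_apply, vecOf]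
      rw [e0, lin_fiveWord h5, show codeWord [1, 0, 1] (1, 0, 0, 0, 0, 0, 0, 0) =
        (0, 0, 0, 0, 1, 0, 0, 0) by decide +kernel]
      ext i; fin_cases i <;> simp [bv_apply, vecOf]

end OmegaEight

namespace OmegaEight

variable {F : Type*} [Field F]

/-- The symmetric composition product for the form `QPlus` (split para-octonions). -/
def star (a b : Fin 8 → F) : Fin 8 → F :=
  ![-a 7 * b 0 - b 3 * a 0 - (a 5 * b 6 - a 6 * b 5),
    -a 7 * b 1 - b 3 * a 1 - (a 6 * b 4 - a 4 * b 6),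
    -a 7 * b 2 - b 3 * a 2 - (a 4 * b 5 - a 5 * b 4),
    a 7 * b 7 - a 0 * b 4 - a 1 * b 5 - a 2 * b 6,
    -b 7 * a 4 - a 3 * b 4 - (a 1 * b 2 - a 2 * b 1),
    -b 7 * a 5 - a 3 * b 5 - (a 2 * b 0 - a 0 * b 2),
    -b 7 * a 6 - a 3 * b 6 - (a 0 * b 1 - a 1 * b 0),
    a 3 * b 3 - a 4 * b 0 - a 5 * b 1 - a 6 * b 2]

theorem eq_vec (v : Fin 8 → F) : v = ![v 0, v 1, v 2, v 3, v 4, v 5, v 6, v 7] := by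
  ext i; fin_cases i <;> rfl

theorem add_eq_vec (u v : Fin 8 → F) : u + v = ![u 0 + v 0, u 1 + v 1, u 2 + v 2, u 3 + v 3,
    u 4 + v 4, u 5 + v 5, u 6 + v 6, u 7 + v 7] := eq_vec _

theorem smul_eq_vec (c : F) (v : Fin 8 → F) : c • v = ![c * v 0, c * v 1, c * v 2, c * v 3,
    c * v 4, c * v 5, c * v 6, c * v 7] := eq_vec _

@[simp] theorem star_add_left (a b c : Fin 8 → F) : star (a + b) c = star a c + star b c := by
  rw [add_eq_vec (star a c)]
  apply vec_ext <;> simp [star] <;> ring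

@[simp] theorem star_add_right (a b c : Fin 8 → F) : star a (b + c) = star a b + star a c := by
  rw [add_eq_vec (star a b)]
  apply vec_ext <;> simp [star] <;> ring

@[simp] theorem star_smul_left (c : F) (a b : Fin 8 → F) : star (c • a) b = c • star a b := by
  rw [smul_eq_vec c (star a b)]
  apply vec_ext <;> simp [star] <;> ring

@[simp] theorem star_smul_right (c : F) (a b : Fin 8 → F) : star a (c • b) = c • star a b := by
  rw [smul_eq_vec c (star a b)]
  apply vec_ext <;> simp [star] <;> ring

@[simp] theorem star_neg_left (a b : Fin 8 → F) : star (-a) b = -star a b := by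
  rw [← neg_one_smul F a, star_smul_left, neg_one_smul]

@[simp] theorem star_neg_right (a b : Fin 8 → F) : star a (-b) = -star a b := by
  rw [← neg_one_smul F b, star_smul_right, neg_one_smul]

@[simp] theorem star_sub_left (a b c : Fin 8 → F) : star (a - b) c = star a c - star b c := by
  rw [sub_eq_add_neg, star_add_left, star_neg_left, sub_eq_add_neg]

@[simp] theorem star_sub_right (a b c : Fin 8 → F) : star a (b - c) = star a b - star a c := by
  rw [sub_eq_add_neg, star_add_right, star_neg_right, sub_eq_add_neg]

@[simp] theorem star_zero_left (a : Fin 8 → F) : star 0 a = 0 := by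
  simpa using star_smul_left 0 0 a

@[simp] theorem star_zero_right (a : Fin 8 → F) : star a 0 = 0 := by
  simpa using star_smul_right 0 a 0

theorem star_star_self (a b : Fin 8 → F) : star (star a b) a = QPlus F a • b := by
  rw [smul_eq_vec]
  apply vec_ext <;> simp [star, QPlus] <;> ring

theorem star_self_star (a b : Fin 8 → F) : star a (star b a) = QPlus F a • b := by
  rw [smul_eq_vec]
  apply vec_ext <;> simp [star, QPlus] <;> ring

theorem QPlus_star (a b : Fin 8 → F) : QPlus F (star a b) = QPlus F a * QPlus F b := by
  simp [star, QPlus]; ring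

theorem polar_star (a b c : Fin 8 → F) : polar (star a b) c = polar a (star b c) := by
  simp [star, polar]; ring

theorem polar_star' (a b c : Fin 8 → F) : polar (star a b) c = polar b (star c a) := by
  rw [polar_comm, ← polar_star, polar_comm]

theorem star_star_add (a b c : Fin 8 → F) :
    star (star a b) c + star (star c b) a = polar a c • b := by
  have h := star_star_self (a + c) b
  have ha := star_star_self a b
  have hc := star_star_self c b
  simp only [star_add_left, star_add_right, QPlus_add, add_smul, ha, hc] at h
  linear_combination (exp := 1) h

theorem star_star_add' (a b c : Fin 8 → F) :
    star a (star b c) + star c (star b a) = polar a c • b := by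
  have h := star_self_star (a + c) b
  have ha := star_self_star a b
  have hc := star_self_star c b
  simp only [star_add_left, star_add_right, QPlus_add, add_smul, ha, hc] at h
  linear_combination (exp := 1) h

/-- Triples of isometries compatible with the composition product. -/
def IsTrial (g₁ g₂ g₃ : Orth F) : Prop :=
  ∀ a b, lin g₁ (star a b) = star (lin g₂ a) (lin g₃ b)

namespace IsTrial

variable {g₁ g₂ g₃ h₁ h₂ h₃ : Orth F}

theorem rotate (h : IsTrial g₁ g₂ g₃) : IsTrial g₂ g₃ g₁ := by
  intro b c
  rw [← sub_eq_zero]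
  apply eq_zero_of_polar
  intro a
  have e : a = lin g₂ (lin g₂⁻¹ a) := (lin_apply_inv _ _).symm
  rw [e]
  generalize lin g₂⁻¹ a = d
  rw [polar_sub_left, polar_lin, polar_star, polar_star', ← h, polar_comm, polar_lin, sub_eq_zero,
    polar_star', polar_comm, polar_star']

protected theorem one : IsTrial (1 : Orth F) 1 1 := fun a b => by simp [lin_one_apply]

theorem mul (h : IsTrial g₁ g₂ g₃) (h' : IsTrial h₁ h₂ h₃) :
    IsTrial (g₁ * h₁) (g₂ * h₂) (g₃ * h₃) := fun a b => by
  simp only [lin_mul_apply, h' a b, h _ _]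

theorem inv (h : IsTrial g₁ g₂ g₃) : IsTrial g₁⁻¹ g₂⁻¹ g₃⁻¹ := fun a b => by
  rw [← lin_apply_inj g₁, h, lin_apply_inv, lin_apply_inv, lin_apply_inv]

end IsTrial

/-- The linear map `z ↦ z - (b ∗ z) ∗ a`. -/
def halfSiegelLin (a b : Fin 8 → F) : Module.End F (Fin 8 → F) where
  toFun z := z - star (star b z) a
  map_add' u v := by simp only [star_add_left, star_add_right]; abel
  map_smul' c v := by
    simp only [star_smul_left, star_smul_right, RingHom.id_apply, smul_sub]

/-- The linear map `z ↦ z - a ∗ (z ∗ b)`. -/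
def halfSiegelLin' (a b : Fin 8 → F) : Module.End F (Fin 8 → F) where
  toFun z := z - star a (star z b)
  map_add' u v := by simp only [star_add_left, star_add_right]; abel
  map_smul' c v := by
    simp only [star_smul_left, star_smul_right, RingHom.id_apply, smul_sub]

theorem exists_isTrial_siegel {a b : Fin 8 → F} (ha : QPlus F a = 0) (hab : polar a b = 0) :
    ∃ g₁ g₂ : Orth F, IsTrial g₁ g₂ (siegel a b) := by
  have h1 : ∀ v, QPlus F (halfSiegelLin a b v) = QPlus F v := by
    intro v
    have e : polar v (star (star b v) a) = 0 := by
      rw [polar_comm, polar_star', star_self_star, polar_smul_right, hab, mul_zero]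
    simp [halfSiegelLin, QPlus_star, ha, e]
  have h2 : ∀ v, QPlus F (halfSiegelLin' a b v) = QPlus F v := by
    intro v
    have e : polar v (star a (star v b)) = 0 := by
      rw [← polar_star, polar_star', star_star_self, polar_smul_right, hab, mul_zero]
    simp [halfSiegelLin', QPlus_star, ha, e]
  refine ⟨ofIso _ h1, ofIso _ h2, fun u v => ?_⟩
  rw [lin_ofIso, lin_ofIso, siegel_apply ha hab]
  simp only [halfSiegelLin, halfSiegelLin', LinearMap.coe_mk, AddHom.coe_mk]
  have e₁ := star_star_add a (star u b) v
  have e₂ := star_star_add a (star u b) b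
  have e₃ := congrArg (fun w => star w a) (star_star_add' v u b)
  have e₄ := star_star_self a (star u b)
  have e₅ := congrArg (fun w => star w a) (star_self_star b u)
  simp only [star_add_left, star_smul_left] at e₃ e₅
  rw [hab, zero_smul, e₅] at e₂
  rw [ha, zero_smul] at e₄
  simp only [star_add_right, star_sub_left, star_sub_right, star_smul_right, e₄]
  rw [eq_sub_of_add_eq e₁, eq_neg_of_add_eq_zero_left e₂, eq_sub_of_add_eq' e₃, polar_comm a v]
  module

end OmegaEight

namespace OmegaEight

variable {F : Type*} [Field F]

theorem exists_isTrial {g : Orth F} (hg : g ∈ siegelGroup F) :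
    ∃ g₁ g₂ : Orth F, IsTrial g₁ g₂ g := by
  induction hg using Subgroup.closure_induction with
  | mem g hg =>
    obtain ⟨a, b, rfl⟩ := hg
    by_cases h : QPlus F a = 0 ∧ polar a b = 0
    · exact exists_isTrial_siegel h.1 h.2
    · rw [siegel, dif_neg h]; exact ⟨1, 1, .one⟩
  | one => exact ⟨1, 1, .one⟩
  | mul g h _ _ hg hh =>
    obtain ⟨g₁, g₂, hg⟩ := hg
    obtain ⟨h₁, h₂, hh⟩ := hh
    exact ⟨_, _, hg.mul hh⟩
  | inv g _ hg =>
    obtain ⟨g₁, g₂, hg⟩ := hg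
    exact ⟨_, _, hg.inv⟩

/-- The Clifford action of vectors on pairs of vectors. -/
def gamma : (Fin 8 → F) →ₗ[F] Module.End F ((Fin 8 → F) × (Fin 8 → F)) where
  toFun v :=
    { toFun := fun x => (star x.2 v, star v x.1)
      map_add' := fun x y => by simp
      map_smul' := fun c x => by simp }
  map_add' u v := by refine LinearMap.ext fun x => ?_; simp
  map_smul' c v := by refine LinearMap.ext fun x => ?_; simp

theorem gamma_apply (v : Fin 8 → F) (x : (Fin 8 → F) × (Fin 8 → F)) :
    gamma v x = (star x.2 v, star v x.1) := rfl

theorem gamma_mul_add (u v : Fin 8 → F) :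
    gamma u * gamma v + gamma v * gamma u = polar u v • (1 : Module.End F _) := by
  refine LinearMap.ext fun x => ?_
  simp only [LinearMap.add_apply, Module.End.mul_apply, gamma_apply, Prod.mk_add_mk,
    star_star_add, star_star_add', LinearMap.smul_apply, Module.End.one_apply]
  rw [polar_comm v u]; rfl

theorem gamma_mul_self (v : Fin 8 → F) :
    gamma v * gamma v = QPlus F v • (1 : Module.End F _) := by
  refine LinearMap.ext fun x => ?_
  simp only [Module.End.mul_apply, gamma_apply, star_star_self, star_self_star,
    LinearMap.smul_apply, Module.End.one_apply]
  rfl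

theorem gamma_bv_zero (p q : Fin 8 → F) : gamma (bv F 0) (p, q) =
    (![-q 7, 0, 0, 0, 0, -q 2, q 1, -q 4],
      ![-p 3, 0, 0, -p 4, 0, p 2, -p 1, 0]) := by
  refine Prod.ext ?_ ?_ <;> apply vec_ext <;> simp [bv_apply]

theorem gamma_bv_one (p q : Fin 8 → F) : gamma (bv F 1) (p, q) =
    (![0, -q 7, 0, 0, q 2, 0, -q 0, -q 5],
      ![0, -p 3, 0, -p 5, -p 2, 0, p 0, 0]) := by
  refine Prod.ext ?_ ?_ <;> apply vec_ext <;> simp [bv_apply]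

theorem gamma_bv_two (p q : Fin 8 → F) : gamma (bv F 2) (p, q) =
    (![0, 0, -q 7, 0, -q 1, q 0, 0, -q 6],
      ![0, 0, -p 3, -p 6, p 1, -p 0, 0, 0]) := by
  refine Prod.ext ?_ ?_ <;> apply vec_ext <;> simp [bv_apply]

theorem gamma_bv_three (p q : Fin 8 → F) : gamma (bv F 3) (p, q) =
    (![-q 0, -q 1, -q 2, 0, 0, 0, 0, q 3],
      ![0, 0, 0, 0, -p 4, -p 5, -p 6, p 3]) := by
  refine Prod.ext ?_ ?_ <;> apply vec_ext <;> simp [bv_apply]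

theorem gamma_bv_four (p q : Fin 8 → F) : gamma (bv F 4) (p, q) =
    (![0, -q 6, q 5, -q 0, -q 3, 0, 0, 0],
      ![0, p 6, -p 5, 0, -p 7, 0, 0, -p 0]) := by
  refine Prod.ext ?_ ?_ <;> apply vec_ext <;> simp [bv_apply]

theorem gamma_bv_five (p q : Fin 8 → F) : gamma (bv F 5) (p, q) =
    (![q 6, 0, -q 4, -q 1, 0, -q 3, 0, 0],
      ![-p 6, 0, p 4, 0, 0, -p 7, 0, -p 1]) := by
  refine Prod.ext ?_ ?_ <;> apply vec_ext <;> simp [bv_apply]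

theorem gamma_bv_six (p q : Fin 8 → F) : gamma (bv F 6) (p, q) =
    (![-q 5, q 4, 0, -q 2, 0, 0, -q 3, 0],
      ![p 5, -p 4, 0, 0, 0, 0, -p 7, -p 2]) := by
  refine Prod.ext ?_ ?_ <;> apply vec_ext <;> simp [bv_apply]

theorem gamma_bv_seven (p q : Fin 8 → F) : gamma (bv F 7) (p, q) =
    (![0, 0, 0, q 7, -q 4, -q 5, -q 6, 0],
      ![-p 0, -p 1, -p 2, p 7, 0, 0, 0, 0]) := by
  refine Prod.ext ?_ ?_ <;> apply vec_ext <;> simp [bv_apply]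

/-- Rank-one operators among the even Clifford words. -/
theorem exists_word_apply (k : Fin 8) : ∃ (L : List (Fin 8 → F)) (n : ℕ) (c : F),
    L.length = 2 * n ∧ c ≠ 0 ∧ ∀ p q, (L.map gamma).prod (p, q) = ((c * p 0) • bv F k, 0) := by
  fin_cases k
  · refine ⟨[bv F 0, bv F 4, bv F 5, bv F 1, bv F 6, bv F 2, bv F 3, bv F 7], 4, 1, rfl, by simp, fun p q => ?_⟩
    simp only [List.map_cons, List.map_nil, List.prod_cons, List.prod_nil, mul_one, Module.End.mul_apply, gamma_bv_zero, gamma_bv_one, gamma_bv_two, gamma_bv_three, gamma_bv_four, gamma_bv_five, gamma_bv_six, gamma_bv_seven]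
    refine Prod.ext ?_ ?_ <;> ext i <;> fin_cases i <;> simp [bv_apply]
  · refine ⟨[bv F 4, bv F 1, bv F 6, bv F 2, bv F 3, bv F 7], 3, -1, rfl, by simp, fun p q => ?_⟩
    simp only [List.map_cons, List.map_nil, List.prod_cons, List.prod_nil, mul_one, Module.End.mul_apply, gamma_bv_zero, gamma_bv_one, gamma_bv_two, gamma_bv_three, gamma_bv_four, gamma_bv_five, gamma_bv_six, gamma_bv_seven]
    refine Prod.ext ?_ ?_ <;> ext i <;> fin_cases i <;> simp [bv_apply]
  · refine ⟨[bv F 4, bv F 5, bv F 1, bv F 2, bv F 3, bv F 7], 3, -1, rfl, by simp, fun p q => ?_⟩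
    simp only [List.map_cons, List.map_nil, List.prod_cons, List.prod_nil, mul_one, Module.End.mul_apply, gamma_bv_zero, gamma_bv_one, gamma_bv_two, gamma_bv_three, gamma_bv_four, gamma_bv_five, gamma_bv_six, gamma_bv_seven]
    refine Prod.ext ?_ ?_ <;> ext i <;> fin_cases i <;> simp [bv_apply]
  · refine ⟨[bv F 4, bv F 5, bv F 1, bv F 6, bv F 2, bv F 7], 3, 1, rfl, by simp, fun p q => ?_⟩
    simp only [List.map_cons, List.map_nil, List.prod_cons, List.prod_nil, mul_one, Module.End.mul_apply, gamma_bv_zero, gamma_bv_one, gamma_bv_two, gamma_bv_three, gamma_bv_four, gamma_bv_five, gamma_bv_six, gamma_bv_seven]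
    refine Prod.ext ?_ ?_ <;> ext i <;> fin_cases i <;> simp [bv_apply]
  · refine ⟨[bv F 4, bv F 1, bv F 2, bv F 7], 2, -1, rfl, by simp, fun p q => ?_⟩
    simp only [List.map_cons, List.map_nil, List.prod_cons, List.prod_nil, mul_one, Module.End.mul_apply, gamma_bv_zero, gamma_bv_one, gamma_bv_two, gamma_bv_three, gamma_bv_four, gamma_bv_five, gamma_bv_six, gamma_bv_seven]
    refine Prod.ext ?_ ?_ <;> ext i <;> fin_cases i <;> simp [bv_apply]
  · refine ⟨[bv F 0, bv F 4, bv F 5, bv F 1, bv F 2, bv F 7], 3, -1, rfl, by simp, fun p q => ?_⟩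
    simp only [List.map_cons, List.map_nil, List.prod_cons, List.prod_nil, mul_one, Module.End.mul_apply, gamma_bv_zero, gamma_bv_one, gamma_bv_two, gamma_bv_three, gamma_bv_four, gamma_bv_five, gamma_bv_six, gamma_bv_seven]
    refine Prod.ext ?_ ?_ <;> ext i <;> fin_cases i <;> simp [bv_apply]
  · refine ⟨[bv F 0, bv F 4, bv F 1, bv F 6, bv F 2, bv F 7], 3, 1, rfl, by simp, fun p q => ?_⟩
    simp only [List.map_cons, List.map_nil, List.prod_cons, List.prod_nil, mul_one, Module.End.mul_apply, gamma_bv_zero, gamma_bv_one, gamma_bv_two, gamma_bv_three, gamma_bv_four, gamma_bv_five, gamma_bv_six, gamma_bv_seven]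
    refine Prod.ext ?_ ?_ <;> ext i <;> fin_cases i <;> simp [bv_apply]
  · refine ⟨[bv F 0, bv F 4, bv F 1, bv F 2, bv F 3, bv F 7], 3, 1, rfl, by simp, fun p q => ?_⟩
    simp only [List.map_cons, List.map_nil, List.prod_cons, List.prod_nil, mul_one, Module.End.mul_apply, gamma_bv_zero, gamma_bv_one, gamma_bv_two, gamma_bv_three, gamma_bv_four, gamma_bv_five, gamma_bv_six, gamma_bv_seven]
    refine Prod.ext ?_ ?_ <;> ext i <;> fin_cases i <;> simp [bv_apply]

/-- The action of a pair of isometries on pairs of vectors. -/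
def spin (g₁ g₂ : Orth F) : Module.End F ((Fin 8 → F) × (Fin 8 → F)) :=
  (lin g₁).prodMap (lin g₂)

theorem spin_apply (g₁ g₂ : Orth F) (p q : Fin 8 → F) :
    spin g₁ g₂ (p, q) = (lin g₁ p, lin g₂ q) := rfl

theorem IsTrial.spin_mul_gamma {g₁ g₂ g₃ : Orth F} (h : IsTrial g₁ g₂ g₃) (v : Fin 8 → F) :
    spin g₁ g₂ * gamma v = gamma (lin g₃ v) * spin g₁ g₂ := by
  refine LinearMap.ext fun x => ?_
  obtain ⟨p, q⟩ := x
  rw [Module.End.mul_apply, Module.End.mul_apply, gamma_apply, spin_apply, spin_apply, gamma_apply,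
    h, h.rotate]

/-- The span of the Clifford words of a given length. -/
def wordSpan (F : Type*) [Field F] (n : ℕ) :
    Submodule F (Module.End F ((Fin 8 → F) × (Fin 8 → F))) :=
  Submodule.span F {X | ∃ L : List (Fin 8 → F), L.length = n ∧ (L.map gamma).prod = X}

theorem gamma_mul_mem_wordSpan (v : Fin 8 → F) {n : ℕ} {X} (h : X ∈ wordSpan F n) :
    gamma v * X ∈ wordSpan F (n + 1) := by
  induction h using Submodule.span_induction with
  | mem X hX =>
    obtain ⟨L, rfl, rfl⟩ := hX
    exact Submodule.subset_span ⟨v :: L, rfl, by simp⟩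
  | zero => rw [mul_zero]; exact zero_mem _
  | add X Y _ _ hX hY => rw [mul_add]; exact add_mem hX hY
  | smul c X _ hX => rw [mul_smul_comm]; exact Submodule.smul_mem _ _ hX

theorem word_mul_gamma_mem (u : Fin 8 → F) : ∀ (L : List (Fin 8 → F)) (n : ℕ), L.length = n + 1 →
    (L.map gamma).prod * gamma u - (-1 : F) ^ (n + 1) • (gamma u * (L.map gamma).prod) ∈
      wordSpan F n
  | [], _, h => by simp at h
  | [v], n, h => by
    obtain rfl : n = 0 := by simpa using h
    have e := gamma_mul_add v u
    have e' : gamma v * gamma u - (-1 : F) • (gamma u * gamma v) =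
        polar v u • (1 : Module.End F _) := by rw [← e]; module
    simp only [List.map_cons, List.map_nil, List.prod_cons, List.prod_nil, mul_one, zero_add,
      pow_one]
    rw [e']
    exact Submodule.smul_mem _ _ (Submodule.subset_span ⟨[], rfl, rfl⟩)
  | v :: w :: L, n, h => by
    obtain ⟨n, rfl⟩ : ∃ m, n = m + 1 := ⟨n - 1, by simp at h; omega⟩
    have ih := gamma_mul_mem_wordSpan v (word_mul_gamma_mem u (w :: L) n (by simpa using h))
    have hX : ((w :: L).map gamma).prod ∈ wordSpan F (n + 1) :=
      Submodule.subset_span ⟨w :: L, by simpa using h, rfl⟩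
    rw [List.map_cons, List.prod_cons]
    generalize ((w :: L).map gamma).prod = X at ih hX
    have e : gamma u * (gamma v * X) = polar v u • X - gamma v * (gamma u * X) := by
      rw [← mul_assoc, eq_sub_of_add_eq' (gamma_mul_add v u), sub_mul, smul_mul_assoc, one_mul,
        mul_assoc]
    have := add_mem ih (Submodule.smul_mem _ ((-1 : F) ^ (n + 1) * polar v u) hX)
    convert this using 1
    rw [e, mul_sub, mul_smul_comm, mul_assoc, pow_succ (-1 : F) (n + 1)]
    module

theorem IsTrial.trace_word {g₁ g₂ g₃ : Orth F} (h : IsTrial g₁ g₂ g₃)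
    (h0 : LinearMap.trace F _ (lin g₁) + LinearMap.trace F _ (lin g₂) = 0)
    (h3 : ∀ v, lin g₃ v = -v → v = 0) (n : ℕ) {X} (hX : X ∈ wordSpan F (2 * n)) :
    LinearMap.trace F _ (spin g₁ g₂ * X) = 0 := by
  induction n generalizing X with
  | zero =>
    induction hX using Submodule.span_induction with
    | mem X hX =>
      obtain ⟨L, hL, rfl⟩ := hX
      obtain rfl : L = [] := by simpa using hL
      rw [List.map_nil, List.prod_nil, mul_one, spin, LinearMap.trace_prodMap', h0]
    | zero => rw [mul_zero, map_zero]
    | add X Y _ _ hX hY => rw [mul_add, map_add, hX, hY, add_zero]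
    | smul c X _ hX => rw [mul_smul_comm, map_smul, hX, smul_zero]
  | succ n ih =>
    induction hX using Submodule.span_induction with
    | mem X hX =>
      obtain ⟨L, hL, rfl⟩ := hX
      obtain ⟨v, L, rfl⟩ : ∃ v L', L = v :: L' := by
        cases L with
        | nil => simp at hL
        | cons v L => exact ⟨v, L, rfl⟩
      have hL' : L.length = 2 * n + 1 := by simp at hL; omega
      have hsurj : Function.Surjective (lin g₃ + 1 : Module.End F (Fin 8 → F)) := by
        rw [← LinearMap.injective_iff_surjective, ← LinearMap.ker_eq_bot, LinearMap.ker_eq_bot']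
        intro m hm
        exact h3 m (eq_neg_of_add_eq_zero_left hm)
      obtain ⟨u, rfl⟩ := hsurj v
      have hw := ih (word_mul_gamma_mem (lin g₃ u) L _ hL')
      rw [List.map_cons, List.prod_cons]
      generalize (L.map gamma).prod = X at hw
      have hs : (-1 : F) ^ (2 * n + 1) = -1 := by rw [pow_succ, pow_mul]; simp
      rw [hs, mul_sub, map_sub, mul_smul_comm, map_smul, smul_eq_mul, neg_one_mul, sub_neg_eq_add] at hw
      have e : LinearMap.trace F _ (spin g₁ g₂ * (gamma u * X)) =
          LinearMap.trace F _ (spin g₁ g₂ * (X * gamma (lin g₃ u))) := by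
        rw [← mul_assoc, h.spin_mul_gamma, mul_assoc, LinearMap.trace_mul_comm, mul_assoc]
      rw [LinearMap.add_apply, Module.End.one_apply, map_add, add_mul, mul_add, map_add, e,
        add_comm, hw]
    | zero => rw [mul_zero, map_zero]
    | add X Y _ _ hX hY => rw [mul_add, map_add, hX, hY, add_zero]
    | smul c X _ hX => rw [mul_smul_comm, map_smul, hX, smul_zero]

/-- A component of a compatible triple has eigenvalue `-1` as soon as the traces of the other
two components are opposite. -/
theorem IsTrial.exists_eigenvector {g₁ g₂ g₃ : Orth F} (h : IsTrial g₁ g₂ g₃)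
    (h0 : LinearMap.trace F _ (lin g₁) + LinearMap.trace F _ (lin g₂) = 0) :
    ∃ v, v ≠ 0 ∧ lin g₃ v = -v := by
  by_contra! hc
  have h3 : ∀ v, lin g₃ v = -v → v = 0 := fun v hv => by_contra fun hv0 => hc v hv0 hv
  have key : ∀ k, lin g₁ (bv F k) 0 = 0 := by
    intro k
    obtain ⟨L, n, c, hL, hc, hX⟩ := exists_word_apply (F := F) k
    have ht := h.trace_word h0 h3 n (Submodule.subset_span ⟨L, hL, rfl⟩)
    have e : spin g₁ g₂ * (L.map gamma).prod = LinearMap.smulRight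
        (c • (LinearMap.proj 0 ∘ₗ LinearMap.fst F (Fin 8 → F) (Fin 8 → F)))
        ((lin g₁ (bv F k), 0) : (Fin 8 → F) × (Fin 8 → F)) := by
      refine LinearMap.ext fun x => ?_
      obtain ⟨p, q⟩ := x
      rw [Module.End.mul_apply, hX, spin_apply]
      simp
    rw [e, LinearMap.trace_smulRight] at ht
    simpa [hc] using ht
  have : ∀ v, lin g₁ v 0 = 0 := by
    intro v
    rw [eq_sum_bv v]
    simp [key]
  have h1 := this (lin g₁⁻¹ (bv F 0))
  rw [lin_apply_inv, bv_apply, if_pos rfl] at h1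
  exact one_ne_zero h1

/-- If one component of a compatible triple is scalar, then so are the others. -/
theorem IsTrial.scalar {g₁ g₂ g₃ : Orth F} (h : IsTrial g₁ g₂ g₃) {c : F}
    (hc : ∀ v, lin g₃ v = c • v) (hc2 : c ^ 2 = 1) :
    ∃ l : F, l ^ 2 = 1 ∧ (∀ v, lin g₁ v = l • v) ∧ ∀ v, lin g₂ v = (c * l) • v := by
  have hcomm : ∀ (n : ℕ) (L : List (Fin 8 → F)), L.length = 2 * n →
      spin g₁ g₂ * (L.map gamma).prod = (L.map gamma).prod * spin g₁ g₂ := by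
    intro n
    induction n with
    | zero =>
      intro L hL
      obtain rfl : L = [] := by simpa using hL
      simp
    | succ n ih =>
      intro L hL
      match L, hL with
      | u :: v :: L, hL =>
        have hL' : L.length = 2 * n := by simp at hL; omega
        simp only [List.map_cons, List.prod_cons]
        rw [← mul_assoc, h.spin_mul_gamma, mul_assoc, ← mul_assoc (spin g₁ g₂), h.spin_mul_gamma,
          mul_assoc, ih L hL', hc, hc, map_smul, map_smul, smul_mul_assoc, smul_mul_assoc,
          mul_smul_comm, smul_smul, ← pow_two, hc2, one_smul]
        simp only [mul_assoc]
  obtain ⟨l, hl⟩ : ∃ l : F, ∀ k, lin g₁ (bv F k) = l • bv F k := by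
    refine ⟨lin g₁ (bv F 0) 0, fun k => ?_⟩
    obtain ⟨L, n, d, hL, hd, hX⟩ := exists_word_apply (F := F) k
    have e := congrArg (fun X => (X (bv F 0, 0)).1) (hcomm n L hL)
    simp only [Module.End.mul_apply, hX, spin_apply, bv_apply, if_true, mul_one, map_smul,
      mul_smul] at e
    exact smul_right_injective _ hd e
  have h1 : ∀ v, lin g₁ v = l • v := by
    intro v
    conv_lhs => rw [eq_sum_bv v]
    conv_rhs => rw [eq_sum_bv v]
    simp only [map_add, map_smul, hl]
    module
  refine ⟨l, ?_, h1, ?_⟩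
  · have e := QPlus_lin g₁ (bv F 0 + bv F 4)
    rw [h1, QPlus_smul] at e
    have : QPlus F (bv F 0 + bv F 4) = 1 := by simp [QPlus, bv_apply]
    rwa [this, mul_one] at e
  · intro v
    have hq : QPlus F (bv F 0 + bv F 4) = 1 := by simp [QPlus, bv_apply]
    have e := star_self_star (bv F 0 + bv F 4) v
    rw [hq, one_smul] at e
    have e' := h.rotate (bv F 0 + bv F 4) (star v (bv F 0 + bv F 4))
    rwa [hc, h1, e, star_smul_left, star_smul_right, e, smul_smul] at e'

end OmegaEight

namespace OmegaEight

variable {F : Type*} [Field F]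

theorem mem_center_of_scalar {c : Orth F} {l : F} (h : ∀ v, lin c v = l • v) :
    c ∈ Subgroup.center (Orth F) := by
  rw [Subgroup.mem_center_iff]
  intro g
  refine lin_ext fun v => ?_
  rw [lin_mul_apply, lin_mul_apply, h, h, map_smul]

theorem exists_scalar_of_mem_center {c : Orth F} (h : c ∈ Subgroup.center (Orth F)) :
    ∃ l : F, l ^ 2 = 1 ∧ ∀ v, lin c v = l • v :=
  scalar_of_commute fun g _ => (Subgroup.mem_center_iff.1 h g).symm

theorem sq_eq_one_of_mem_center {c : Orth F} (h : c ∈ Subgroup.center (Orth F)) : c ^ 2 = 1 := by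
  obtain ⟨l, hl, hc⟩ := exists_scalar_of_mem_center h
  refine lin_ext fun v => ?_
  rw [pow_two, lin_mul_apply, hc, hc, smul_smul, ← pow_two, hl, one_smul, lin_one_apply]

/-- The isometry `v ↦ -v`. -/
noncomputable def negId (F : Type*) [Field F] : Orth F :=
  ofIso (-1) fun v => by simp

@[simp] theorem lin_negId (v : Fin 8 → F) : lin (negId F) v = -v := by simp [negId]

theorem IsTrial.mem_center {g₁ g₂ g₃ : Orth F} (h : IsTrial g₁ g₂ g₃)
    (h₃ : g₃ ∈ Subgroup.center (Orth F)) : g₁ ∈ Subgroup.center (Orth F) := by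
  obtain ⟨c, hc2, hc⟩ := exists_scalar_of_mem_center h₃
  obtain ⟨l, -, hl, -⟩ := h.scalar hc hc2
  exact mem_center_of_scalar hl

theorem IsTrial.pow {g₁ g₂ g₃ : Orth F} (h : IsTrial g₁ g₂ g₃) (n : ℕ) :
    IsTrial (g₁ ^ n) (g₂ ^ n) (g₃ ^ n) := by
  induction n with
  | zero => simpa using IsTrial.one
  | succ n ih => simpa only [pow_succ] using ih.mul h

/-- A component of a compatible triple has eigenvalue `1` as soon as the traces of the other two
components agree. -/
theorem IsTrial.exists_fixed {g₁ g₂ g₃ : Orth F} (h : IsTrial g₁ g₂ g₃)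
    (h0 : LinearMap.trace F _ (lin g₁) = LinearMap.trace F _ (lin g₂)) :
    ∃ v, v ≠ 0 ∧ lin g₃ v = v := by
  have h' : IsTrial (negId F * g₁) g₂ (negId F * g₃) := fun a b => by
    rw [lin_mul_apply, lin_mul_apply, lin_negId, lin_negId, h, star_neg_right]
  have e : lin (negId F * g₁) = -lin g₁ := LinearMap.ext fun v => by simp
  obtain ⟨v, hv, hv'⟩ := h'.exists_eigenvector (by rw [e, map_neg, h0, neg_add_cancel])
  refine ⟨v, hv, ?_⟩
  rwa [lin_mul_apply, lin_negId, neg_inj] at hv'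

/-- `x` and `y` generate a group containing all Siegel transformations, up to scalars. -/
def ProjGen (x y : Orth F) : Prop :=
  siegelGroup F ≤ Subgroup.closure {x, y} ⊔ Subgroup.center (Orth F)

namespace ProjGen

variable {x y : Orth F}

theorem of_le {x' y' : Orth F} (h : ProjGen x y)
    (hx : x ∈ Subgroup.closure {x', y'} ⊔ Subgroup.center (Orth F))
    (hy : y ∈ Subgroup.closure {x', y'} ⊔ Subgroup.center (Orth F)) : ProjGen x' y' := by
  refine h.trans (sup_le ((Subgroup.closure_le _).2 ?_) le_sup_right)
  rintro g (rfl | rfl)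
  exacts [hx, hy]

theorem invariant (h : ProjGen x y) (W : Submodule F (Fin 8 → F)) [Finite F]
    (hx : ∀ w ∈ W, lin x w ∈ W) (hy : ∀ w ∈ W, lin y w ∈ W) :
    ∀ g ∈ siegelGroup F, ∀ w ∈ W, lin g w ∈ W := by
  intro g hg
  obtain ⟨k, hk, c, hc, rfl⟩ := Subgroup.mem_sup_of_normal_right.1 (h hg)
  obtain ⟨l, -, hc⟩ := exists_scalar_of_mem_center hc
  suffices hk : ∀ w ∈ W, lin k w ∈ W from fun w hw => by
    rw [lin_mul_apply, hc]; exact hk _ (W.smul_mem _ hw)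
  clear hg hc
  induction hk using Subgroup.closure_induction with
  | mem g hg =>
    obtain rfl | rfl := hg
    exacts [hx, hy]
  | one => intro w hw; rwa [lin_one_apply]
  | mul a b _ _ ha hb => intro w hw; rw [lin_mul_apply]; exact ha _ (hb _ hw)
  | inv a _ ha =>
    intro w hw
    have hinj : Function.Injective ((lin a).restrict ha) := fun u v e => by
      have := congrArg Subtype.val e
      exact Subtype.ext ((lin_apply_inj a).1 this)
    obtain ⟨u, hu⟩ := Finite.surjective_of_injective hinj ⟨w, hw⟩
    have e : lin a u = w := congrArg Subtype.val hu
    rw [← e, lin_inv_apply]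
    exact u.2

theorem eq_top (h : ProjGen x y) [Finite F] (W : Submodule F (Fin 8 → F))
    (hx : ∀ w ∈ W, lin x w ∈ W) (hy : ∀ w ∈ W, lin y w ∈ W) {v : Fin 8 → F} (hv : v ∈ W)
    (h0 : v ≠ 0) : W = ⊤ :=
  eq_top_of_invariant W (h.invariant W hx hy) hv h0

theorem span_ne_top (s : Finset (Fin 8 → F)) (hs : s.card < 8) :
    Submodule.span F (s : Set (Fin 8 → F)) ≠ ⊤ := by
  intro h
  have h1 := finrank_span_finset_le_card (R := F) s
  rw [Set.finrank, h, finrank_top, Module.finrank_fin_fun] at h1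
  omega

theorem eq_zero_of_eigenvector (h : ProjGen x y) [Finite F] {v : Fin 8 → F} {c d : F}
    (hx : lin x v = c • v) (hy : lin y v = d • v) : v = 0 := by
  by_contra h0
  have key : ∀ (g : Orth F) (e : F), lin g v = e • v →
      ∀ w ∈ Submodule.span F (({v} : Finset (Fin 8 → F)) : Set (Fin 8 → F)),
        lin g w ∈ Submodule.span F (({v} : Finset (Fin 8 → F)) : Set (Fin 8 → F)) := by
    intro g e he w hw
    rw [Finset.coe_singleton, Submodule.mem_span_singleton] at hw ⊢
    obtain ⟨a, rfl⟩ := hw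
    exact ⟨a * e, by rw [map_smul, he, smul_smul]⟩
  classical
  exact span_ne_top {v} (by simp) (h.eq_top _ (key x c hx) (key y d hy)
    (Submodule.subset_span (by simp)) h0)

end ProjGen

theorem exists_isTrial_of_mem_closure {x₁ x₂ x₃ y₁ y₂ y₃ w : Orth F} (hx : IsTrial x₁ x₂ x₃)
    (hy : IsTrial y₁ y₂ y₃) (hw : w ∈ Subgroup.closure {x₃, y₃}) :
    ∃ w₁ ∈ Subgroup.closure {x₁, y₁}, ∃ w₂, IsTrial w₁ w₂ w := by
  induction hw using Subgroup.closure_induction with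
  | mem g hg =>
    obtain rfl | rfl := hg
    · exact ⟨x₁, Subgroup.subset_closure (by simp), _, hx⟩
    · exact ⟨y₁, Subgroup.subset_closure (by simp), _, hy⟩
  | one => exact ⟨1, one_mem _, 1, .one⟩
  | mul a b _ _ ha hb =>
    obtain ⟨a₁, ha₁, a₂, ha⟩ := ha
    obtain ⟨b₁, hb₁, b₂, hb⟩ := hb
    exact ⟨_, mul_mem ha₁ hb₁, _, ha.mul hb⟩
  | inv a _ ha =>
    obtain ⟨a₁, ha₁, a₂, ha⟩ := ha
    exact ⟨_, inv_mem ha₁, _, ha.inv⟩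

theorem ProjGen.transfer {x₁ x₂ x₃ y₁ y₂ y₃ : Orth F} (hx : IsTrial x₁ x₂ x₃)
    (hy : IsTrial y₁ y₂ y₃) (h : ProjGen x₃ y₃) : ProjGen x₁ y₁ := by
  refine siegelGroup_le_commutator_self.trans (Subgroup.commutator_le.2 fun B hB C hC => ?_)
  obtain ⟨b₁, b₂, hb⟩ := exists_isTrial hB
  obtain ⟨c₁, c₂, hc⟩ := exists_isTrial hC
  have hb := hb.rotate.rotate
  have hc := hc.rotate.rotate
  have hcomm := ((hb.mul hc).mul hb.inv).mul hc.inv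
  have h3 : ⁅b₂, c₂⁆ ∈ siegelGroup F := by
    rw [← commutator_eq_siegelGroup]
    exact Subgroup.commutator_mem_commutator (Subgroup.mem_top _) (Subgroup.mem_top _)
  obtain ⟨w, hw, z, hz, e⟩ := Subgroup.mem_sup_of_normal_right.1 (h h3)
  obtain ⟨w₁, hw₁, w₂, hw⟩ := exists_isTrial_of_mem_closure hx hy hw
  have ht := hw.inv.mul hcomm
  rw [← commutatorElement_def, ← commutatorElement_def, ← commutatorElement_def, ← e,
    inv_mul_cancel_left] at ht
  refine Subgroup.mem_sup_of_normal_right.2 ⟨w₁, hw₁, _, ht.mem_center hz, ?_⟩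
  rw [mul_inv_cancel_left]

/-- Compatible triples lifting a `(2,3)`-generating pair modulo scalars. -/
structure GenTriple (x₁ x₂ x₃ y₁ y₂ y₃ : Orth F) : Prop where
  trial_x : IsTrial x₁ x₂ x₃
  trial_y : IsTrial y₁ y₂ y₃
  gen : ProjGen x₃ y₃
  sq₁ : x₁ ^ 2 ∈ Subgroup.center (Orth F)
  sq₂ : x₂ ^ 2 ∈ Subgroup.center (Orth F)
  sq₃ : x₃ ^ 2 ∈ Subgroup.center (Orth F)
  cube₁ : y₁ ^ 3 = 1
  cube₂ : y₂ ^ 3 = 1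
  cube₃ : y₃ ^ 3 = 1

theorem GenTriple.rotate {x₁ x₂ x₃ y₁ y₂ y₃ : Orth F} (h : GenTriple x₁ x₂ x₃ y₁ y₂ y₃) :
    GenTriple x₂ x₃ x₁ y₂ y₃ y₁ :=
  ⟨h.trial_x.rotate, h.trial_y.rotate, h.gen.transfer h.trial_x h.trial_y, h.sq₂, h.sq₃, h.sq₁,
    h.cube₂, h.cube₃, h.cube₁⟩

theorem pow_four_pow_three {y : Orth F} (h : y ^ 3 ∈ Subgroup.center (Orth F)) :
    (y ^ 4) ^ 3 = 1 := by
  rw [← pow_mul, mul_comm, pow_mul, show (y ^ 3) ^ 4 = ((y ^ 3) ^ 2) ^ 2 by rw [← pow_mul (y ^ 3)],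
    sq_eq_one_of_mem_center h, one_pow]

theorem map_center_le : (Subgroup.center ↥(commutator (Orth F))).map (commutator (Orth F)).subtype ≤
    Subgroup.center (Orth F) := by
  rintro _ ⟨c, hc, rfl⟩
  obtain ⟨l, -, hl⟩ := scalar_of_commute (c := (c : Orth F)) fun g hg => by
    rw [← commutator_eq_siegelGroup] at hg
    exact congrArg Subtype.val (Subgroup.mem_center_iff.1 hc ⟨g, hg⟩).symm
  exact mem_center_of_scalar hl

theorem exists_genTriple (h : IsTwoThreeGenerated (↥(commutator (Orth F)) ⧸
    Subgroup.center ↥(commutator (Orth F)))) :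
    ∃ x₁ x₂ x₃ y₁ y₂ y₃ : Orth F, GenTriple x₁ x₂ x₃ y₁ y₂ y₃ := by
  obtain ⟨x, y, hx, hy, hgen⟩ := h
  obtain ⟨x, rfl⟩ := QuotientGroup.mk_surjective x
  obtain ⟨y, rfl⟩ := QuotientGroup.mk_surjective y
  have hx2 : (x : Orth F) ^ 2 ∈ Subgroup.center (Orth F) := by
    refine map_center_le ⟨x ^ 2, ?_, rfl⟩
    rw [SetLike.mem_coe, ← QuotientGroup.eq_one_iff, QuotientGroup.mk_pow, ← hx, pow_orderOf_eq_one]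
  have hy3 : (y : Orth F) ^ 3 ∈ Subgroup.center (Orth F) := by
    refine map_center_le ⟨y ^ 3, ?_, rfl⟩
    rw [SetLike.mem_coe, ← QuotientGroup.eq_one_iff, QuotientGroup.mk_pow, ← hy, pow_orderOf_eq_one]
  have hg : ProjGen (x : Orth F) (y : Orth F) := by
    have h1 : Subgroup.closure {x, y} ⊔ Subgroup.center ↥(commutator (Orth F)) = ⊤ := by
      have h2 : (Subgroup.closure {x, y}).map
          (QuotientGroup.mk' (Subgroup.center ↥(commutator (Orth F)))) = ⊤ := by
        rw [MonoidHom.map_closure, Set.image_pair]; exact hgen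
      have h3 := congrArg (Subgroup.comap (QuotientGroup.mk' (Subgroup.center _))) h2
      rwa [Subgroup.comap_map_eq, QuotientGroup.ker_mk', Subgroup.comap_top] at h3
    have h2 := congrArg (Subgroup.map (commutator (Orth F)).subtype) h1
    rw [Subgroup.map_sup, MonoidHom.map_closure, Set.image_pair, ← MonoidHom.range_eq_map,
      Subgroup.range_subtype] at h2
    exact (siegelGroup_le_commutator.trans h2.ge).trans (sup_le_sup le_rfl map_center_le)
  obtain ⟨x₁, x₂, htx⟩ := exists_isTrial (commutator_eq_siegelGroup.le x.2)
  obtain ⟨y₁, y₂, hty⟩ := exists_isTrial (commutator_eq_siegelGroup.le y.2)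
  have hx1 := (htx.pow 2).mem_center hx2
  have hy1 := (hty.pow 3).mem_center hy3
  refine ⟨x₁, x₂, x, y₁ ^ 4, y₂ ^ 4, y ^ 4, htx, hty.pow 4, ?_, hx1,
    (htx.pow 2).rotate.mem_center hx1, hx2, pow_four_pow_three hy1,
    pow_four_pow_three ((hty.pow 3).rotate.mem_center hy1), pow_four_pow_three hy3⟩
  refine hg.of_le (Subgroup.mem_sup_left (Subgroup.subset_closure (by simp))) ?_
  have e : (y : Orth F) ^ 4 * ((y : Orth F) ^ 3)⁻¹ = y := by group
  have hm := mul_mem (Subgroup.mem_sup_left (T := Subgroup.center (Orth F))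
    (Subgroup.subset_closure (Set.mem_insert_of_mem (x : Orth F) (Set.mem_singleton ((y : Orth F) ^ 4)))))
    (Subgroup.mem_sup_right (inv_mem hy3))
  rwa [e] at hm

/-- A pair of isometries with large fixed spaces and no common fixed vector has a product without
fixed vectors. -/
theorem eq_zero_of_mul_fixed {x y : Orth F}
    (hfix : ∀ v, lin x v = v → lin y v = v → v = 0)
    (hdim : 8 ≤ Module.finrank F (LinearMap.ker (lin x - 1)) +
      Module.finrank F (LinearMap.ker (lin y - 1)))
    {v : Fin 8 → F} (hv : lin (x * y) v = v) : v = 0 := by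
  have memx : ∀ z, z ∈ LinearMap.ker (lin x - 1) ↔ lin x z = z := fun z => by
    rw [LinearMap.mem_ker, LinearMap.sub_apply, Module.End.one_apply, sub_eq_zero]
  have memy : ∀ z, z ∈ LinearMap.ker (lin y - 1) ↔ lin y z = z := fun z => by
    rw [LinearMap.mem_ker, LinearMap.sub_apply, Module.End.one_apply, sub_eq_zero]
  have hinf : LinearMap.ker (lin x - 1) ⊓ LinearMap.ker (lin y - 1) = ⊥ := by
    rw [eq_bot_iff]
    rintro z ⟨hz, hz'⟩
    exact hfix z ((memx z).1 hz) ((memy z).1 hz')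
  have hsup : LinearMap.ker (lin x - 1) ⊔ LinearMap.ker (lin y - 1) = ⊤ := by
    apply Submodule.eq_top_of_finrank_eq
    have h1 := Submodule.finrank_sup_add_finrank_inf_eq (LinearMap.ker (lin x - 1))
      (LinearMap.ker (lin y - 1))
    have h2 := Submodule.finrank_le (LinearMap.ker (lin x - 1) ⊔ LinearMap.ker (lin y - 1))
    rw [hinf, finrank_bot] at h1
    rw [Module.finrank_fin_fun] at h2 ⊢
    omega
  have e : lin y v = lin x⁻¹ v := by
    rw [← lin_apply_inj x, ← lin_mul_apply, hv, lin_apply_inv]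
  have hd : lin y v - v = 0 := by
    apply eq_zero_of_polar
    intro w
    obtain ⟨a, ha, b, hb, rfl⟩ := Submodule.mem_sup.1 (hsup.ge (Submodule.mem_top (x := w)))
    have h1 : polar (lin y v - v) a = 0 := by
      rw [e, polar_sub_left, polar_lin_left, inv_inv, (memx a).1 ha, sub_self]
    have h2 : polar (lin y v - v) b = 0 := by
      have h3 := polar_lin y v b
      rw [(memy b).1 hb] at h3
      rw [polar_sub_left, h3, sub_self]
    rw [polar_add_right, h1, h2, add_zero]
  have hy : lin y v = v := sub_eq_zero.1 hd
  refine hfix v ?_ hy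
  rw [lin_mul_apply, hy] at hv
  exact hv

end OmegaEight

namespace OmegaEight

variable {F : Type*} [Field F]

theorem mem_ker_lin_sub_one {g : Orth F} {v : Fin 8 → F} :
    v ∈ LinearMap.ker (lin g - 1) ↔ lin g v = v := by
  rw [LinearMap.mem_ker, LinearMap.sub_apply, Module.End.one_apply, sub_eq_zero]

theorem finrank_le_finrank_map_add (f : Module.End F (Fin 8 → F)) (W : Submodule F (Fin 8 → F)) :
    Module.finrank F W ≤ Module.finrank F (W.map f) + Module.finrank F (LinearMap.ker f) := by
  have h := LinearMap.finrank_range_add_finrank_ker (f.domRestrict W)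
  rw [LinearMap.range_domRestrict] at h
  rw [← h]
  gcongr
  rw [LinearMap.ker_domRestrict]
  have e := (Submodule.equivMapOfInjective W.subtype W.injective_subtype
    ((LinearMap.ker f).comap W.subtype)).finrank_eq
  rw [e]
  exact Submodule.finrank_mono (Submodule.map_comap_le _ _)

/-- An isometry of order three in characteristic three has a fixed space of dimension at least
four. -/
theorem four_le_finrank_fixed (h3 : (3 : F) = 0) {y : Orth F} (hy : y ^ 3 = 1) :
    4 ≤ Module.finrank F (LinearMap.ker (lin y - 1)) := by
  have hyyy : ∀ v, lin y (lin y (lin y v)) = v := fun v => by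
    rw [← lin_mul_apply, ← lin_mul_apply, ← pow_two, ← pow_succ, hy, lin_one_apply]
  have hN : ∀ v, (lin y - 1) ((lin y - 1) ((lin y - 1) v)) = 0 := by
    intro v
    simp only [LinearMap.sub_apply, Module.End.one_apply, map_sub, hyyy]
    have : ∀ w : Fin 8 → F, (3 : F) • w = 0 := fun w => by rw [h3, zero_smul]
    trans (3 : F) • lin y v - (3 : F) • lin y (lin y v)
    · module
    · rw [this, this, sub_self]
  have hge : 8 ≤ 3 * Module.finrank F (LinearMap.ker (lin y - 1)) := by
    have h1 := finrank_le_finrank_map_add (lin y - 1) ⊤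
    have h2 := finrank_le_finrank_map_add (lin y - 1) (Submodule.map (lin y - 1) ⊤)
    have h4 : Submodule.map (lin y - 1) (Submodule.map (lin y - 1) ⊤) ≤
        LinearMap.ker (lin y - 1) := by
      rintro _ ⟨_, ⟨v, -, rfl⟩, rfl⟩
      exact hN v
    have h5 := Submodule.finrank_mono h4
    rw [finrank_top, Module.finrank_fin_fun] at h1
    omega
  by_contra! hlt
  have hk : Module.finrank F (LinearMap.ker (lin y - 1)) = 3 := by omega
  obtain ⟨C, hC⟩ := Submodule.exists_isCompl (LinearMap.ker (lin y - 1))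
  have hC5 : Module.finrank F C = 5 := by
    have := Submodule.finrank_add_eq_of_isCompl hC
    rw [Module.finrank_fin_fun] at this
    omega
  let b := Module.finBasisOfFinrankEq F C hC5
  have skew : ∀ u v : Fin 8 → F,
      polar (lin y u - lin y⁻¹ u) v = -polar (lin y v - lin y⁻¹ v) u := by
    intro u v
    simp only [polar_sub_left]
    rw [polar_lin_left, polar_lin_left y⁻¹, inv_inv, polar_comm u, polar_comm u]
    ring
  let M : Matrix (Fin 5) (Fin 5) F := Matrix.of fun i j =>
    polar (lin y (b i : Fin 8 → F) - lin y⁻¹ (b i : Fin 8 → F)) (b j : Fin 8 → F)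
  have hM : Mᵀ = -M := by
    ext i j
    exact skew _ _
  have hdet : M.det = 0 := by
    have h1 : M.det = -M.det := by
      conv_lhs => rw [← Matrix.det_transpose, hM, Matrix.det_neg]
      simp [pow_succ]
    linear_combination M.det * h3 - h1
  obtain ⟨c, hc0, hc⟩ := Matrix.exists_vecMul_eq_zero_iff.2 hdet
  let u : C := ∑ i, c i • b i
  have hu0 : u ≠ 0 := by
    intro h
    exact hc0 (funext fun i => Fintype.linearIndependent_iff.1 b.linearIndependent c h i)
  have hu : lin y (u : Fin 8 → F) - lin y⁻¹ (u : Fin 8 → F) = 0 := by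
    apply eq_zero_of_polar
    intro w
    obtain ⟨k, hk, z, hz, rfl⟩ := Submodule.mem_sup.1 (hC.sup_eq_top.ge (Submodule.mem_top (x := w)))
    have h1 : polar (lin y (u : Fin 8 → F) - lin y⁻¹ (u : Fin 8 → F)) k = 0 := by
      have e : lin y k = k := mem_ker_lin_sub_one.1 hk
      have e' : lin y⁻¹ k = k := by rw [← lin_apply_inj y, lin_apply_inv, e]
      rw [skew, e, e', sub_self, polar_zero_left, neg_zero]
    let φ : C →ₗ[F] F :=
      { toFun := fun z => polar (lin y (u : Fin 8 → F) - lin y⁻¹ (u : Fin 8 → F)) z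
        map_add' := fun z z' => by simp only [Submodule.coe_add, polar_add_right]
        map_smul' := fun a z => by
          simp only [Submodule.coe_smul, polar_smul_right, RingHom.id_apply, smul_eq_mul] }
    have hφ : φ = 0 := by
      refine b.ext fun j => ?_
      have h2 := congrFun hc j
      simp only [Matrix.vecMul, dotProduct, Pi.zero_apply] at h2
      rw [LinearMap.zero_apply, ← h2]
      change polar (lin y (u : Fin 8 → F) - lin y⁻¹ (u : Fin 8 → F)) (b j) = _
      rw [skew]
      let χ : (Fin 8 → F) →ₗ[F] F :=
        { toFun := fun z => polar (lin y (b j : Fin 8 → F) - lin y⁻¹ (b j : Fin 8 → F)) z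
          map_add' := fun z z' => by simp only [polar_add_right]
          map_smul' := fun a z => by
            simp only [polar_smul_right, RingHom.id_apply, smul_eq_mul] }
      change -χ u = _
      have eu : (u : Fin 8 → F) = ∑ i, c i • (b i : Fin 8 → F) := by simp [u]
      rw [eu, map_sum, ← Finset.sum_neg_distrib]
      refine Finset.sum_congr rfl fun i _ => ?_
      rw [map_smul, smul_eq_mul, ← mul_neg]
      congr 1
      exact (skew _ _).symm
    have h2 : φ ⟨z, hz⟩ = 0 := by rw [hφ]; rfl
    rw [polar_add_right, h1, zero_add]
    exact h2
  have hfix : lin y (u : Fin 8 → F) = u := by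
    have e1 : lin y (u : Fin 8 → F) = lin y⁻¹ u := sub_eq_zero.1 hu
    have e2 : lin y (lin y (u : Fin 8 → F)) = u := by rw [e1, lin_apply_inv]
    have e3 := hyyy (u : Fin 8 → F)
    rwa [e2] at e3
  have hmem : (u : Fin 8 → F) ∈ LinearMap.ker (lin y - 1) ⊓ C := ⟨mem_ker_lin_sub_one.2 hfix, u.2⟩
  rw [hC.inf_eq_bot, Submodule.mem_bot] at hmem
  exact hu0 (Subtype.ext hmem)

end OmegaEight

namespace OmegaEight

variable {F : Type*} [Field F]

theorem mem_ker_lin_negId_mul_sub_one {g : Orth F} {v : Fin 8 → F} :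
    v ∈ LinearMap.ker (lin (negId F * g) - 1) ↔ lin g v = -v := by
  rw [mem_ker_lin_sub_one, lin_mul_apply, lin_negId, neg_eq_iff_eq_neg]

theorem lin_lin_of_sq {x : Orth F} (hx : x ^ 2 = 1) (v : Fin 8 → F) : lin x (lin x v) = v := by
  rw [← lin_mul_apply, ← pow_two, hx, lin_one_apply]

theorem isCompl_eigenspaces (h2 : (2 : F) ≠ 0) {x : Orth F} (hx : x ^ 2 = 1) :
    IsCompl (LinearMap.ker (lin x - 1)) (LinearMap.ker (lin (negId F * x) - 1)) := by
  constructor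
  · rw [Submodule.disjoint_def]
    intro v hv hv'
    rw [mem_ker_lin_sub_one] at hv
    rw [mem_ker_lin_negId_mul_sub_one, hv] at hv'
    have h : (2 : F) • v = 0 := by rw [two_smul]; nth_rw 1 [hv']; exact neg_add_cancel v
    exact (smul_eq_zero.1 h).resolve_left h2
  · rw [codisjoint_iff, eq_top_iff]
    intro v _
    refine Submodule.mem_sup.2 ⟨(2 : F)⁻¹ • (v + lin x v), ?_, (2 : F)⁻¹ • (v - lin x v), ?_, ?_⟩
    · rw [mem_ker_lin_sub_one, map_smul, map_add, lin_lin_of_sq hx, add_comm]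
    · rw [mem_ker_lin_negId_mul_sub_one, map_smul, map_sub, lin_lin_of_sq hx]
      module
    · rw [← smul_add, show v + lin x v + (v - lin x v) = (2 : F) • v by module, smul_smul,
        inv_mul_cancel₀ h2, one_smul]

theorem finrank_le_four {x y : Orth F} (hfix : ∀ v, lin x v = v → lin y v = v → v = 0)
    (hy : 4 ≤ Module.finrank F (LinearMap.ker (lin y - 1))) :
    Module.finrank F (LinearMap.ker (lin x - 1)) ≤ 4 := by
  have h1 := Submodule.finrank_sup_add_finrank_inf_eq (LinearMap.ker (lin x - 1))
    (LinearMap.ker (lin y - 1))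
  have h2 := Submodule.finrank_le (LinearMap.ker (lin x - 1) ⊔ LinearMap.ker (lin y - 1))
  have hinf : LinearMap.ker (lin x - 1) ⊓ LinearMap.ker (lin y - 1) = ⊥ := by
    rw [eq_bot_iff]
    rintro z ⟨hz, hz'⟩
    exact hfix z (mem_ker_lin_sub_one.1 hz) (mem_ker_lin_sub_one.1 hz')
  rw [hinf, finrank_bot] at h1
  rw [Module.finrank_fin_fun] at h2
  omega

theorem ProjGen.fixed_eq_zero [Finite F] {x y : Orth F} (h : ProjGen x y) (v : Fin 8 → F)
    (hx : lin x v = v) (hy : lin y v = v) : v = 0 :=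
  h.eq_zero_of_eigenvector (c := 1) (d := 1) (by rw [hx, one_smul]) (by rw [hy, one_smul])

theorem ProjGen.fixed_eq_zero' [Finite F] {x y : Orth F} (h : ProjGen x y) (v : Fin 8 → F)
    (hx : lin (negId F * x) v = v) (hy : lin y v = v) : v = 0 :=
  h.eq_zero_of_eigenvector (c := -1) (d := 1)
    (by rw [neg_one_smul, ← mem_ker_lin_negId_mul_sub_one, mem_ker_lin_sub_one, hx])
    (by rw [hy, one_smul])

theorem two_ne_zero_of_three (h3 : (3 : F) = 0) : (2 : F) ≠ 0 := fun h =>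
  one_ne_zero (α := F) (by linear_combination h3 - h)

theorem ProjGen.finrank_eigenspaces [Finite F] (h3 : (3 : F) = 0) {x y : Orth F}
    (h : ProjGen x y) (hx : x ^ 2 = 1) (hy : y ^ 3 = 1) :
    Module.finrank F (LinearMap.ker (lin x - 1)) = 4 ∧
      Module.finrank F (LinearMap.ker (lin (negId F * x) - 1)) = 4 := by
  have h4 := four_le_finrank_fixed h3 hy
  have h1 := finrank_le_four h.fixed_eq_zero h4
  have h2 := finrank_le_four h.fixed_eq_zero' h4
  have h5 := Submodule.finrank_add_eq_of_isCompl
    (isCompl_eigenspaces (two_ne_zero_of_three h3) hx)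
  rw [Module.finrank_fin_fun] at h5
  omega

theorem ProjGen.no_eigenvector [Finite F] (h3 : (3 : F) = 0) {x y : Orth F}
    (h : ProjGen x y) (hx : x ^ 2 = 1) (hy : y ^ 3 = 1) {v : Fin 8 → F}
    (hv : lin (x * y) v = v ∨ lin (x * y) v = -v) : v = 0 := by
  have h4 := four_le_finrank_fixed h3 hy
  obtain ⟨h1, h2⟩ := h.finrank_eigenspaces h3 hx hy
  rcases hv with hv | hv
  · exact eq_zero_of_mul_fixed h.fixed_eq_zero (by omega) hv
  · refine eq_zero_of_mul_fixed h.fixed_eq_zero' (by omega) ?_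
    rw [mul_assoc, lin_mul_apply, hv, lin_negId, neg_neg]

theorem gamma_mul_comm {u v : Fin 8 → F} (h : polar u v = 0) :
    gamma u * gamma v = -(gamma v * gamma u) := by
  have := gamma_mul_add u v
  rw [h, zero_smul] at this
  exact eq_neg_of_add_eq_zero_left this

theorem exists_scalar_of_commute_gamma {T : Module.End F ((Fin 8 → F) × (Fin 8 → F))}
    (hT : ∀ v, T * gamma v = gamma v * T) : ∃ l : F, ∀ p, T (p, 0) = (l • p, 0) := by
  have hw : ∀ L : List (Fin 8 → F), T * (L.map gamma).prod = (L.map gamma).prod * T := by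
    intro L
    induction L with
    | nil => simp
    | cons v L ih =>
      rw [List.map_cons, List.prod_cons, ← mul_assoc, hT, mul_assoc, ih, mul_assoc]
  obtain ⟨l, hl⟩ : ∃ l : F, ∀ k, T (bv F k, 0) = (l • bv F k, 0) := by
    refine ⟨(T (bv F 0, 0)).1 0, fun k => ?_⟩
    obtain ⟨L, n, d, -, hd, hX⟩ := exists_word_apply (F := F) k
    have e := LinearMap.congr_fun (hw L) (bv F 0, 0)
    rw [Module.End.mul_apply, Module.End.mul_apply, hX, bv_apply, if_pos rfl, mul_one] at e
    have e1 : ((d • bv F k, 0) : (Fin 8 → F) × (Fin 8 → F)) = d • (bv F k, 0) := by simp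
    rw [e1, map_smul, ← Prod.mk.eta (p := T (bv F 0, 0)), hX, mul_smul] at e
    have e2 : ((d • (T (bv F 0, 0)).1 0 • bv F k, 0) : (Fin 8 → F) × (Fin 8 → F)) =
      d • ((T (bv F 0, 0)).1 0 • bv F k, 0) := by simp
    rw [e2] at e
    exact smul_right_injective _ hd e
  refine ⟨l, fun p => ?_⟩
  have key : T ∘ₗ LinearMap.inl F _ _ = l • LinearMap.inl F (Fin 8 → F) (Fin 8 → F) := by
    refine (Pi.basisFun F (Fin 8)).ext fun k => ?_
    have hk : Pi.basisFun F (Fin 8) k = bv F k := by simp [bv]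
    rw [hk, LinearMap.comp_apply, LinearMap.inl_apply, hl, LinearMap.smul_apply,
      LinearMap.inl_apply, Prod.smul_mk, smul_zero]
  have := LinearMap.congr_fun key p
  rwa [LinearMap.comp_apply, LinearMap.smul_apply, LinearMap.inl_apply, Prod.smul_mk,
    smul_zero] at this

/-- An orthogonal basis of the `-1`-eigenspace of an isometric involution. -/
theorem exists_orthogonal_eigenbasis (h2 : (2 : F) ≠ 0) {x : Orth F} (hx : x ^ 2 = 1)
    (hdim : Module.finrank F (LinearMap.ker (lin (negId F * x) - 1)) = 4) :
    ∃ u : Fin 4 → Fin 8 → F, (∀ i, lin x (u i) = -u i) ∧ (∀ i j, i ≠ j → polar (u i) (u j) = 0) ∧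
      (∀ i, QPlus F (u i) ≠ 0) ∧
      LinearMap.ker (lin (negId F * x) - 1) ≤ Submodule.span F (Set.range u) := by
  let U := LinearMap.ker (lin (negId F * x) - 1)
  let B : LinearMap.BilinForm F U := LinearMap.mk₂ F (fun u v => polar (u : Fin 8 → F) v)
    (fun u v w => polar_add_left _ _ _) (fun c u w => polar_smul_left _ _ _)
    (fun u v w => polar_add_right _ _ _) (fun c u w => polar_smul_right _ _ _)
  haveI := invertibleOfNonzero h2
  obtain ⟨b, hb⟩ := LinearMap.BilinForm.exists_orthogonal_basis (B := B)
    ⟨fun u v => polar_comm (u : Fin 8 → F) v⟩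
  let b' := b.reindex (finCongr hdim)
  have hb' : ∀ i j, i ≠ j → polar (b' i : Fin 8 → F) (b' j) = 0 := by
    intro i j hij
    simp only [b', Module.Basis.reindex_apply]
    exact hb (fun h => hij ((finCongr hdim).symm.injective h))
  have hmem : ∀ i, lin x (b' i : Fin 8 → F) = -(b' i : Fin 8 → F) := fun i =>
    mem_ker_lin_negId_mul_sub_one.1 (b' i).2
  have hspan : U ≤ Submodule.span F (Set.range fun i => (b' i : Fin 8 → F)) := by
    intro v hv
    have h1 : (⟨v, hv⟩ : U) ∈ Submodule.span F (Set.range b') := b'.mem_span _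
    have h3 := Submodule.mem_map_of_mem (f := U.subtype) h1
    rw [Submodule.map_span, ← Set.range_comp] at h3
    exact h3
  refine ⟨fun i => (b' i : Fin 8 → F), hmem, hb', fun i hi => ?_, hspan⟩
  have h0 : (b' i : Fin 8 → F) = 0 := by
    apply eq_zero_of_polar
    intro w
    obtain ⟨a, ha, c, hc, rfl⟩ := Submodule.mem_sup.1
      ((isCompl_eigenspaces h2 hx).sup_eq_top.ge (Submodule.mem_top (x := w)))
    have e1 : polar (b' i : Fin 8 → F) a = 0 := by
      have h := polar_lin x (b' i : Fin 8 → F) a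
      rw [hmem, mem_ker_lin_sub_one.1 ha, polar_neg_left] at h
      have h' : (2 : F) * polar (b' i : Fin 8 → F) a = 0 := by linear_combination -h
      exact (mul_eq_zero.1 h').resolve_left h2
    have e2 : polar (b' i : Fin 8 → F) c = 0 := by
      have hc' := hspan hc
      clear hc
      induction hc' using Submodule.span_induction with
      | mem z hz =>
        obtain ⟨j, rfl⟩ := hz
        rcases eq_or_ne i j with rfl | hij
        · rw [polar_self, hi, mul_zero]
        · exact hb' i j hij
      | zero => exact polar_zero_right _
      | add z z' _ _ hz hz' => rw [polar_add_right, hz, hz', add_zero]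
      | smul d z _ hz => rw [polar_smul_right, hz, mul_zero]
    rw [polar_add_right, e1, e2, add_zero]
  exact b'.ne_zero i (Subtype.ext h0)

end OmegaEight

namespace OmegaEight

variable {F : Type*} [Field F]

theorem end_mul_neg {M : Type*} [AddCommGroup M] [Module F M] (X Y : Module.End F M) :
    X * -Y = -(X * Y) := LinearMap.ext fun v => by simp

theorem end_neg_mul {M : Type*} [AddCommGroup M] [Module F M] (X Y : Module.End F M) :
    -X * Y = -(X * Y) := LinearMap.ext fun v => by simp

theorem end_neg_mul_neg {M : Type*} [AddCommGroup M] [Module F M] (X Y : Module.End F M) :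
    -X * -Y = X * Y := LinearMap.ext fun v => by simp

theorem gamma_pair_comm {u u' v : Fin 8 → F} (h : polar u v = 0) (h' : polar u' v = 0) :
    gamma u * gamma u' * gamma v = gamma v * (gamma u * gamma u') := by
  rw [mul_assoc, gamma_mul_comm h', end_mul_neg, ← mul_assoc, gamma_mul_comm h, end_neg_mul, neg_neg,
    mul_assoc]

theorem gamma_pair_anti_left {u u' : Fin 8 → F} (h : polar u u' = 0) :
    gamma u * gamma u' * gamma u = -(gamma u * (gamma u * gamma u')) := by
  rw [mul_assoc, gamma_mul_comm (u := u') (v := u) (by rw [polar_comm, h]), end_mul_neg]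

theorem gamma_pair_anti_right {u u' : Fin 8 → F} (h : polar u u' = 0) :
    gamma u * gamma u' * gamma u' = -(gamma u' * (gamma u * gamma u')) := by
  rw [← mul_assoc, gamma_mul_comm (u := u') (v := u) (by rw [polar_comm, h]), end_neg_mul, neg_neg]

theorem gamma_pair_sq {u u' : Fin 8 → F} (h : polar u u' = 0) :
    gamma u * gamma u' * (gamma u * gamma u') = -((QPlus F u * QPlus F u') • 1) := by
  rw [← mul_assoc, gamma_pair_anti_left h, ← mul_assoc, gamma_mul_self, end_neg_mul, smul_mul_assoc,
    one_mul, smul_mul_assoc, gamma_mul_self, smul_smul]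

/-- In a compatible triple whose last component is an involution with a four-dimensional
`-1`-eigenspace, the first component is an involution, too. -/
theorem IsTrial.sq_eq_one (h2 : (2 : F) ≠ 0) {s₁ s₂ x : Orth F} (ht : IsTrial s₁ s₂ x)
    (hx : x ^ 2 = 1) (hdim : Module.finrank F (LinearMap.ker (lin (negId F * x) - 1)) = 4) :
    s₁ ^ 2 = 1 := by
  obtain ⟨u, hu, ho, hQ, hspan⟩ := exists_orthogonal_eigenbasis h2 hx hdim
  have hs : ∀ v, spin s₁ s₂ * gamma v = gamma (lin x v) * spin s₁ s₂ := ht.spin_mul_gamma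
  have o : ∀ i j, i ≠ j → polar (u i) (u j) = 0 := ho
  let A := gamma (u 0) * gamma (u 1)
  let B := gamma (u 2) * gamma (u 3)
  let s := spin s₁ s₂
  have hsu : ∀ i j, s * (gamma (u i) * gamma (u j)) = gamma (u i) * gamma (u j) * s := by
    intro i j
    rw [← mul_assoc, hs, hu, mul_assoc, hs, hu, ← mul_assoc, map_neg, map_neg, end_neg_mul_neg]
  have hA : A * A = -((QPlus F (u 0) * QPlus F (u 1)) • 1) := gamma_pair_sq (o 0 1 (by decide))
  have hB : B * B = -((QPlus F (u 2) * QPlus F (u 3)) • 1) := gamma_pair_sq (o 2 3 (by decide))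
  have hAB : A * B = B * A := by
    change A * (gamma (u 2) * gamma (u 3)) = _
    rw [← mul_assoc, gamma_pair_comm (o 0 2 (by decide)) (o 1 2 (by decide)), mul_assoc,
      gamma_pair_comm (o 0 3 (by decide)) (o 1 3 (by decide)), ← mul_assoc]
  have anti : ∀ i, A * B * gamma (u i) = -(gamma (u i) * (A * B)) := by
    intro i
    fin_cases i
    · change A * B * gamma (u 0) = -(gamma (u 0) * (A * B))
      rw [mul_assoc, gamma_pair_comm (o 2 0 (by decide)) (o 3 0 (by decide)), ← mul_assoc,
        gamma_pair_anti_left (o 0 1 (by decide)), end_neg_mul, mul_assoc]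
    · change A * B * gamma (u 1) = -(gamma (u 1) * (A * B))
      rw [mul_assoc, gamma_pair_comm (o 2 1 (by decide)) (o 3 1 (by decide)), ← mul_assoc,
        gamma_pair_anti_right (o 0 1 (by decide)), end_neg_mul, mul_assoc]
    · change A * B * gamma (u 2) = -(gamma (u 2) * (A * B))
      rw [mul_assoc, gamma_pair_anti_left (o 2 3 (by decide)), end_mul_neg, ← mul_assoc,
        gamma_pair_comm (o 0 2 (by decide)) (o 1 2 (by decide)), mul_assoc]
    · change A * B * gamma (u 3) = -(gamma (u 3) * (A * B))
      rw [mul_assoc, gamma_pair_anti_right (o 2 3 (by decide)), end_mul_neg, ← mul_assoc,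
        gamma_pair_comm (o 0 3 (by decide)) (o 1 3 (by decide)), mul_assoc]
  have hcomm : ∀ v, s * (A * B) * gamma v = gamma v * (s * (A * B)) := by
    have hneg : ∀ v ∈ Submodule.span F (Set.range u),
        s * (A * B) * gamma v = gamma v * (s * (A * B)) := by
      intro v hv
      induction hv using Submodule.span_induction with
      | mem z hz =>
        obtain ⟨i, rfl⟩ := hz
        rw [mul_assoc, anti, end_mul_neg, ← mul_assoc, hs, hu, map_neg, end_neg_mul, end_neg_mul, neg_neg,
          mul_assoc]
      | zero => simp
      | add z z' _ _ hz hz' => rw [map_add, mul_add, add_mul, hz, hz']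
      | smul d z _ hz => rw [map_smul, mul_smul_comm, smul_mul_assoc, hz]
    intro v
    obtain ⟨a, ha, c, hc, rfl⟩ := Submodule.mem_sup.1
      ((isCompl_eigenspaces h2 hx).sup_eq_top.ge (Submodule.mem_top (x := v)))
    have ha' : lin x a = a := mem_ker_lin_sub_one.1 ha
    have hua : ∀ i, polar (u i) a = 0 := by
      intro i
      have h := polar_lin x (u i) a
      rw [hu, ha', polar_neg_left] at h
      have h' : (2 : F) * polar (u i) a = 0 := by linear_combination -h
      exact (mul_eq_zero.1 h').resolve_left h2
    have e : s * (A * B) * gamma a = gamma a * (s * (A * B)) := by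
      rw [mul_assoc, mul_assoc, gamma_pair_comm (hua 2) (hua 3), ← mul_assoc A,
        gamma_pair_comm (hua 0) (hua 1), mul_assoc (gamma a), ← mul_assoc s, hs, ha', mul_assoc]
    rw [map_add, mul_add, add_mul, e, hneg c (hspan hc)]
  obtain ⟨l, hl⟩ := exists_scalar_of_commute_gamma hcomm
  let P := QPlus F (u 0) * QPlus F (u 1) * (QPlus F (u 2) * QPlus F (u 3))
  have hP : P ≠ 0 := mul_ne_zero (mul_ne_zero (hQ 0) (hQ 1)) (mul_ne_zero (hQ 2) (hQ 3))
  have hnorm : l ^ 2 = P := by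
    have e := congrArg (fun z => QPlus F z.1) (hl (bv F 0 + bv F 4))
    have hq : QPlus F (bv F 0 + bv F 4) = 1 := by simp [QPlus, bv_apply]
    simp only [s, A, B, Module.End.mul_apply, gamma_apply, star_zero_left, star_zero_right,
      spin_apply, QPlus_lin, QPlus_star, QPlus_smul, hq] at e
    linear_combination -e
  refine lin_ext fun p => ?_
  have hTT : s * (A * B) * (s * (A * B)) = P • (s * s) := by
    have hsAB : s * (A * B) = A * B * s := by
      rw [← mul_assoc, hsu, mul_assoc, hsu, ← mul_assoc]
    have : A * B * (A * B) = P • 1 := by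
      rw [mul_assoc, ← mul_assoc B, ← hAB, mul_assoc A B B, ← mul_assoc, hA, hB, end_neg_mul_neg,
        smul_mul_assoc, one_mul, smul_smul]
    calc s * (A * B) * (s * (A * B)) = s * (A * B * s) * (A * B) := by simp only [mul_assoc]
      _ = s * s * (A * B * (A * B)) := by rw [← hsAB]; simp only [mul_assoc]
      _ = P • (s * s) := by rw [this, mul_smul_comm, mul_one]
  have e := LinearMap.congr_fun hTT (p, 0)
  rw [Module.End.mul_apply, hl, hl, smul_smul, ← pow_two, hnorm, LinearMap.smul_apply,
    Module.End.mul_apply, spin_apply, spin_apply] at e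
  have e' : P • p = P • lin s₁ (lin s₁ p) := congrArg Prod.fst e
  rw [pow_two, lin_mul_apply, lin_one_apply]
  exact (smul_right_injective _ hP e').symm

theorem GenTriple.sq_eq_one [Finite F] (h3 : (3 : F) = 0) {x₁ x₂ x₃ y₁ y₂ y₃ : Orth F}
    (h : GenTriple x₁ x₂ x₃ y₁ y₂ y₃) (hx : x₃ ^ 2 = 1) : x₁ ^ 2 = 1 :=
  h.trial_x.sq_eq_one (two_ne_zero_of_three h3) hx (h.gen.finrank_eigenspaces h3 hx h.cube₃).2

theorem GenTriple.sq_eq_one_of_card_three [Finite F] (h3 : (3 : F) = 0)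
    {x₁ x₂ x₃ y₁ y₂ y₃ : Orth F} (h : GenTriple x₁ x₂ x₃ y₁ y₂ y₃) : x₃ ^ 2 = 1 := by
  have key : ∀ {g : Orth F} {c : F}, (∀ v, lin g v = c • v) → c = 1 → g = 1 := fun hg hc =>
    lin_ext fun v => by rw [hg, hc, one_smul, lin_one_apply]
  obtain ⟨c, hc2, hc⟩ := exists_scalar_of_mem_center h.sq₃
  obtain ⟨l, hl2, hl₁, hl₂⟩ := (h.trial_x.pow 2).scalar hc hc2
  rcases sq_eq_one_iff.1 hc2 with hc1 | hc1
  · exact key hc hc1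
  rcases sq_eq_one_iff.1 hl2 with hl1 | hl1
  · exact h.rotate.rotate.sq_eq_one h3 (h.rotate.sq_eq_one h3 (key hl₁ hl1))
  · exact h.rotate.rotate.sq_eq_one h3 (key hl₂ (by rw [hc1, hl1]; ring))

theorem GenTriple.trace_sq_ne [Finite F] (h3 : (3 : F) = 0)
    {x₁ x₂ x₃ y₁ y₂ y₃ : Orth F} (h : GenTriple x₁ x₂ x₃ y₁ y₂ y₃) :
    (LinearMap.trace F _ (lin (x₁ * y₁))) ^ 2 ≠ (LinearMap.trace F _ (lin (x₂ * y₂))) ^ 2 := by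
  intro e
  have hw := h.trial_x.mul h.trial_y
  have hno := fun {v} => h.gen.no_eigenvector (v := v) h3 (h.sq_eq_one_of_card_three h3) h.cube₃
  rcases sq_eq_sq_iff_eq_or_eq_neg.1 e with e | e
  · obtain ⟨v, hv0, hv⟩ := hw.exists_fixed e
    exact hv0 (hno (Or.inl hv))
  · obtain ⟨v, hv0, hv⟩ := hw.exists_eigenvector (by rw [e, neg_add_cancel])
    exact hv0 (hno (Or.inr hv))

theorem not_genTriple_of_card_three [Fintype F] (hq : Fintype.card F = 3)
    {x₁ x₂ x₃ y₁ y₂ y₃ : Orth F} (h : GenTriple x₁ x₂ x₃ y₁ y₂ y₃) : False := by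
  have h3 : (3 : F) = 0 := by
    have := Nat.cast_card_eq_zero F
    rw [hq] at this
    exact_mod_cast this
  have hsq : ∀ t : F, t ^ 2 = 0 ∨ t ^ 2 = 1 := by
    intro t
    rcases eq_or_ne t 0 with rfl | ht
    · simp
    · right
      have := FiniteField.pow_card_sub_one_eq_one t ht
      rwa [hq] at this
  have h12 := h.trace_sq_ne h3
  have h23 := h.rotate.trace_sq_ne h3
  have h31 := h.rotate.rotate.trace_sq_ne h3
  rcases hsq (LinearMap.trace F _ (lin (x₁ * y₁))) with e1 | e1 <;>
  rcases hsq (LinearMap.trace F _ (lin (x₂ * y₂))) with e2 | e2 <;>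
  rcases hsq (LinearMap.trace F _ (lin (x₃ * y₃))) with e3 | e3 <;>
  first
  | exact h12 (e1.trans e2.symm)
  | exact h23 (e2.trans e3.symm)
  | exact h31 (e3.trans e1.symm)

end OmegaEight

namespace OmegaEight

/-- Bit `n` of this number is the value at `n` of the form `codeForm_eq` on `{0, 1}⁸`. -/
def formTable : ℕ := 0x111e111e111eeee1111e111e111eeee1111e111e111eeee1eee1eee1eee1111e

/-- A quadratic form on eight-bit numbers, added by exclusive or. -/
def codeForm (n : ℕ) : ℕ := (formTable >>> n) &&& 1

/-- An isometry of order three of `codeForm`. -/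
def codeRot (n : ℕ) : ℕ :=
  (n &&& 192) ||| ((n >>> 1) &&& 21) ||| (((n ^^^ (n >>> 1)) &&& 21) <<< 1)

/-- Evaluates the argument before passing it on, which keeps kernel reduction fast. -/
def force {α : Type} (n : ℕ) (f : ℕ → α) : α :=
  match n with
  | 0 => f 0
  | k + 1 => f (k + 1)

/-- Reduces `z` by the left components of `m`, changing `r` by the right components. -/
def evalStep : List (ℕ × ℕ) → ℕ → ℕ → ℕ × ℕ
  | [], z, r => (z, r)
  | (a, b) :: m, z, r =>
    force (z ^^^ a) fun z' =>
      bif Nat.blt z' z then force (r ^^^ b) fun r' => evalStep m z' r' else evalStep m z r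

/-- Extends the partial additive map `m` by `z ↦ r`. -/
def learn (m : List (ℕ × ℕ)) (z r : ℕ) : List (ℕ × ℕ) :=
  match evalStep m z r with
  | (0, _) => m
  | (a + 1, b) => m ++ [(a + 1, b)]

/-- A necessary condition for `m` to extend to an isometric involution with `z ↦ r`. -/
def admissible (m : List (ℕ × ℕ)) (z r : ℕ) : Bool :=
  Nat.beq (codeForm r) (codeForm z) &&
    (m.all fun p => Nat.beq (codeForm (r ^^^ p.2)) (codeForm (z ^^^ p.1))) &&
    match evalStep m r 0 with
    | (0, s) => Nat.beq s z
    | _ => true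

/-- Adds `n` to the bit set `S` of size `c` and to the queue `q`, unless it is present. -/
def visit (n : ℕ) (S : ℕ) (q : List ℕ) (c : ℕ) {α : Type} (f : ℕ → List ℕ → ℕ → α) : α :=
  bif Nat.beq ((S >>> n) &&& 1) 1 then f S q c
  else force (S ||| (1 <<< n)) fun S' => force (c + 1) fun c' => f S' (n :: q) c'

/-- Verifies that, for each isometric involution extending `m`, the orbit search starting from
the bit set `S` of size `c` with queue `q` ends with fewer than `bound` elements. -/
def orbitSearch (bound : ℕ) : ℕ → List (ℕ × ℕ) → ℕ → List ℕ → ℕ → Bool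
  | 0, _, _, _, _ => false
  | _ + 1, _, _, [], c => Nat.blt c bound
  | k + 1, m, S, z :: q, c =>
    match evalStep m z 0 with
    | (0, r) => force r fun r => force (codeRot z) fun s =>
        visit s S q c fun S q c => visit r S q c fun S q c => orbitSearch bound k m S q c
    | (_ + 1, _) => (List.range 256).all fun r => !(admissible m z r) ||
        orbitSearch bound k (learn (learn m z r) r z) S (z :: q) c

/-- The partial map swapping `v` with its rotation `u`, and `p` with the rotation of `u`. -/
def startMap (v p : ℕ) : List (ℕ × ℕ) :=
  learn (learn (learn (learn [] v (codeRot v)) (codeRot v) v)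
    (codeRot (codeRot v)) p) p (codeRot (codeRot v))

def runSearch (bound v p : ℕ) : Bool :=
  orbitSearch bound 200 (startMap v p) (1 <<< v) [v] 1

theorem force_eq {α : Type} (n : ℕ) (f : ℕ → α) : force n f = f n := by
  cases n <;> rfl

theorem codeRot_lt {n : ℕ} (h : n < 256) : codeRot n < 256 := by
  have : ∀ n < 256, codeRot n < 256 := by decide +kernel
  exact this n h

theorem xor_lt {m n : ℕ} (hm : m < 256) (hn : n < 256) : m ^^^ n < 256 :=
  Nat.xor_lt_two_pow (n := 8) hm hn

/-- An isometric involution of the space of eight-bit numbers. -/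
structure CodeInvolution (X : ℕ → ℕ) : Prop where
  lt : ∀ n < 256, X n < 256
  xor : ∀ m < 256, ∀ n < 256, X (m ^^^ n) = X m ^^^ X n
  form : ∀ n < 256, codeForm (X n) = codeForm n
  invol : ∀ n < 256, X (X n) = n

theorem CodeInvolution.zero {X : ℕ → ℕ} (hX : CodeInvolution X) : X 0 = 0 := by
  simpa using hX.xor 0 (by norm_num) 0 (by norm_num)

/-- The pairs in `m` belong to the graph of `X`. -/
def Agrees (X : ℕ → ℕ) (m : List (ℕ × ℕ)) : Prop :=
  ∀ p ∈ m, p.1 < 256 ∧ p.2 < 256 ∧ X p.1 = p.2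

theorem evalStep_spec {X : ℕ → ℕ} (hX : CodeInvolution X) {m : List (ℕ × ℕ)} (hm : Agrees X m)
    {z r : ℕ} (hz : z < 256) (hr : r < 256) :
    (evalStep m z r).1 < 256 ∧ (evalStep m z r).2 < 256 ∧
      X (evalStep m z r).1 ^^^ (evalStep m z r).2 = X z ^^^ r := by
  induction m generalizing z r with
  | nil => exact ⟨hz, hr, rfl⟩
  | cons p m ih =>
    obtain ⟨a, b⟩ := p
    obtain ⟨ha, hb, hab⟩ := hm (a, b) (by simp)
    have hm' : Agrees X m := fun p hp => hm p (List.mem_cons_of_mem _ hp)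
    simp only [evalStep, force_eq]
    cases Nat.blt (z ^^^ a) z with
    | false => exact ih hm' hz hr
    | true =>
      obtain ⟨h1, h2, h3⟩ := ih hm' (xor_lt hz ha) (xor_lt hr hb)
      refine ⟨h1, h2, h3.trans ?_⟩
      rw [hX.xor z hz a ha, hab]
      rw [Nat.xor_comm r b, Nat.xor_assoc, ← Nat.xor_assoc b, Nat.xor_self, Nat.zero_xor]

theorem evalStep_zero {X : ℕ → ℕ} (hX : CodeInvolution X) {m : List (ℕ × ℕ)} (hm : Agrees X m)
    {z r : ℕ} (hz : z < 256) (h : evalStep m z 0 = (0, r)) : X z = r := by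
  have := (evalStep_spec hX hm hz (r := 0) (by norm_num)).2.2
  rw [h, hX.zero, Nat.zero_xor, Nat.xor_zero] at this
  exact this.symm

theorem Agrees.learn {X : ℕ → ℕ} (hX : CodeInvolution X) {m : List (ℕ × ℕ)} (hm : Agrees X m)
    {z r : ℕ} (hz : z < 256) (hr : r < 256) (h : X z = r) : Agrees X (learn m z r) := by
  obtain ⟨h1, h2, h3⟩ := evalStep_spec hX hm hz hr
  rw [h, Nat.xor_self] at h3
  unfold OmegaEight.learn
  split
  · exact hm
  · rename_i a b e
    rw [e] at h1 h2 h3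
    intro p hp
    rcases List.mem_append.1 hp with hp | hp
    · exact hm p hp
    · rw [List.mem_singleton.1 hp]
      exact ⟨h1, h2, Nat.xor_eq_zero_iff.1 h3⟩

theorem admissible_apply {X : ℕ → ℕ} (hX : CodeInvolution X) {m : List (ℕ × ℕ)}
    (hm : Agrees X m) {z : ℕ} (hz : z < 256) : admissible m z (X z) = true := by
  have hr := hX.lt z hz
  simp only [admissible, Bool.and_eq_true, List.all_eq_true, Nat.beq_eq]
  refine ⟨⟨hX.form z hz, fun p hp => ?_⟩, ?_⟩
  · obtain ⟨h1, h2, h3⟩ := hm p hp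
    rw [← h3, ← hX.xor z hz _ h1, hX.form _ (xor_lt hz h1)]
  · split
    · rename_i s e
      rw [← evalStep_zero hX hm hr e, hX.invol z hz]
      simp
    · rfl

/-- The bit set `S` represents `T`. -/
def Represents (S : ℕ) (T : Finset ℕ) : Prop := ∀ n, n ∈ T ↔ S.testBit n = true

theorem Represents.insert {S : ℕ} {T : Finset ℕ} (h : Represents S T) (n : ℕ) :
    Represents (S ||| (1 <<< n)) (insert n T) := by
  intro k
  rw [Finset.mem_insert, h k, Nat.testBit_or, Nat.one_shiftLeft, Nat.testBit_two_pow,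
    Bool.or_eq_true, decide_eq_true_eq, or_comm, eq_comm (a := k)]

theorem Represents.beq_iff {S : ℕ} {T : Finset ℕ} (h : Represents S T) (n : ℕ) :
    Nat.beq ((S >>> n) &&& 1) 1 = true ↔ n ∈ T := by
  rw [h n, Nat.beq_eq, Nat.testBit, Nat.land_comm]
  have := Nat.one_and_eq_mod_two (S >>> n)
  rw [this]
  rcases Nat.mod_two_eq_zero_or_one (S >>> n) with h | h <;> simp [h]

/-- The invariant of the orbit search. -/
structure Explored (X : ℕ → ℕ) (T : Finset ℕ) (S : ℕ) (q : List ℕ) (c : ℕ) : Prop where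
  rep : Represents S T
  card : T.card = c
  lt : ∀ n ∈ T, n < 256
  queue : ∀ n ∈ q, n ∈ T
  closed : ∀ n ∈ T, n ∈ q ∨ codeRot n ∈ T ∧ X n ∈ T

/-- The invariant of the orbit search while the neighbours of `z` are being added. -/
structure Exploring (X : ℕ → ℕ) (z : ℕ) (T : Finset ℕ) (S : ℕ) (q : List ℕ) (c : ℕ) : Prop where
  rep : Represents S T
  card : T.card = c
  lt : ∀ n ∈ T, n < 256
  queue : ∀ n ∈ q, n ∈ T
  closed : ∀ n ∈ T, n = z ∨ n ∈ q ∨ codeRot n ∈ T ∧ X n ∈ T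

theorem Exploring.visit {X : ℕ → ℕ} {z : ℕ} {T : Finset ℕ} {S : ℕ} {q : List ℕ} {c : ℕ}
    (h : Exploring X z T S q c) {n : ℕ} (hn : n < 256) {f : ℕ → List ℕ → ℕ → Bool}
    (hf : visit n S q c f = true) :
    ∃ T' S' q' c', T ⊆ T' ∧ n ∈ T' ∧ Exploring X z T' S' q' c' ∧ f S' q' c' = true := by
  unfold OmegaEight.visit at hf
  by_cases hT : n ∈ T
  · rw [(h.rep.beq_iff n).2 hT, cond_true] at hf
    exact ⟨T, S, q, c, subset_rfl, hT, h, hf⟩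
  · rw [Bool.eq_false_iff.2 (mt (h.rep.beq_iff n).1 hT), cond_false, force_eq, force_eq] at hf
    refine ⟨insert n T, _, _, _, Finset.subset_insert n T, Finset.mem_insert_self n T,
      ⟨h.rep.insert n, ?_, ?_, ?_, ?_⟩, hf⟩
    · rw [Finset.card_insert_of_notMem hT, h.card]
    · intro k hk
      rcases Finset.mem_insert.1 hk with rfl | hk
      exacts [hn, h.lt k hk]
    · intro k hk
      rcases List.mem_cons.1 hk with rfl | hk
      exacts [Finset.mem_insert_self _ _, Finset.mem_insert_of_mem (h.queue k hk)]
    · intro k hk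
      rcases Finset.mem_insert.1 hk with rfl | hk
      · exact Or.inr (Or.inl List.mem_cons_self)
      · rcases h.closed k hk with h1 | h1 | ⟨h1, h2⟩
        · exact Or.inl h1
        · exact Or.inr (Or.inl (List.mem_cons_of_mem _ h1))
        · exact Or.inr (Or.inr ⟨Finset.mem_insert_of_mem h1, Finset.mem_insert_of_mem h2⟩)

theorem orbitSearch_spec {X : ℕ → ℕ} (hX : CodeInvolution X) (bound k : ℕ)
    {m : List (ℕ × ℕ)} (hm : Agrees X m) {T : Finset ℕ} {S : ℕ} {q : List ℕ} {c : ℕ}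
    (hT : Explored X T S q c) (h : orbitSearch bound k m S q c = true) :
    ∃ T' : Finset ℕ, T ⊆ T' ∧ T'.card < bound ∧
      ∀ n ∈ T', n < 256 ∧ codeRot n ∈ T' ∧ X n ∈ T' := by
  induction k generalizing m T S q c with
  | zero => simp [orbitSearch] at h
  | succ k ih =>
    cases q with
    | nil =>
      refine ⟨T, subset_rfl, ?_, fun n hn =>
        ⟨hT.lt n hn, (hT.closed n hn).resolve_left (by simp)⟩⟩
      rw [hT.card]
      exact Nat.blt_eq.mp h
    | cons z q =>
      have hzT := hT.queue z List.mem_cons_self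
      have hz := hT.lt z hzT
      rw [orbitSearch] at h
      split at h
      · rename_i r e
        have hXz := evalStep_zero hX hm hz e
        rw [force_eq, force_eq] at h
        have hE : Exploring X z T S q c :=
          ⟨hT.rep, hT.card, hT.lt, fun n hn => hT.queue n (List.mem_cons_of_mem _ hn),
            fun n hn => by
              rcases hT.closed n hn with h | h
              · rcases List.mem_cons.1 h with h | h
                exacts [Or.inl h, Or.inr (Or.inl h)]
              · exact Or.inr (Or.inr h)⟩
        obtain ⟨T₁, S₁, q₁, c₁, hs₁, hn₁, hE₁, h₁⟩ := hE.visit (codeRot_lt hz) h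
        obtain ⟨T₂, S₂, q₂, c₂, hs₂, hn₂, hE₂, h₂⟩ :=
          hE₁.visit (by rw [← hXz]; exact hX.lt z hz) h₁
        obtain ⟨T', hT', hc⟩ := ih hm ⟨hE₂.rep, hE₂.card, hE₂.lt, hE₂.queue, fun n hn => by
          rcases hE₂.closed n hn with rfl | h
          · exact Or.inr ⟨hs₂ hn₁, by rw [hXz]; exact hn₂⟩
          · exact h⟩ h₂
        exact ⟨T', (hs₁.trans hs₂).trans hT', hc⟩
      · have hr := hX.lt z hz
        have h' := List.all_eq_true.1 h (X z) (List.mem_range.2 hr)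
        rw [admissible_apply hX hm hz, Bool.not_true, Bool.false_or] at h'
        exact ih ((hm.learn hX hz hr rfl).learn hX hr hz (hX.invol z hz)) hT h'

theorem runSearch_spec {X : ℕ → ℕ} (hX : CodeInvolution X) {bound v p : ℕ} (hv : v < 256)
    (hXv : X v = codeRot v) (hXp : X (codeRot (codeRot v)) = p)
    (h : runSearch bound v p = true) :
    ∃ T : Finset ℕ, v ∈ T ∧ T.card < bound ∧ ∀ n ∈ T, n < 256 ∧ codeRot n ∈ T ∧ X n ∈ T := by
  have hu := codeRot_lt hv
  have hz := codeRot_lt hu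
  have hp : p < 256 := hXp ▸ hX.lt _ hz
  have hm : Agrees X (startMap v p) := by
    refine Agrees.learn hX (Agrees.learn hX (Agrees.learn hX (Agrees.learn hX ?_ hv hu hXv) hu hv
      ?_) hz hp hXp) hp hz ?_
    · intro p hp
      simp at hp
    · rw [← hXv, hX.invol v hv]
    · rw [← hXp, hX.invol _ hz]
  obtain ⟨T, hT, hc, hcl⟩ := orbitSearch_spec hX bound 200 hm (T := {v}) (S := 1 <<< v) (q := [v])
    (c := 1) ⟨fun n => by
      rw [Finset.mem_singleton, Nat.one_shiftLeft, Nat.testBit_two_pow, decide_eq_true_eq, eq_comm],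
      Finset.card_singleton v, by simpa using hv, by simp, by simp⟩ h
  exact ⟨T, hT (Finset.mem_singleton_self v), hc, hcl⟩

set_option maxRecDepth 100000 in
theorem runSearch_eq_true : runSearch 135 65 7 = true ∧ runSearch 135 65 87 = true ∧
    runSearch 135 65 132 = true ∧ runSearch 120 69 16 = true ∧ runSearch 120 69 134 = true := by
  decide +kernel

/-- The additive map on numbers with the given images of the powers of two. -/
def codeMap : List ℕ → ℕ → ℕ
  | [], _ => 0
  | a :: l, n => (if n.testBit 0 then a else 0) ^^^ codeMap l (n >>> 1)

theorem codeMap_xor (l : List ℕ) (m n : ℕ) :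
    codeMap l (m ^^^ n) = codeMap l m ^^^ codeMap l n := by
  induction l generalizing m n with
  | nil => simp [codeMap]
  | cons a l ih =>
    rw [codeMap, codeMap, codeMap, Nat.shiftRight_xor_distrib, ih, Nat.testBit_xor]
    cases m.testBit 0 <;> cases n.testBit 0 <;>
      simp only [Bool.bne_false, Bool.bne_true, Bool.not_true, Bool.not_false, if_true,
        Bool.false_eq_true, if_false, Nat.zero_xor]
    · ac_rfl
    · ac_rfl
    · rw [show a ^^^ codeMap l (m >>> 1) ^^^ (a ^^^ codeMap l (n >>> 1)) =
        (a ^^^ a) ^^^ (codeMap l (m >>> 1) ^^^ codeMap l (n >>> 1)) by ac_rfl, Nat.xor_self,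
        Nat.zero_xor]

end OmegaEight

namespace OmegaEight

variable {F : Type*} [Field F]

/-- A bit as an element of a field. -/
def bitVal (b : Bool) : F := bif b then 1 else 0

theorem bitVal_xor (h2 : (2 : F) = 0) (a b : Bool) :
    (bitVal (a ^^ b) : F) = bitVal a + bitVal b := by
  cases a <;> cases b <;> simp [bitVal, one_add_one_eq_two, h2]

theorem bitVal_and (a b : Bool) : (bitVal (a && b) : F) = bitVal a * bitVal b := by
  cases a <;> cases b <;> simp [bitVal]

theorem bitVal_sq (a : Bool) : (bitVal a : F) ^ 2 = bitVal a := by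
  cases a <;> simp [bitVal]

theorem bitVal_inj {a b : Bool} : (bitVal a : F) = bitVal b ↔ a = b := by
  cases a <;> cases b <;> simp [bitVal]

/-- The linear combination of `e` whose coefficients are the bits of `n`. -/
def enc (e : Fin 8 → Fin 8 → F) (n : ℕ) : Fin 8 → F :=
  ∑ i : Fin 8, (bitVal (n.testBit i) : F) • e i

theorem enc_xor (h2 : (2 : F) = 0) (e : Fin 8 → Fin 8 → F) (m n : ℕ) :
    enc e (m ^^^ n) = enc e m + enc e n := by
  simp only [enc, ← Finset.sum_add_distrib, ← add_smul, ← bitVal_xor h2, Nat.testBit_xor]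

/-- The other member of a pair of consecutive indices. -/
def partner : Fin 8 → Fin 8 := ![1, 0, 3, 2, 5, 4, 7, 6]

/-- A basis consisting of mutually orthogonal pairs. -/
structure PairBasis (e : Fin 8 → Fin 8 → F) (s : Fin 8 → Bool) : Prop where
  form : ∀ i, QPlus F (e i) = bitVal (s i)
  polar_eq : ∀ i j, polar (e i) (e j) = if j = partner i then 1 else 0

/-- The quadratic form in the coordinates of a `PairBasis`. -/
def pairForm (s : Fin 8 → Bool) (n : ℕ) : Bool :=
  ((s 0 && n.testBit 0) ^^ (s 1 && n.testBit 1) ^^ (n.testBit 0 && n.testBit 1)) ^^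
  ((s 2 && n.testBit 2) ^^ (s 3 && n.testBit 3) ^^ (n.testBit 2 && n.testBit 3)) ^^
  ((s 4 && n.testBit 4) ^^ (s 5 && n.testBit 5) ^^ (n.testBit 4 && n.testBit 5)) ^^
  ((s 6 && n.testBit 6) ^^ (s 7 && n.testBit 7) ^^ (n.testBit 6 && n.testBit 7))

namespace PairBasis

variable {e : Fin 8 → Fin 8 → F} {s : Fin 8 → Bool}

theorem QPlus_enc (h2 : (2 : F) = 0) (h : PairBasis e s) (n : ℕ) :
    QPlus F (enc e n) = bitVal (pairForm s n) := by
  simp only [enc, Fin.sum_univ_eight, QPlus_add, QPlus_smul, polar_add_left, polar_smul_left,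
    polar_smul_right, h.form, h.polar_eq, pairForm, bitVal_xor h2, bitVal_and, bitVal_sq]
  simp [partner]
  ring

theorem polar_enc (h : PairBasis e s) (n : ℕ) (i : Fin 8) :
    polar (enc e n) (e (partner i)) = bitVal (n.testBit i) := by
  have hp : ∀ i j : Fin 8, partner i = partner j ↔ i = j := by decide
  have : ∀ c : Fin 8 → F, polar (∑ i, c i • e i) (e (partner i)) = c i := by
    intro c
    have hs : polar (∑ i, c i • e i) (e (partner i)) = ∑ j, c j * polar (e j) (e (partner i)) := by
      simp only [Fin.sum_univ_eight, polar_add_left, polar_smul_left]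
    rw [hs, Finset.sum_eq_single i]
    · rw [h.polar_eq, if_pos rfl, mul_one]
    · intro j _ hj
      rw [h.polar_eq, if_neg (by rwa [hp, eq_comm]), mul_zero]
    · simp
  exact this _

theorem enc_injOn (h : PairBasis e s) : Set.InjOn (enc e) (Finset.range 256) := by
  intro m hm n hn hmn
  rw [Finset.mem_coe, Finset.mem_range] at hm hn
  refine Nat.eq_of_testBit_eq fun i => ?_
  rcases lt_or_ge i 8 with hi | hi
  · have := h.polar_enc m ⟨i, hi⟩
    rw [hmn, h.polar_enc n ⟨i, hi⟩, bitVal_inj] at this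
    exact this.symm
  · have h256 : 256 ≤ 2 ^ i := by
      calc 256 = 2 ^ 8 := by norm_num
        _ ≤ 2 ^ i := Nat.pow_le_pow_right (by norm_num) hi
    rw [Nat.testBit_lt_two_pow (hm.trans_le h256), Nat.testBit_lt_two_pow (hn.trans_le h256)]

open Classical in
theorem image_enc [Fintype F] (hq : Fintype.card F = 2) (h : PairBasis e s) :
    (Finset.range 256).image (enc e) = Finset.univ := by
  rw [← Finset.card_eq_iff_eq_univ, Finset.card_image_of_injOn h.enc_injOn, Finset.card_range,
    Fintype.card_fun, hq, Fintype.card_fin]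
  norm_num

theorem exists_enc [Fintype F] (hq : Fintype.card F = 2) (h : PairBasis e s) (v : Fin 8 → F) :
    ∃ n < 256, enc e n = v := by
  classical
  have := h.image_enc hq ▸ Finset.mem_univ v
  simpa using this

open Classical in
theorem card_singular [Fintype F] (hq : Fintype.card F = 2) (h2 : (2 : F) = 0)
    (h : PairBasis e s) :
    ({v : Fin 8 → F | QPlus F v = 0} : Finset _).card =
      ((Finset.range 256).filter fun n => pairForm s n = false).card := by
  rw [← Finset.card_image_of_injOn (h.enc_injOn.mono
    (s₁ := ((Finset.range 256).filter fun n => pairForm s n = false))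
    fun n hn => (Finset.mem_filter.1 hn).1)]
  congr 1
  ext v
  obtain ⟨n, hn, rfl⟩ := h.exists_enc hq v
  have h0 : (0 : F) = bitVal false := rfl
  simp only [Finset.mem_filter, Finset.mem_univ, true_and, Finset.mem_image, h.QPlus_enc h2, h0,
    bitVal_inj, Finset.mem_range]
  constructor
  · exact fun H => ⟨n, ⟨hn, H⟩, rfl⟩
  · rintro ⟨m, ⟨hm, H⟩, e⟩
    rwa [← h.enc_injOn (by simpa using hm) (by simpa using hn) e]

theorem standard : PairBasis ![bv F 0, bv F 4, bv F 1, bv F 5, bv F 2, bv F 6, bv F 3, bv F 7]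
    fun _ => false := by
  constructor
  · intro i
    fin_cases i <;> simp [QPlus_bv, bitVal]
  · intro i j
    fin_cases i <;> fin_cases j <;> simp [polar_bv_left, bv_apply, partner]

/-- Three pairs of anisotropic type force the fourth to be of anisotropic type, too. -/
theorem eq_true [Fintype F] (hq : Fintype.card F = 2) (h2 : (2 : F) = 0) {a b : Bool}
    (h : PairBasis e ![true, true, true, true, true, true, a, b]) : a = true ∧ b = true := by
  have h1 := h.card_singular hq h2
  rw [standard.card_singular hq h2] at h1
  revert a b
  have : ∀ a b : Bool, ((Finset.range 256).filter fun n => pairForm (fun _ => false) n = false).card =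
      ((Finset.range 256).filter fun n =>
        pairForm ![true, true, true, true, true, true, a, b] n = false).card →
      a = true ∧ b = true := by decide +kernel
  exact fun {a b} _ h => this a b h

end PairBasis

theorem codeForm_eq {n : ℕ} (hn : n < 256) : codeForm n = (pairForm (fun _ => true) n).toNat := by
  have : ∀ n < 256, codeForm n = (pairForm (fun _ => true) n).toNat := by decide +kernel
  exact this n hn

end OmegaEight

namespace OmegaEight

variable {F : Type*} [Field F]

theorem lin_lin_lin_of_cube {y : Orth F} (hy : y ^ 3 = 1) (v : Fin 8 → F) :
    lin y (lin y (lin y v)) = v := by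
  rw [← lin_mul_apply, ← lin_mul_apply, ← pow_two, ← pow_succ, hy, lin_one_apply]

/-- Mutually orthogonal vectors `a i`, for `i < k`, each spanning together with its image an
anisotropic plane on which `y` acts without fixed points. -/
structure PartialFrame (y : Orth F) (a : ℕ → Fin 8 → F) (k : ℕ) : Prop where
  form : ∀ i < k, QPlus F (a i) = 1
  sum : ∀ i < k, lin y (lin y (a i)) = a i + lin y (a i)
  orth : ∀ i < k, ∀ j < k, i ≠ j → polar (a i) (a j) = 0
  orth_rot : ∀ i < k, ∀ j < k, i ≠ j → polar (a i) (lin y (a j)) = 0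

/-- The orthogonal complement of the planes of a partial frame. -/
def InPerp (y : Orth F) (a : ℕ → Fin 8 → F) (k : ℕ) (v : Fin 8 → F) : Prop :=
  ∀ i < k, polar v (a i) = 0 ∧ polar v (lin y (a i)) = 0

theorem polar_lin_self {y : Orth F} {v : Fin 8 → F} (h2 : (2 : F) = 0)
    (h : lin y (lin y v) = v + lin y v) : polar v (lin y v) = QPlus F v := by
  have := congrArg (QPlus F) h
  rw [QPlus_lin, QPlus_lin, QPlus_add, QPlus_lin] at this
  linear_combination -this - QPlus F v * h2

namespace PartialFrame

variable {y : Orth F} {a : ℕ → Fin 8 → F} {k : ℕ}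

theorem polar_rot (h2 : (2 : F) = 0) (h : PartialFrame y a k) {i : ℕ} (hi : i < k) :
    polar (a i) (lin y (a i)) = 1 := by
  rw [polar_lin_self h2 (h.sum i hi), h.form i hi]

theorem inPerp_rot (h : PartialFrame y a k) {v : Fin 8 → F} (hv : InPerp y a k v) :
    InPerp y a k (lin y v) := by
  intro i hi
  obtain ⟨h1, h2⟩ := hv i hi
  refine ⟨?_, by rw [polar_lin, h1]⟩
  have e := h.sum i hi
  have : a i = lin y (lin y (a i)) - lin y (a i) := by rw [e]; abel
  rw [this, polar_sub_right, polar_lin, polar_lin, h1, h2, sub_zero]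

theorem exists_inPerp (h2 : (2 : F) = 0) (h : PartialFrame y a k) (v : Fin 8 → F) :
    ∃ w, InPerp y a k w ∧ ∀ z, InPerp y a k z → polar z v = polar z w := by
  refine ⟨v - ∑ i ∈ Finset.range k,
    (polar v (lin y (a i)) • a i + polar v (a i) • lin y (a i)), ?_, ?_⟩
  · have hsum : ∀ (f : ℕ → Fin 8 → F) (z : Fin 8 → F),
        polar (∑ i ∈ Finset.range k, f i) z = ∑ i ∈ Finset.range k, polar (f i) z := by
      intro f z
      induction Finset.range k using Finset.induction_on with
      | empty => simp
      | insert i s hi ih => rw [Finset.sum_insert hi, Finset.sum_insert hi, polar_add_left, ih]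
    intro j hj
    have self : ∀ z : Fin 8 → F, polar z z = 0 := fun z => by rw [polar_self, h2, zero_mul]
    constructor
    · rw [polar_sub_left, hsum, Finset.sum_eq_single j]
      · rw [polar_add_left, polar_smul_left, polar_smul_left, self, polar_comm (lin y (a j)),
          h.polar_rot h2 hj]
        ring
      · intro i hi hij
        have hi := Finset.mem_range.1 hi
        rw [polar_add_left, polar_smul_left, polar_smul_left, h.orth i hi j hj hij,
          polar_comm (lin y (a i)), h.orth_rot j hj i hi hij.symm]
        ring
      · intro hj'
        exact absurd (Finset.mem_range.2 hj) hj'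
    · rw [polar_sub_left, hsum, Finset.sum_eq_single j]
      · rw [polar_add_left, polar_smul_left, polar_smul_left, self, h.polar_rot h2 hj]
        ring
      · intro i hi hij
        have hi := Finset.mem_range.1 hi
        rw [polar_add_left, polar_smul_left, polar_smul_left, h.orth_rot i hi j hj hij,
          polar_lin, h.orth i hi j hj hij]
        ring
      · intro hj'
        exact absurd (Finset.mem_range.2 hj) hj'
  · intro z hz
    have hsum : ∀ (s : Finset ℕ) (f : ℕ → Fin 8 → F), (∀ i ∈ s, polar z (f i) = 0) →
        polar z (∑ i ∈ s, f i) = 0 := by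
      intro s f hf
      induction s using Finset.induction_on with
      | empty => simp
      | insert i s hi ih =>
        rw [Finset.sum_insert hi, polar_add_right, hf i (Finset.mem_insert_self i s),
          ih fun j hj => hf j (Finset.mem_insert_of_mem hj), add_zero]
    rw [polar_sub_right, hsum, sub_zero]
    intro i hi
    obtain ⟨h1, h2⟩ := hz i (Finset.mem_range.1 hi)
    rw [polar_add_right, polar_smul_right, polar_smul_right, h1, h2]
    ring

/-- The orthogonal complement of the planes of a partial frame is nondegenerate. -/
theorem exists_polar_ne_zero (h2 : (2 : F) = 0) (h : PartialFrame y a k) {v : Fin 8 → F}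
    (hv : InPerp y a k v) (h0 : v ≠ 0) : ∃ w, InPerp y a k w ∧ polar v w ≠ 0 := by
  obtain ⟨w, hw⟩ := OmegaEight.exists_polar_ne_zero h0
  obtain ⟨w', hw', e⟩ := h.exists_inPerp h2 w
  exact ⟨w', hw', by rwa [← e v hv]⟩

theorem extend (h2 : (2 : F) = 0) (h01 : ∀ c : F, c = 0 ∨ c = 1) (hy : y ^ 3 = 1)
    (h : PartialFrame y a k) {w : Fin 8 → F} (hw : InPerp y a k w) (hwy : lin y w ≠ w) :
    ∃ a', PartialFrame y a' (k + 1) := by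
  have hyyy := lin_lin_lin_of_cube hy
  have hsub : ∀ z, InPerp y a k z → InPerp y a k (lin y z - z) := fun z hz i hi => by
    rw [polar_sub_left, polar_sub_left, (hz i hi).1, (hz i hi).2, (h.inPerp_rot hz i hi).1,
      (h.inPerp_rot hz i hi).2, sub_zero]
    simp
  have hadd : ∀ z : Fin 8 → F, z + z = 0 := fun z => by rw [← two_smul F, h2, zero_smul]
  have hfree : ∀ z, lin y (lin y (lin y z - z)) = lin y z - z + lin y (lin y z - z) := by
    intro z
    rw [map_sub, map_sub, hyyy, ← sub_eq_zero, show z - lin y (lin y z) -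
      (lin y z - z + (lin y (lin y z) - lin y z)) =
      (z - lin y (lin y z)) + (z - lin y (lin y z)) by abel, hadd]
  obtain ⟨z, hz, hQ⟩ : ∃ z, InPerp y a k z ∧ QPlus F (lin y z - z) = 1 := by
    by_contra! hno
    have hQ : ∀ z, InPerp y a k z → QPlus F (lin y z - z) = 0 := fun z hz =>
      (h01 _).resolve_right (hno z hz)
    obtain ⟨u, hu, hne⟩ := h.exists_polar_ne_zero h2 (hsub w hw) (sub_ne_zero.2 hwy)
    have hu' := h.inPerp_rot hu
    have hs := hQ (w + lin y u) fun i hi => by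
      rw [polar_add_left, polar_add_left, (hw i hi).1, (hw i hi).2, (hu' i hi).1, (hu' i hi).2,
        add_zero]
      simp
    rw [show lin y (w + lin y u) - (w + lin y u) = (lin y w - w) + (lin y (lin y u) - lin y u) by
      rw [map_add]; abel, QPlus_add, hQ w hw, hQ _ hu'] at hs
    have hfix : polar (lin y w - w) (u + lin y u + lin y (lin y u)) = 0 := by
      have := polar_lin y w (u + lin y u + lin y (lin y u))
      rw [map_add, map_add, hyyy,
        show lin y u + lin y (lin y u) + u = u + lin y u + lin y (lin y u) by abel] at this
      rw [polar_sub_left, this, sub_self]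
    refine hne ?_
    rw [polar_sub_right] at hs
    rw [polar_add_right, polar_add_right] at hfix
    linear_combination hfix - hs - polar (lin y w - w) (lin y u) * h2
  have hb := hsub z hz
  have hbf := hfree z
  generalize lin y z - z = b at hQ hb hbf
  have hk : Function.update a k b k = b := Function.update_self k b a
  have hlt : ∀ i < k, Function.update a k b i = a i := fun i hi =>
    Function.update_of_ne hi.ne b a
  refine ⟨Function.update a k b, ?_, ?_, ?_, ?_⟩
  · intro i hi
    rcases Nat.lt_succ_iff_lt_or_eq.1 hi with hi | rfl
    · rw [hlt i hi, h.form i hi]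
    · rw [hk, hQ]
  · intro i hi
    rcases Nat.lt_succ_iff_lt_or_eq.1 hi with hi | rfl
    · rw [hlt i hi, h.sum i hi]
    · rw [hk, hbf]
  · intro i hi j hj hij
    rcases Nat.lt_succ_iff_lt_or_eq.1 hi with hi | rfl <;>
      rcases Nat.lt_succ_iff_lt_or_eq.1 hj with hj | rfl
    · rw [hlt i hi, hlt j hj, h.orth i hi j hj hij]
    · rw [hlt i hi, hk, polar_comm, (hb i hi).1]
    · rw [hlt j hj, hk, (hb j hj).1]
    · exact absurd rfl hij
  · intro i hi j hj hij
    rcases Nat.lt_succ_iff_lt_or_eq.1 hi with hi | rfl <;>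
      rcases Nat.lt_succ_iff_lt_or_eq.1 hj with hj | rfl
    · rw [hlt i hi, hlt j hj, h.orth_rot i hi j hj hij]
    · have hby : polar (lin y (lin y (a i))) (lin y b) = 0 := by
        rw [polar_lin, polar_comm, (hb i hi).2]
      rw [h.sum i hi, polar_add_left, polar_lin, polar_comm (a i) b, (hb i hi).1, add_zero] at hby
      rw [hlt i hi, hk, hby]
    · rw [hlt j hj, hk, (hb j hj).2]
    · exact absurd rfl hij

end PartialFrame

theorem exists_submodule_inPerp (y : Orth F) (a : ℕ → Fin 8 → F) (k : ℕ) :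
    ∃ W : Submodule F (Fin 8 → F), (∀ v ∈ W, InPerp y a k v) ∧ 8 ≤ Module.finrank F W + 2 * k := by
  let f : (Fin 8 → F) →ₗ[F] (Fin k ⊕ Fin k → F) :=
    { toFun := fun v => Sum.elim (fun i => polar v (a i)) (fun i => polar v (lin y (a i)))
      map_add' := fun u v => by ext (i | i) <;> simp
      map_smul' := fun c v => by ext (i | i) <;> simp }
  refine ⟨LinearMap.ker f, fun v hv i hi => ?_, ?_⟩
  · have hv := LinearMap.mem_ker.1 hv
    exact ⟨congrFun hv (Sum.inl ⟨i, hi⟩), congrFun hv (Sum.inr ⟨i, hi⟩)⟩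
  · have h1 := LinearMap.finrank_range_add_finrank_ker f
    have h2 := Submodule.finrank_le (LinearMap.range f)
    rw [Module.finrank_fintype_fun_eq_card, Fintype.card_sum, Fintype.card_fin] at h2
    rw [Module.finrank_fin_fun] at h1
    omega

theorem exists_partialFrame (h2 : (2 : F) = 0) (h01 : ∀ c : F, c = 0 ∨ c = 1) {y : Orth F}
    (hy : y ^ 3 = 1) (k : ℕ) : (∃ j < k, ∃ a, PartialFrame y a j ∧
      ∀ v, InPerp y a j v → lin y v = v) ∨ ∃ a, PartialFrame y a k := by
  induction k with
  | zero => exact Or.inr ⟨0, by constructor <;> simp⟩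
  | succ k ih =>
    rcases ih with ⟨j, hj, h⟩ | ⟨a, ha⟩
    · exact Or.inl ⟨j, hj.trans k.lt_succ_self, h⟩
    · by_cases hfix : ∀ v, InPerp y a k v → lin y v = v
      · exact Or.inl ⟨k, k.lt_succ_self, a, ha, hfix⟩
      · push Not at hfix
        obtain ⟨w, hw, hwy⟩ := hfix
        exact Or.inr (ha.extend h2 h01 hy hw hwy)

namespace PartialFrame

variable {y : Orth F} {a : ℕ → Fin 8 → F} {k : ℕ}

theorem polar_eq (h2 : (2 : F) = 0) (h : PartialFrame y a k) {i j : ℕ} (hi : i < k) (hj : j < k) :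
    polar (a i) (a j) = 0 ∧ polar (lin y (a i)) (lin y (a j)) = 0 ∧
      (polar (a i) (lin y (a j)) = if i = j then 1 else 0) ∧
      polar (lin y (a i)) (a j) = if i = j then 1 else 0 := by
  rw [polar_lin, polar_comm (lin y (a i))]
  rcases eq_or_ne i j with rfl | hij
  · simp [polar_self, h2, h.polar_rot h2 hi]
  · simp [h.orth i hi j hj hij, h.orth_rot i hi j hj hij, h.orth_rot j hj i hi hij.symm, hij]

theorem pairBasis_four (h2 : (2 : F) = 0) (h : PartialFrame y a 4) :
    PairBasis ![a 0, lin y (a 0), a 1, lin y (a 1), a 2, lin y (a 2), a 3, lin y (a 3)]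
      fun _ => true := by
  have hQ : ∀ i < 4, QPlus F (a i) = 1 := h.form
  have hP := fun i hi j hj => h.polar_eq h2 (i := i) (j := j) hi hj
  constructor
  · intro i
    fin_cases i <;> simp [hQ, bitVal]
  · intro i j
    fin_cases i <;> fin_cases j <;> simp [hP, partner, -polar_lin]

theorem pairBasis_three (h2 : (2 : F) = 0) (h : PartialFrame y a 3) {b c : Fin 8 → F}
    {s t : Bool} (hb : InPerp y a 3 b) (hc : InPerp y a 3 c) (hbc : polar b c = 1)
    (hs : QPlus F b = bitVal s) (ht : QPlus F c = bitVal t) :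
    PairBasis ![a 0, lin y (a 0), a 1, lin y (a 1), a 2, lin y (a 2), b, c]
      ![true, true, true, true, true, true, s, t] := by
  have hQ : ∀ i < 3, QPlus F (a i) = 1 := h.form
  have hP := fun i hi j hj => h.polar_eq h2 (i := i) (j := j) hi hj
  have hb' : ∀ i < 3, polar b (a i) = 0 ∧ polar b (lin y (a i)) = 0 ∧ polar (a i) b = 0 ∧
      polar (lin y (a i)) b = 0 := fun i hi => by
    rw [polar_comm (a i), polar_comm (lin y (a i))]; simp [hb i hi]
  have hc' : ∀ i < 3, polar c (a i) = 0 ∧ polar c (lin y (a i)) = 0 ∧ polar (a i) c = 0 ∧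
      polar (lin y (a i)) c = 0 := fun i hi => by
    rw [polar_comm (a i), polar_comm (lin y (a i))]; simp [hc i hi]
  have hcb : polar c b = 1 := by rw [polar_comm, hbc]
  constructor
  · intro i
    fin_cases i <;> simp [hQ, hs, ht] <;> simp [bitVal]
  · intro i j
    fin_cases i <;> fin_cases j <;>
      simp [hP, hb', hc', hbc, hcb, partner, polar_self, h2, -polar_lin]

end PartialFrame

end OmegaEight

namespace OmegaEight

variable {F : Type*} [Field F]

/-- An identification of the eight-bit numbers with `F⁸`, over a field of two elements, under
which `y` and the quadratic form become `codeRot` and `codeForm`. -/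
structure IsFrame (y : Orth F) (E : ℕ → Fin 8 → F) : Prop where
  xor : ∀ m < 256, ∀ n < 256, E (m ^^^ n) = E m + E n
  rot : ∀ n < 256, lin y (E n) = E (codeRot n)
  form : ∀ n < 256, QPlus F (E n) = codeForm n

theorem testBit_codeRot {n : ℕ} (hn : n < 256) :
    (codeRot n).testBit 0 = n.testBit 1 ∧ (codeRot n).testBit 1 = (n.testBit 0 ^^ n.testBit 1) ∧
    (codeRot n).testBit 2 = n.testBit 3 ∧ (codeRot n).testBit 3 = (n.testBit 2 ^^ n.testBit 3) ∧
    (codeRot n).testBit 4 = n.testBit 5 ∧ (codeRot n).testBit 5 = (n.testBit 4 ^^ n.testBit 5) ∧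
    (codeRot n).testBit 6 = n.testBit 6 ∧ (codeRot n).testBit 7 = n.testBit 7 := by
  revert n
  decide +kernel

theorem cast_codeForm {n : ℕ} (hn : n < 256) :
    (codeForm n : F) = bitVal (pairForm (fun _ => true) n) := by
  rw [codeForm_eq hn]
  cases pairForm (fun _ => true) n <;> simp [bitVal]

theorem PartialFrame.isFrame (h2 : (2 : F) = 0) {y : Orth F} {a : ℕ → Fin 8 → F}
    (h : PartialFrame y a 3) {b c : Fin 8 → F} (hb : lin y b = b) (hc : lin y c = c)
    (hP : PairBasis ![a 0, lin y (a 0), a 1, lin y (a 1), a 2, lin y (a 2), b, c]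
      fun _ => true) :
    IsFrame y (enc ![a 0, lin y (a 0), a 1, lin y (a 1), a 2, lin y (a 2), b, c]) where
  xor m _ n _ := enc_xor h2 _ m n
  form n hn := by rw [hP.QPlus_enc h2, cast_codeForm hn]
  rot n hn := by
    obtain ⟨h0, h1, h3, h4, h5, h6, h7, h8⟩ := testBit_codeRot hn
    have e0 := h.sum 0 (by norm_num)
    have e1 := h.sum 1 (by norm_num)
    have e2 := h.sum 2 (by norm_num)
    simp only [enc, Fin.sum_univ_eight, map_add, map_smul]
    simp [e0, e1, e2, hb, hc, h0, h1, h3, h4, h5, h6, h7, h8, bitVal_xor h2]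
    module

/-- The maps with the given images of powers of two that preserve the structure. -/
def IsSymmetry (l : List ℕ) : Prop :=
  ∀ n < 256, codeMap l n < 256 ∧ codeRot (codeMap l n) = codeMap l (codeRot n) ∧
    codeForm (codeMap l n) = codeForm n

namespace IsFrame

variable {y : Orth F} {E : ℕ → Fin 8 → F}

theorem comp_codeMap (h : IsFrame y E) {l : List ℕ} (hl : IsSymmetry l) :
    IsFrame y (E ∘ codeMap l) where
  xor m hm n hn := by
    rw [Function.comp_apply, codeMap_xor, h.xor _ (hl m hm).1 _ (hl n hn).1]
    rfl
  rot n hn := by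
    rw [Function.comp_apply, h.rot _ (hl n hn).1, (hl n hn).2.1]
    rfl
  form n hn := by rw [Function.comp_apply, h.form _ (hl n hn).1, (hl n hn).2.2]

theorem form_eq (h : IsFrame y E) {m n : ℕ} (hm : m < 256) (hn : n < 256)
    (hmn : QPlus F (E m) = QPlus F (E n)) : codeForm m = codeForm n := by
  rw [h.form m hm, h.form n hn, cast_codeForm hm, cast_codeForm hn, bitVal_inj] at hmn
  rw [codeForm_eq hm, codeForm_eq hn, hmn]

theorem injOn (h : IsFrame y E) : Set.InjOn E (Finset.range 256) := by
  intro m hm n hn hmn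
  rw [Finset.mem_coe, Finset.mem_range] at hm hn
  have key : ∀ d < 256, (∀ k < 256, codeForm (d ^^^ k) = codeForm k) → d = 0 := by decide +kernel
  refine Nat.xor_eq_zero_iff.1 (key _ (xor_lt hm hn) fun k hk => ?_)
  refine h.form_eq (xor_lt (xor_lt hm hn) hk) hk (congrArg _ ?_)
  rw [h.xor _ (xor_lt hm hn) k hk, h.xor m hm n hn, hmn, ← h.xor n hn n hn, Nat.xor_self,
    ← h.xor 0 (by norm_num) k hk, Nat.zero_xor]

theorem inj (h : IsFrame y E) {m n : ℕ} (hm : m < 256) (hn : n < 256) (hmn : E m = E n) : m = n :=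
  h.injOn (by simpa using hm) (by simpa using hn) hmn

theorem surj [Fintype F] (hq : Fintype.card F = 2) (h : IsFrame y E) (v : Fin 8 → F) :
    ∃ n < 256, E n = v := by
  classical
  have : (Finset.range 256).image E = Finset.univ := by
    rw [← Finset.card_eq_iff_eq_univ, Finset.card_image_of_injOn h.injOn, Finset.card_range,
      Fintype.card_fun, hq, Fintype.card_fin]
    norm_num
  have := this ▸ Finset.mem_univ v
  simpa using this

theorem zero (h : IsFrame y E) : E 0 = 0 := by
  simpa using h.xor 0 (by norm_num) 0 (by norm_num)

/-- A vector can be given a minimal number by changing the frame. -/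
theorem exists_reduced {L : List (List ℕ × List ℕ)} (hL : ∀ p ∈ L, IsSymmetry p.1)
    {K : (ℕ → Fin 8 → F) → Prop} (hK : ∀ E, K E → ∀ p ∈ L, K (E ∘ codeMap p.1))
    {C R : ℕ → Prop} (w : Fin 8 → F)
    (hC : ∀ E, IsFrame y E → K E → ∀ m < 256, E m = w → C m)
    (hR : ∀ m < 256, C m → R m ∨
      ∃ p ∈ L, codeMap p.2 m < m ∧ codeMap p.1 (codeMap p.2 m) = m)
    (n : ℕ) (hn : n < 256) (hE : IsFrame y E) (hKE : K E) (hw : E n = w) :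
    ∃ E' m, IsFrame y E' ∧ K E' ∧ m < 256 ∧ E' m = w ∧ R m := by
  induction n using Nat.strong_induction_on generalizing E with
  | _ n ih =>
    rcases hR n hn (hC E hE hKE n hn hw) with h | ⟨p, hp, hlt, he⟩
    · exact ⟨E, n, hE, hKE, hn, hw, h⟩
    · exact ih _ hlt (hlt.trans hn) (hE.comp_codeMap (hL p hp)) (hK E hKE p hp)
        (by rw [Function.comp_apply, he, hw])

end IsFrame

/-- Symmetries, followed by their inverses. -/
def symmetries : List (List ℕ × List ℕ) :=
  [([1, 2, 4, 8, 16, 32, 128, 192], [1, 2, 4, 8, 16, 32, 192, 64]),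
   ([2, 3, 8, 12, 32, 48, 64, 128], [3, 1, 12, 4, 48, 16, 64, 128]),
   ([2, 3, 4, 8, 16, 32, 64, 128], [3, 1, 4, 8, 16, 32, 64, 128]),
   ([4, 8, 16, 32, 1, 2, 64, 128], [16, 32, 1, 2, 4, 8, 64, 128]),
   ([57, 30, 45, 54, 21, 42, 64, 128], [21, 42, 27, 45, 30, 39, 64, 128])]

/-- Symmetries fixing `65`, followed by their inverses. -/
def symmetriesSingular : List (List ℕ × List ℕ) :=
  [([1, 2, 8, 12, 32, 48, 64, 128], [1, 2, 12, 4, 48, 16, 64, 128]),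
   ([1, 2, 8, 12, 16, 32, 64, 192], [1, 2, 12, 4, 16, 32, 64, 192]),
   ([1, 2, 16, 32, 4, 8, 64, 128], [1, 2, 16, 32, 4, 8, 64, 128])]

/-- Symmetries fixing `69`, followed by their inverses. -/
def symmetriesNonsingular : List (List ℕ × List ℕ) :=
  [([4, 8, 1, 2, 32, 48, 64, 128], [4, 8, 1, 2, 48, 16, 64, 128]),
   ([46, 55, 43, 61, 31, 37, 64, 128], [43, 61, 46, 55, 31, 37, 64, 128]),
   ([30, 39, 27, 45, 21, 42, 64, 192], [27, 45, 30, 39, 21, 42, 64, 192])]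

theorem isSymmetry_symmetries : ∀ p ∈ symmetries, IsSymmetry p.1 := by
  unfold IsSymmetry
  decide +kernel

theorem isSymmetry_symmetriesSingular :
    ∀ p ∈ symmetriesSingular, IsSymmetry p.1 ∧ codeMap p.1 65 = 65 := by
  unfold IsSymmetry
  decide +kernel

theorem isSymmetry_symmetriesNonsingular :
    ∀ p ∈ symmetriesNonsingular, IsSymmetry p.1 ∧ codeMap p.1 69 = 69 := by
  unfold IsSymmetry
  decide +kernel

/-- The combinations of the images of `v` under the rotation. -/
def orbitSum (v : ℕ) (i j k : Bool) : ℕ :=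
  (bif i then v else 0) ^^^
    ((bif j then codeRot v else 0) ^^^ (bif k then codeRot (codeRot v) else 0))

/-- The conditions on the image of `codeRot (codeRot v)` under an involution mapping `v` to
`codeRot v`, when these vectors do not span an invariant subspace. -/
def IsCandidate (v p : ℕ) : Prop :=
  (∀ i j k, p ≠ orbitSum v i j k) ∧ codeForm p = codeForm (codeRot (codeRot v)) ∧
    codeForm (p ^^^ v) = codeForm (codeRot (codeRot v) ^^^ codeRot v) ∧
    codeForm (p ^^^ codeRot v) = codeForm (codeRot (codeRot v) ^^^ v)

theorem symmetries_reduce : ∀ m < 256, (64 ≤ m ∧ codeRot m ≠ m) → (m = 65 ∨ m = 69) ∨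
    ∃ p ∈ symmetries, codeMap p.2 m < m ∧ codeMap p.1 (codeMap p.2 m) = m := by
  decide +kernel

theorem symmetriesSingular_reduce : ∀ m < 256, IsCandidate 65 m → runSearch 135 65 m = true ∨
    ∃ p ∈ symmetriesSingular, codeMap p.2 m < m ∧ codeMap p.1 (codeMap p.2 m) = m := by
  have : ∀ m < 256, IsCandidate 65 m → (m = 7 ∨ m = 87 ∨ m = 132) ∨
      ∃ p ∈ symmetriesSingular, codeMap p.2 m < m ∧ codeMap p.1 (codeMap p.2 m) = m := by
    unfold IsCandidate
    decide +kernel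
  intro m hm hc
  obtain ⟨h1, h2, h3, -, -⟩ := runSearch_eq_true
  rcases this m hm hc with (rfl | rfl | rfl) | h
  exacts [Or.inl h1, Or.inl h2, Or.inl h3, Or.inr h]

theorem symmetriesNonsingular_reduce : ∀ m < 256, IsCandidate 69 m → runSearch 120 69 m = true ∨
    ∃ p ∈ symmetriesNonsingular, codeMap p.2 m < m ∧ codeMap p.1 (codeMap p.2 m) = m := by
  have : ∀ m < 256, IsCandidate 69 m → (m = 16 ∨ m = 134) ∨
      ∃ p ∈ symmetriesNonsingular, codeMap p.2 m < m ∧ codeMap p.1 (codeMap p.2 m) = m := by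
    unfold IsCandidate
    decide +kernel
  intro m hm hc
  obtain ⟨-, -, -, h1, h2⟩ := runSearch_eq_true
  rcases this m hm hc with (rfl | rfl) | h
  exacts [Or.inl h1, Or.inl h2, Or.inr h]

theorem card_codeForm :
    ((Finset.range 256).filter fun n => n ≠ 0 ∧ codeForm n = codeForm 65).card = 135 ∧
    ((Finset.range 256).filter fun n => n ≠ 0 ∧ codeForm n = codeForm 69).card = 120 := by
  decide +kernel

end OmegaEight

namespace OmegaEight

variable {F : Type*} [Field F] {x y : Orth F}

theorem IsFrame.exists_codeInvolution [Fintype F] (hq : Fintype.card F = 2) {E : ℕ → Fin 8 → F}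
    (hE : IsFrame y E) (hx : x ^ 2 = 1) :
    ∃ X, CodeInvolution X ∧ ∀ n < 256, E (X n) = lin x (E n) := by
  choose X hlt hX using fun n => hE.surj hq (lin x (E n))
  refine ⟨X, ⟨fun n _ => hlt n, fun m hm n hn => ?_, fun n hn => ?_, fun n hn => ?_⟩,
    fun n _ => hX n⟩
  · refine hE.inj (hlt _) (xor_lt (hlt m) (hlt n)) ?_
    rw [hE.xor _ (hlt m) _ (hlt n), hX, hX, hX, hE.xor m hm n hn, map_add]
  · refine hE.form_eq (hlt n) hn ?_
    rw [hX, QPlus_lin]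
  · refine hE.inj (hlt _) hn ?_
    rw [hX, hX, lin_lin_of_sq hx]

/-- A set of vectors invariant under generators contains all vectors of a given length. -/
theorem IsFrame.false_of_runSearch [Fintype F] (hq : Fintype.card F = 2) {E : ℕ → Fin 8 → F}
    (hE : IsFrame y E) (hx : x ^ 2 = 1) (hy : y ^ 3 = 1)
    (hgen : siegelGroup F ≤ Subgroup.closure {x, y}) {v p bound : ℕ} (hv : v < 256) (hv0 : v ≠ 0)
    (hp : p < 256) (hxv : lin x (E v) = E (codeRot v))
    (hxp : lin x (E (codeRot (codeRot v))) = E p) (h : runSearch bound v p = true)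
    (hcard : bound ≤
      ((Finset.range 256).filter fun n => n ≠ 0 ∧ codeForm n = codeForm v).card) : False := by
  obtain ⟨X, hX, hXE⟩ := hE.exists_codeInvolution hq hx
  have hu := codeRot_lt hv
  have hz := codeRot_lt hu
  obtain ⟨T, hvT, hT, hTc⟩ := runSearch_spec hX hv
    (hE.inj (hX.lt v hv) hu (by rw [hXE v hv, hxv]))
    (hE.inj (hX.lt _ hz) hp (by rw [hXE _ hz, hxp])) h
  have stepx : ∀ n ∈ T, ∃ m ∈ T, E m = lin x (E n) := fun n hn =>
    ⟨X n, (hTc n hn).2.2, hXE n (hTc n hn).1⟩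
  have stepy : ∀ n ∈ T, ∃ m ∈ T, E m = lin y (E n) := fun n hn =>
    ⟨codeRot n, (hTc n hn).2.1, (hE.rot n (hTc n hn).1).symm⟩
  have hinvx : x⁻¹ = x := inv_eq_of_mul_eq_one_left (by rw [← pow_two, hx])
  have hinvy : y⁻¹ = y * y := inv_eq_of_mul_eq_one_left (by rw [← pow_two, ← pow_succ, hy])
  have step : ∀ g ∈ Subgroup.closure {x, y}, ∃ m ∈ T, E m = lin g (E v) := by
    intro g hg
    induction hg using Subgroup.closure_induction_left with
    | one => exact ⟨v, hvT, (lin_one_apply _).symm⟩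
    | mul_left s hs g _ ih =>
      obtain ⟨n, hn, e⟩ := ih
      rw [lin_mul_apply, ← e]
      rcases hs with rfl | rfl
      exacts [stepx n hn, stepy n hn]
    | inv_mul_cancel s hs g _ ih =>
      obtain ⟨n, hn, e⟩ := ih
      rw [lin_mul_apply, ← e]
      rcases hs with rfl | rfl
      · rw [hinvx]
        exact stepx n hn
      · obtain ⟨m, hm, e'⟩ := stepy n hn
        rw [hinvy, lin_mul_apply, ← e']
        exact stepy m hm
  have hne : ∀ n < 256, n ≠ 0 → E n ≠ 0 := fun n hn h0 e =>
    h0 (hE.inj hn (by norm_num) (e.trans hE.zero.symm))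
  refine absurd (hcard.trans (Finset.card_le_card (t := T) fun n hn => ?_)) hT.not_ge
  obtain ⟨hn, hn0, hform⟩ := Finset.mem_filter.1 hn
  rw [Finset.mem_range] at hn
  obtain ⟨g, hg, e⟩ := exists_siegelGroup_map (hne v hv hv0) (hne n hn hn0)
    (by rw [hE.form v hv, hE.form n hn, hform])
  obtain ⟨m, hm, e'⟩ := step g (hgen hg)
  rwa [hE.inj hn (hTc m hm).1 (e.symm.trans e'.symm)]

theorem four_le_finrank_fixed_of_sq (h2 : (2 : F) = 0) (hx : x ^ 2 = 1) :
    4 ≤ Module.finrank F (LinearMap.ker (lin x - 1)) := by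
  have hle : LinearMap.range (lin x - 1) ≤ LinearMap.ker (lin x - 1) := by
    rintro _ ⟨v, rfl⟩
    rw [mem_ker_lin_sub_one, LinearMap.sub_apply, Module.End.one_apply, map_sub, lin_lin_of_sq hx,
      ← sub_eq_zero, show v - lin x v - (lin x v - v) = (2 : F) • (v - lin x v) by module, h2,
      zero_smul]
  have h1 := LinearMap.finrank_range_add_finrank_ker (lin x - 1)
  have h3 := Submodule.finrank_mono hle
  rw [Module.finrank_fin_fun] at h1
  omega

theorem PartialFrame.inPerp_of_fixed {a : ℕ → Fin 8 → F} {k : ℕ} (h : PartialFrame y a k)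
    {t : Fin 8 → F} (ht : lin y t = t) : InPerp y a k t := by
  have hp : ∀ w, polar t (lin y w) = polar t w := fun w => by
    rw [← polar_lin y t w, ht]
  intro i hi
  have e := congrArg (polar t) (h.sum i hi)
  rw [polar_add_right, hp, hp, left_eq_add] at e
  exact ⟨e, by rw [hp, e]⟩

theorem exists_isFrame [Fintype F] (hq : Fintype.card F = 2) (h2 : (2 : F) = 0)
    (h01 : ∀ c : F, c = 0 ∨ c = 1) (hx : x ^ 2 = 1) (hy : y ^ 3 = 1) (hgen : ProjGen x y)
    {v t : Fin 8 → F} (hv : lin (x * y) v = v) (hv0 : v ≠ 0) (ht : lin y t = t) (ht0 : t ≠ 0) :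
    ∃ E, IsFrame y E := by
  rcases exists_partialFrame h2 h01 hy 4 with ⟨j, hj, a, ha, hfix⟩ | ⟨a, ha⟩
  · obtain ⟨W, hW, hdim⟩ := exists_submodule_inPerp y a j
    have hle : W ≤ LinearMap.ker (lin y - 1) := by
      intro w hw
      rw [mem_ker_lin_sub_one]
      exact hfix w (hW w hw)
    have h1 := Submodule.finrank_mono hle
    have h3 := four_le_finrank_fixed_of_sq h2 hx
    rcases Nat.lt_or_ge j 3 with hj3 | hj3
    · exact absurd (eq_zero_of_mul_fixed hgen.fixed_eq_zero (by omega) hv) hv0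
    obtain rfl : j = 3 := by omega
    have hb := ha.inPerp_of_fixed ht
    obtain ⟨c, hc, hbc⟩ := ha.exists_polar_ne_zero h2 hb ht0
    have hbit : ∀ d : F, ∃ s, d = bitVal s := fun d => by
      rcases h01 d with rfl | rfl
      exacts [⟨false, rfl⟩, ⟨true, rfl⟩]
    obtain ⟨r, hr⟩ := hbit (QPlus F t)
    obtain ⟨s, hs⟩ := hbit (QPlus F c)
    have hP := ha.pairBasis_three h2 hb hc ((h01 _).resolve_left hbc) hr hs
    obtain ⟨rfl, rfl⟩ := hP.eq_true hq h2
    refine ⟨_, ha.isFrame h2 ht (hfix c hc) ?_⟩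
    convert hP using 1
    ext i
    fin_cases i <;> rfl
  · obtain ⟨w, hw⟩ := OmegaEight.exists_polar_ne_zero ht0
    obtain ⟨n, -, rfl⟩ := (ha.pairBasis_four h2).exists_enc hq w
    have hP : ∀ i < 4, polar t (a i) = 0 ∧ polar t (lin y (a i)) = 0 := ha.inPerp_of_fixed ht
    exact absurd (by simp [enc, Fin.sum_univ_eight, hP]) hw

end OmegaEight

namespace OmegaEight

variable {F : Type*} [Field F] {x y : Orth F}

theorem ProjGen.eq_zero_of_mem [Finite F] (h : ProjGen x y) (s : Finset (Fin 8 → F))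
    (hs : s.card < 8) (hx : ∀ w ∈ s, lin x w ∈ Submodule.span F (s : Set (Fin 8 → F)))
    (hy : ∀ w ∈ s, lin y w ∈ Submodule.span F (s : Set (Fin 8 → F))) {v : Fin 8 → F}
    (hv : v ∈ s) : v = 0 := by
  by_contra h0
  have key : ∀ g : Orth F, (∀ w ∈ s, lin g w ∈ Submodule.span F (s : Set (Fin 8 → F))) →
      ∀ w ∈ Submodule.span F (s : Set (Fin 8 → F)),
        lin g w ∈ Submodule.span F (s : Set (Fin 8 → F)) := by
    intro g hg
    have hle : Submodule.span F (s : Set (Fin 8 → F)) ≤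
        (Submodule.span F (s : Set (Fin 8 → F))).comap (lin g) := Submodule.span_le.2 hg
    exact fun w hw => hle hw
  exact span_ne_top s hs (h.eq_top _ (key x hx) (key y hy) (Submodule.subset_span hv) h0)

/-- Over the field of two elements, no product of the generators fixes a vector. -/
theorem eq_zero_of_card_two [Fintype F] (hq : Fintype.card F = 2) (h2 : (2 : F) = 0)
    (h01 : ∀ c : F, c = 0 ∨ c = 1) (hx : x ^ 2 = 1) (hy : y ^ 3 = 1)
    (hgen : siegelGroup F ≤ Subgroup.closure {x, y}) {v : Fin 8 → F}
    (hv : lin (x * y) v = v) : v = 0 := by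
  classical
  by_contra hv0
  have hproj : ProjGen x y := hgen.trans le_sup_left
  have hyyy := lin_lin_lin_of_cube hy v
  have hxu : lin x (lin y v) = v := by rw [← lin_mul_apply, hv]
  have hxv : lin x v = lin y v := by
    conv_lhs => rw [← hxu]
    exact lin_lin_of_sq hx _
  have hneg : ∀ w : Fin 8 → F, w + w = 0 := fun w => by rw [← two_smul F, h2, zero_smul]
  have ht0 : v + lin y v + lin y (lin y v) ≠ 0 := by
    intro ht
    have hz : lin y (lin y v) = v + lin y v := by
      rw [← sub_eq_zero, ← ht, ← sub_eq_zero, show lin y (lin y v) - (v + lin y v) -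
        (v + lin y v + lin y (lin y v)) = -((v + lin y v) + (v + lin y v)) by abel, hneg, neg_zero]
    refine hv0 (hproj.eq_zero_of_mem {v, lin y v} (Finset.card_le_two.trans_lt (by norm_num))
      ?_ ?_ (by simp))
    all_goals
      simp only [Finset.forall_mem_insert, Finset.mem_singleton, forall_eq, hxv, hxu, hz,
        Finset.coe_insert, Finset.coe_singleton]
      refine ⟨?_, ?_⟩
    · exact Submodule.subset_span (by simp)
    · exact Submodule.subset_span (by simp)
    · exact Submodule.subset_span (by simp)
    · exact add_mem (Submodule.subset_span (by simp)) (Submodule.subset_span (by simp))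
  have hyt : lin y (v + lin y v + lin y (lin y v)) = v + lin y v + lin y (lin y v) := by
    rw [map_add, map_add, hyyy]
    abel
  obtain ⟨E, hE⟩ := exists_isFrame hq h2 h01 hx hy hproj hv hv0 hyt ht0
  have hC : ∀ E, IsFrame y E → True → ∀ m < 256, E m = v → 64 ≤ m ∧ codeRot m ≠ m := by
    intro E hE _ m hm e
    constructor
    · by_contra hlt
      have key : ∀ m < 64, m ^^^ codeRot m ^^^ codeRot (codeRot m) = 0 := by decide +kernel
      have hu := codeRot_lt hm
      refine ht0 ?_
      rw [← e, hE.rot m hm, hE.rot _ hu, ← hE.xor m hm _ hu,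
        ← hE.xor _ (xor_lt hm hu) _ (codeRot_lt hu), key m (by omega), hE.zero]
    · intro e'
      have hyv : lin y v = v := by rw [← e, hE.rot m hm, e']
      exact hv0 (hproj.fixed_eq_zero v (by rw [hxv, hyv]) hyv)
  obtain ⟨n, hn, hnv⟩ := hE.surj hq v
  obtain ⟨E, m, hE, -, hm, e, hm'⟩ := IsFrame.exists_reduced isSymmetry_symmetries
    (K := fun _ => True) (fun _ _ _ _ => trivial) v hC symmetries_reduce n hn hE trivial hnv
  -- the image of the third vector of the orbit of `v` under `y`
  have hcand : ∀ n < 256, ∀ E, IsFrame y E → E n = v →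
      ∀ p < 256, E p = lin x (lin y (lin y v)) → IsCandidate n p := by
    intro n hn E hE e p hp e'
    have hu := codeRot_lt hn
    have hz := codeRot_lt hu
    have eu : E (codeRot n) = lin y v := by rw [← hE.rot n hn, e]
    have ez : E (codeRot (codeRot n)) = lin y (lin y v) := by rw [← hE.rot _ hu, eu]
    refine ⟨fun i j k hpo => ?_, ?_, ?_, ?_⟩
    · refine hv0 (hproj.eq_zero_of_mem {v, lin y v, lin y (lin y v)}
        (Finset.card_le_three.trans_lt (by norm_num)) ?_ ?_ (by simp))
      · have hmem : lin x (lin y (lin y v)) ∈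
            Submodule.span F ({v, lin y v, lin y (lin y v)} : Set (Fin 8 → F)) := by
          have hb : ∀ (b : Bool) (l : ℕ), l < 256 → (bif b then l else 0) < 256 := by
            intro b l hl
            cases b <;> simp [hl]
          rw [← e', hpo, orbitSum, hE.xor _ (hb i _ hn) _ (xor_lt (hb j _ hu) (hb k _ hz)),
            hE.xor _ (hb j _ hu) _ (hb k _ hz)]
          have hs : ∀ (b : Bool) (l : ℕ),
              E l ∈ Submodule.span F ({v, lin y v, lin y (lin y v)} : Set (Fin 8 → F)) →
              E (bif b then l else 0) ∈
                Submodule.span F ({v, lin y v, lin y (lin y v)} : Set (Fin 8 → F)) := by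
            intro b l hl
            cases b
            · rw [cond_false, hE.zero]
              exact zero_mem _
            · exact hl
          refine add_mem (hs _ _ ?_) (add_mem (hs _ _ ?_) (hs _ _ ?_))
          · rw [e]; exact Submodule.subset_span (by simp)
          · rw [eu]; exact Submodule.subset_span (by simp)
          · rw [ez]; exact Submodule.subset_span (by simp)
        simp only [Finset.forall_mem_insert, Finset.mem_singleton, forall_eq, hxv, hxu,
          Finset.coe_insert, Finset.coe_singleton]
        exact ⟨Submodule.subset_span (by simp), Submodule.subset_span (by simp), hmem⟩
      · simp only [Finset.forall_mem_insert, Finset.mem_singleton, forall_eq, hyyy,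
          Finset.coe_insert, Finset.coe_singleton]
        exact ⟨Submodule.subset_span (by simp), Submodule.subset_span (by simp),
          Submodule.subset_span (by simp)⟩
    · exact hE.form_eq hp hz (by rw [e', ez, QPlus_lin])
    · refine hE.form_eq (xor_lt hp hn) (xor_lt hz hu) ?_
      rw [hE.xor p hp n hn, hE.xor _ hz _ hu, e', ez, eu, e, ← QPlus_lin x (_ + lin y v), map_add,
        hxu]
    · refine hE.form_eq (xor_lt hp hu) (xor_lt hz hn) ?_
      rw [hE.xor p hp _ hu, hE.xor _ hz _ hn, e', ez, eu, e, ← QPlus_lin x (_ + v), map_add, hxv]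
  have finish : ∀ (n bound : ℕ) (L : List (List ℕ × List ℕ)), n < 256 → n ≠ 0 →
      (∀ p ∈ L, IsSymmetry p.1 ∧ codeMap p.1 n = n) →
      (∀ m < 256, IsCandidate n m → runSearch bound n m = true ∨
        ∃ p ∈ L, codeMap p.2 m < m ∧ codeMap p.1 (codeMap p.2 m) = m) →
      bound ≤ ((Finset.range 256).filter fun k => k ≠ 0 ∧ codeForm k = codeForm n).card →
      E n = v → False := by
    intro n bound L hn hn0 hL hR hcard e
    obtain ⟨p, hp, hpw⟩ := hE.surj hq (lin x (lin y (lin y v)))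
    obtain ⟨E', p', hE', e', hp', hpw', hrun⟩ := IsFrame.exists_reduced
      (fun p hp => (hL p hp).1) (K := fun E => E n = v)
      (fun E e p hp => by rw [Function.comp_apply, (hL p hp).2, e]) (lin x (lin y (lin y v)))
      (fun E hE e p hp hpw => hcand n hn E hE e p hp hpw) hR p hp hE e hpw
    refine hE'.false_of_runSearch hq hx hy hgen hn hn0 hp' ?_ ?_ hrun hcard
    · rw [e', hxv, ← hE'.rot n hn, e']
    · rw [← hE'.rot _ (codeRot_lt hn), ← hE'.rot n hn, e', hpw']
  rcases hm' with rfl | rfl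
  · exact finish 65 135 _ (by norm_num) (by norm_num) isSymmetry_symmetriesSingular
      symmetriesSingular_reduce card_codeForm.1.ge e
  · exact finish 69 120 _ (by norm_num) (by norm_num) isSymmetry_symmetriesNonsingular
      symmetriesNonsingular_reduce card_codeForm.2.ge e

theorem not_genTriple_of_card_two [Fintype F] (hq : Fintype.card F = 2)
    {x₁ x₂ x₃ y₁ y₂ y₃ : Orth F} (h : GenTriple x₁ x₂ x₃ y₁ y₂ y₃) : False := by
  have h2 : (2 : F) = 0 := by
    have := Nat.cast_card_eq_zero F
    rw [hq] at this
    exact_mod_cast this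
  have h01 : ∀ c : F, c = 0 ∨ c = 1 := by
    intro c
    rcases eq_or_ne c 0 with rfl | hc
    · simp
    · right
      have := FiniteField.pow_card_sub_one_eq_one c hc
      rwa [hq, pow_one] at this
  have hcenter : ∀ c ∈ Subgroup.center (Orth F), c = 1 := by
    intro c hc
    obtain ⟨l, hl, hlc⟩ := exists_scalar_of_mem_center hc
    refine lin_ext fun v => ?_
    rcases h01 l with rfl | rfl
    · simp at hl
    · rw [hlc, one_smul, lin_one_apply]
  have key : ∀ {x₁ x₂ x₃ y₁ y₂ y₃ : Orth F}, GenTriple x₁ x₂ x₃ y₁ y₂ y₃ →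
      LinearMap.trace F _ (lin (x₁ * y₁)) ≠ LinearMap.trace F _ (lin (x₂ * y₂)) := by
    intro x₁ x₂ x₃ y₁ y₂ y₃ h e
    obtain ⟨v, hv0, hv⟩ := (h.trial_x.mul h.trial_y).exists_fixed e
    refine hv0 (eq_zero_of_card_two hq h2 h01 (hcenter _ h.sq₃) h.cube₃ ?_ hv)
    exact h.gen.trans (sup_le le_rfl fun c hc => hcenter c hc ▸ one_mem _)
  have h12 := key h
  have h23 := key h.rotate
  have h31 := key h.rotate.rotate
  rcases h01 (LinearMap.trace F _ (lin (x₁ * y₁))) with e1 | e1 <;>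
  rcases h01 (LinearMap.trace F _ (lin (x₂ * y₂))) with e2 | e2 <;>
  rcases h01 (LinearMap.trace F _ (lin (x₃ * y₃))) with e3 | e3 <;>
  first
  | exact h12 (e1.trans e2.symm)
  | exact h23 (e2.trans e3.symm)
  | exact h31 (e3.trans e1.symm)

end OmegaEight

namespace OmegaEight

variable {F : Type*} [Field F]

theorem generated_of_four_le [Fintype F] (hq : 4 ≤ Fintype.card F) : Generated F := by
  obtain ⟨n, hp, hn⟩ := FiniteField.card F (ringChar F)
  by_cases hr : ringChar F = 2
  · have h2 : (2 : F) = 0 := by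
      have := ringChar.Nat.cast_ringChar (R := F)
      rw [hr] at this
      exact_mod_cast this
    rw [hr] at hn
    rcases hq.eq_or_lt with h4 | h4
    · exact generated_four h4.symm
    · refine generated_even h2 ?_
      have : 2 < (n : ℕ) := (Nat.pow_lt_pow_iff_right (a := 2) (by norm_num)).1 (by omega)
      rw [hn]
      exact Nat.pow_le_pow_right (n := 2) (by norm_num) this
  · by_cases hprime : (Fintype.card F).Prime
    · have h6 : Fintype.card F ≠ 6 := fun h => by norm_num [h] at hprime
      have h4 : Fintype.card F ≠ 4 := fun h => by norm_num [h] at hprime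
      rcases eq_or_ne (Fintype.card F) 5 with h5 | h5
      · exact generated_five h5
      · exact generated_of_prime (by omega) hprime
    · exact generated_odd_nonprime hr hprime

theorem Generated.isTwoThreeGenerated (h : Generated F) :
    IsTwoThreeGenerated (↥(commutator (Orth F)) ⧸ Subgroup.center ↥(commutator (Orth F))) := by
  obtain ⟨x, y, hx, hy, hx2, hy3, hxy, hgen⟩ := h
  rw [← commutator_eq_siegelGroup] at hx hy hgen
  have hcomm : ∀ g h : ↥(commutator (Orth F)), g ∈ Subgroup.center ↥(commutator (Orth F)) →
      (g : Orth F) * h = h * g := fun g h hg =>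
    congrArg Subtype.val (Subgroup.mem_center_iff.1 hg h).symm
  refine ⟨((⟨x, hx⟩ : ↥(commutator (Orth F))) : _ ⧸ _),
    ((⟨y, hy⟩ : ↥(commutator (Orth F))) : _ ⧸ _), ?_, ?_, ?_⟩
  · refine orderOf_eq_prime ?_ ?_
    · rw [← QuotientGroup.mk_pow, show (⟨x, hx⟩ : ↥(commutator (Orth F))) ^ 2 = 1 from
        Subtype.ext (by simpa [pow_two] using hx2), QuotientGroup.mk_one]
    · rw [Ne, QuotientGroup.eq_one_iff]
      exact fun hc => hxy (hcomm _ ⟨y, hy⟩ hc)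
  · haveI : Fact (Nat.Prime 3) := ⟨Nat.prime_three⟩
    refine orderOf_eq_prime ?_ ?_
    · rw [← QuotientGroup.mk_pow, show (⟨y, hy⟩ : ↥(commutator (Orth F))) ^ 3 = 1 from
        Subtype.ext (by simpa using hy3), QuotientGroup.mk_one]
    · rw [Ne, QuotientGroup.eq_one_iff]
      exact fun hc => hxy (hcomm _ ⟨x, hx⟩ hc).symm
  · have htop : Subgroup.closure {(⟨x, hx⟩ : ↥(commutator (Orth F))), ⟨y, hy⟩} = ⊤ := by
      refine Subgroup.map_injective (commutator (Orth F)).subtype_injective ?_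
      rw [MonoidHom.map_closure, Set.image_pair, ← MonoidHom.range_eq_map, Subgroup.range_subtype]
      refine le_antisymm ((Subgroup.closure_le _).2 ?_) hgen
      rintro g (rfl | rfl)
      exacts [hx, hy]
    have := congrArg (Subgroup.map (QuotientGroup.mk' (Subgroup.center ↥(commutator (Orth F))))) htop
    rwa [MonoidHom.map_closure, Set.image_pair,
      Subgroup.map_top_of_surjective _ (QuotientGroup.mk'_surjective _)] at this

end OmegaEight

/-- The finite simple orthogonal groups `PΩ₈⁺(q)` (the quotient of the derived
subgroup of the orthogonal group of the plus-type form by its center) are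
`(2,3)`-generated iff `q ≥ 4`. -/
theorem pomega8plus_two_three_generated_iff
    (F : Type*) [Field F] [Fintype F] (q : ℕ) (hq : Fintype.card F = q) :
    IsTwoThreeGenerated
      (↥(commutator ↥(orthogonalGroupOf F (QPlus F))) ⧸
        Subgroup.center ↥(commutator ↥(orthogonalGroupOf F (QPlus F)))) ↔ 4 ≤ q := by
  constructor
  · intro h
    by_contra hlt
    obtain ⟨x₁, x₂, x₃, y₁, y₂, y₃, h⟩ := OmegaEight.exists_genTriple h
    have h1 := Fintype.one_lt_card (α := F)
    obtain h2 | h3 : Fintype.card F = 2 ∨ Fintype.card F = 3 := by omega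
    exacts [OmegaEight.not_genTriple_of_card_two h2 h, OmegaEight.not_genTriple_of_card_three h3 h]
  · rintro h
    subst hq
    exact (OmegaEight.generated_of_four_le h).isTwoThreeGenerated
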